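/- Let N ≥ 1 and let (x^1(t),…,x^N(t)) solve the ODE system ẋ^i = (1/4)((x^{i+1}−x^i)^2 − (x^i−x^{i−1})^2) for i = 1,…,N, with the conventions x^0 := −x^1 and x^{N+1} := 2−x^N. Let X(t,θ) solve ∂_t X = (1/2) ∂_θX ∂²_{θθ}X on (0,1) with X(t,0)=0, X(t,1)=1, starting from X_0 ∈ C^{4,α}([0,1]). Assume there are constants c_0, C_0 > 0 with c_0/N ≤ x^i(0)−x^{i−1}(0) ≤ C_0/N for all i and c_0 ≤ ∂_θX_0 ≤ C_0. Define X^i(t) := X(t,(i−1/2)/N), x̄^i(t) := x^i(N^3 t), and μ_t^N := (1/N)Σ_{i=1}^N δ_{x^i(t)}. Then there exist constants c', C' > 0, depending only on c_0, C_0 and ‖X_0‖_{C^{4,α}([0,1])}, such that for all t ≥ 0: (1/N)Σ_{i=1}^N (x̄^i(t)−X^i(t))^2 ≤ e^{−c't}·(1/N)Σ_{i=1}^N (x̄^i(0)−X^i(0))^2 + C'/N^4, and MK_1(μ_t^N, dθ) ≤ 1/(4N) + C' e^{−c' t/N^3} + C'/N^2; in particular MK_1(μ_t^N, dθ) ≤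 1/(4N) + 2C'/N^2 for all t ≥ 2N^3 log N / c'. -/

import Mathlib

open MeasureTheory

/-- The reference grid points `(i - 1/2)/N`. -/
noncomputable def grid (N i : ℕ) : ℝ := ((i : ℝ) - 1 / 2) / N

/-- Extension of a finite family `v 1, …, v N` by the boundary conventions
`v 0 := -v 1` and `v (N+1) := 2 - v N`. -/
noncomputable def pad (N : ℕ) (v : ℕ → ℝ) : ℕ → ℝ :=
  fun i => if i = 0 then -v 1 else if i = N + 1 then 2 - v N else v i

/-- `f` is of class `C^{4,α}` on `[0,1]` with all relevant norms bounded by `K`. -/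
def C4HolderBound (α K : ℝ) (f : ℝ → ℝ) : Prop :=
  ContDiff ℝ 4 f ∧
    (∀ k : ℕ, k ≤ 4 → ∀ θ ∈ Set.Icc (0 : ℝ) 1, |iteratedDeriv k f θ| ≤ K) ∧
    ∀ θ ∈ Set.Icc (0 : ℝ) 1, ∀ θ' ∈ Set.Icc (0 : ℝ) 1,
      |iteratedDeriv 4 f θ - iteratedDeriv 4 f θ'| ≤ K * |θ - θ'| ^ α

section

open Set Filter Topology

lemma nonneg_of_hasDerivAt_of_left_max {f : ℝ → ℝ} {d a t : ℝ} (hat : a < t)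
    (hf : HasDerivAt f d t) (hmax : ∀ s ∈ Ico a t, f s ≤ f t) : 0 ≤ d := by
  have h1 : HasDerivWithinAt f d (Iio t) t := hf.hasDerivWithinAt
  rw [hasDerivWithinAt_iff_tendsto_slope] at h1
  have h2 : (Iio t) \ {t} = Iio t := by
    ext x; simp
  rw [h2] at h1
  refine ge_of_tendsto h1 ?_
  filter_upwards [Ioo_mem_nhdsLT hat] with s hs
  rw [slope_def_field]
  exact div_nonneg_of_nonpos (sub_nonpos.2 (hmax s ⟨hs.1.le, hs.2⟩)) (sub_nonpos.2 hs.2.le)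

/-- Parabolic maximum principle on a compact parameter set. -/
lemma max_principle {P : Type*} [TopologicalSpace P] {S : Set P} (hS : IsCompact S) {T : ℝ}
    {F : ℝ → P → ℝ} (C : ℝ)
    (hF : ContinuousOn (Function.uncurry F) (Icc 0 T ×ˢ S))
    (h0 : ∀ p ∈ S, F 0 p ≤ 0)
    (h : ∀ t ∈ Ioc 0 T, ∀ p ∈ S, 0 < F t p → (∀ q ∈ S, F t q ≤ F t p) →
      ∃ d, HasDerivAt (fun s => F s p) d t ∧ d ≤ C * F t p) :
    ∀ t ∈ Icc 0 T, ∀ p ∈ S, F t p ≤ 0 := by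
  intro t₁ ht₁ p₁ hp₁
  by_contra! hpos
  have hT : 0 < T := by
    rcases ht₁.1.eq_or_lt with h' | h'
    · subst h'; exact absurd (h0 p₁ hp₁) (not_le.2 hpos)
    · exact h'.trans_le ht₁.2
  set m : ℝ := Real.exp (-C * t₁) * F t₁ p₁ with hm
  have hmpos : 0 < m := mul_pos (Real.exp_pos _) hpos
  set μ : ℝ := m / (2 * T) with hμ
  have hμpos : 0 < μ := by positivity
  have hμT : μ * T = m / 2 := by rw [hμ]; field_simp
  let H : ℝ × P → ℝ := fun z => Real.exp (-C * z.1) * F z.1 z.2 - μ * z.1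
  have hH : ContinuousOn H (Icc 0 T ×ˢ S) := by
    apply ContinuousOn.sub
    · exact ContinuousOn.mul (by fun_prop) hF
    · fun_prop
  obtain ⟨⟨t, p⟩, ⟨ht, hp⟩, hmax⟩ := (isCompact_Icc.prod hS).exists_isMaxOn ⟨(t₁, p₁), ht₁, hp₁⟩ hH
  simp only at ht hp
  have hHpos : 0 < H (t, p) := by
    have h1 : H (t₁, p₁) ≤ H (t, p) := hmax ⟨ht₁, hp₁⟩
    have h2 : μ * t₁ ≤ μ * T := by gcongr; exact ht₁.2
    have h3 : H (t₁, p₁) = m - μ * t₁ := rfl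
    linarith
  have hFpos : 0 < F t p := by
    have h1 : 0 < Real.exp (-C * t) * F t p := by
      have h3 : H (t, p) = Real.exp (-C * t) * F t p - μ * t := rfl
      have := mul_nonneg hμpos.le ht.1
      linarith
    exact (pos_iff_pos_of_mul_pos h1).1 (Real.exp_pos _)
  have ht0 : 0 < t := by
    rcases ht.1.eq_or_lt with h' | h'
    · subst h'; exact absurd (h0 p hp) (not_le.2 hFpos)
    · exact h'
  obtain ⟨d, hd, hdC⟩ := h t ⟨ht0, ht.2⟩ p hp hFpos (fun q hq => by
    have h1 : H (t, q) ≤ H (t, p) := hmax ⟨ht, hq⟩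
    have h2 : Real.exp (-C * t) * F t q ≤ Real.exp (-C * t) * F t p := by
      simp only [H] at h1; linarith
    exact le_of_mul_le_mul_left h2 (Real.exp_pos _))
  have hD : HasDerivAt (fun s => H (s, p))
      (Real.exp (-C * t) * (-C * 1) * F t p + Real.exp (-C * t) * d - μ * 1) t :=
    ((((hasDerivAt_id t).const_mul (-C)).exp).mul hd).sub ((hasDerivAt_id t).const_mul μ)
  have h5 := nonneg_of_hasDerivAt_of_left_max ht0 hD
    (fun s hs => hmax ⟨⟨hs.1, hs.2.le.trans ht.2⟩, hp⟩)
  have h6 : Real.exp (-C * t) * d ≤ Real.exp (-C * t) * (C * F t p) := by gcongr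
  nlinarith

lemma max_principle_backward {P : Type*} [TopologicalSpace P] {S : Set P} (hS : IsCompact S)
    {a T : ℝ} {F : ℝ → P → ℝ}
    (hF : ContinuousOn (Function.uncurry F) (Icc a T ×ˢ S))
    (h0 : ∀ p ∈ S, F T p ≤ 0)
    (h : ∀ t ∈ Ico a T, ∀ p ∈ S, 0 < F t p → (∀ q ∈ S, F t q ≤ F t p) →
      ∃ d, HasDerivAt (fun s => F s p) d t ∧ 0 ≤ d) :
    ∀ t ∈ Icc a T, ∀ p ∈ S, F t p ≤ 0 := by
  intro t ht p hp
  have := max_principle hS (T := T - a) (F := fun s p => F (T - s) p) 0 ?_ ?_ ?_ (T - t)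
    ⟨by linarith [ht.2], by linarith [ht.1]⟩ p hp
  · simpa using this
  · refine hF.comp (f := fun z : ℝ × P => (T - z.1, z.2)) (by fun_prop) ?_
    rintro ⟨s, q⟩ ⟨hs, hq⟩
    exact ⟨⟨by linarith [hs.2], by linarith [hs.1]⟩, hq⟩
  · intro q hq; simpa using h0 q hq
  · intro s hs q hq hpos hmax
    obtain ⟨d, hd, hd0⟩ := h (T - s) ⟨by linarith [hs.2], by linarith [hs.1]⟩ q hq hpos hmax
    refine ⟨-d, ?_, by linarith⟩
    have := HasDerivAt.comp_const_sub T s hd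
    simpa using this

/-- First and second order conditions at an interior local maximum. -/
lemma IsLocalMax.second_deriv_nonpos {f f' : ℝ → ℝ} {f'' x : ℝ} (hmax : IsLocalMax f x)
    (hf : ∀ᶠ y in 𝓝 x, HasDerivAt f (f' y) y) (hf' : HasDerivAt f' f'' x) :
    f' x = 0 ∧ f'' ≤ 0 := by
  have h0 : f' x = 0 := hmax.hasDerivAt_eq_zero hf.self_of_nhds
  refine ⟨h0, ?_⟩
  by_contra! hpos
  have hderiv : deriv f =ᶠ[𝓝 x] f' := hf.mono fun y hy => hy.deriv
  have hdd : deriv (deriv f) x = f'' := by rw [hderiv.deriv_eq, hf'.deriv]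
  have hmin : IsLocalMin f x := isLocalMin_of_deriv_deriv_pos (by rw [hdd]; exact hpos)
    (by rw [hf.self_of_nhds.deriv, h0]) hf.self_of_nhds.continuousAt
  have hconst : f =ᶠ[𝓝 x] fun _ => f x := by
    filter_upwards [hmin, hmax] with y h1 h2 using le_antisymm h2 h1
  have h1 : deriv f =ᶠ[𝓝 x] fun _ => 0 := by
    filter_upwards [hconst.eventuallyEq_nhds] with y hy
    rw [hy.deriv_eq]; simp
  rw [h1.deriv_eq] at hdd
  simp at hdd
  linarith

lemma ContDiff.hasDerivAt_deriv_two {f : ℝ → ℝ} (hf : ContDiff ℝ 2 f) :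
    (∀ y, HasDerivAt f (deriv f y) y) ∧
      ∀ y, HasDerivAt (deriv f) (deriv (deriv f) y) y := by
  have h1 : ContDiff ℝ 1 (deriv f) := by
    have : ContDiff ℝ (1 + 1) f := by simpa [one_add_one_eq_two] using hf
    exact (contDiff_succ_iff_deriv.1 this).2.2
  exact ⟨fun y => (hf.differentiable (by norm_num) y).hasDerivAt,
    fun y => (h1.differentiable (by norm_num) y).hasDerivAt⟩

/-- `g` is twice differentiable in space and solves `∂ₜg = (1/2) ∂_θg ∂²_θθg` at `(t, θ)`. -/
def SolvesAt (g : ℝ → ℝ → ℝ) (t θ : ℝ) : Prop :=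
  ContDiff ℝ 2 (g t) ∧
    HasDerivAt (fun s => g s θ) ((1 / 2) * deriv (g t) θ * deriv (deriv (g t)) θ) t

lemma IsLocalMax.deriv_of_sub_linear {f : ℝ → ℝ} (hf : ContDiff ℝ 2 f) {l x : ℝ}
    (hmax : IsLocalMax (fun y => f y - l * y) x) :
    deriv f x = l ∧ deriv (deriv f) x ≤ 0 := by
  obtain ⟨h1, h2⟩ := hf.hasDerivAt_deriv_two
  have := hmax.second_deriv_nonpos (f' := fun y => deriv f y - l * 1)
    (f'' := deriv (deriv f) x)
    (Eventually.of_forall fun y => (h1 y).sub ((hasDerivAt_id y).const_mul l))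
    ((h2 x).sub_const _)
  exact ⟨by linarith [this.1], this.2⟩

lemma IsLocalMin.deriv_of_sub_linear {f : ℝ → ℝ} (hf : ContDiff ℝ 2 f) {l x : ℝ}
    (hmin : IsLocalMin (fun y => f y - l * y) x) :
    deriv f x = l ∧ 0 ≤ deriv (deriv f) x := by
  obtain ⟨h1, h2⟩ := hf.hasDerivAt_deriv_two
  have := (hmin.neg).second_deriv_nonpos (f' := fun y => -(deriv f y - l * 1))
    (f'' := -deriv (deriv f) x)
    (Eventually.of_forall fun y => ((h1 y).sub ((hasDerivAt_id y).const_mul l)).neg)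
    ((h2 x).sub_const _).neg
  exact ⟨by linarith [this.1], by linarith [this.2]⟩

lemma isLocalMax_of_Icc {f : ℝ → ℝ} {a b x : ℝ} (hx : x ∈ Ioo a b)
    (h : ∀ y ∈ Icc a b, f y ≤ f x) : IsLocalMax f x := by
  filter_upwards [Ioo_mem_nhds hx.1 hx.2] with y hy using h y ⟨hy.1.le, hy.2.le⟩

lemma isLocalMin_of_Icc {f : ℝ → ℝ} {a b x : ℝ} (hx : x ∈ Ioo a b)
    (h : ∀ y ∈ Icc a b, f x ≤ f y) : IsLocalMin f x := by
  filter_upwards [Ioo_mem_nhds hx.1 hx.2] with y hy using h y ⟨hy.1.le, hy.2.le⟩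

lemma ContinuousOn.exists_right_bound {f : ℝ → ℝ} {T e c : ℝ} (hT : 0 < T)
    (hf : ContinuousWithinAt f (Icc 0 T) 0) (he : |f 0 - c| < e) :
    ∃ T' ∈ Ioc 0 T, ∀ t ∈ Icc 0 T', |f t - c| ≤ e := by
  have h1 : ∀ᶠ t in 𝓝[Icc 0 T] 0, |f t - c| < e :=
    ((hf.sub continuousWithinAt_const).abs).eventually (gt_mem_nhds he)
  rw [eventually_nhdsWithin_iff, Metric.eventually_nhds_iff] at h1
  obtain ⟨r, hr, h⟩ := h1
  refine ⟨min T (r / 2), ⟨by positivity, min_le_left _ _⟩, fun t ht => ?_⟩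
  have h2 : t ≤ r / 2 := ht.2.trans (min_le_right _ _)
  refine (h ?_ ⟨ht.1, ht.2.trans (min_le_left _ _)⟩).le
  rw [Real.dist_eq, sub_zero, abs_of_nonneg ht.1]
  linarith

/-- A corner of a space-time rectangle is a removable singularity. -/
lemma corner_continuous {g : ℝ → ℝ → ℝ} {T D : ℝ} (hT : 0 < T) (hD : 0 < D)
    (hc : ContinuousOn (Function.uncurry g) ((Icc 0 T ×ˢ Icc 0 D) \ {(0, 0)}))
    (ht : ContinuousWithinAt (fun t => g t 0) (Icc 0 T) 0)
    (hθ : ContinuousWithinAt (fun θ => g 0 θ) (Icc 0 D) 0)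
    (hg : ∀ t ∈ Ioo 0 T, ∀ θ ∈ Ioo 0 D, SolvesAt g t θ) {e : ℝ} (he : 0 < e) :
    ∃ δ > 0, ∀ t ∈ Icc 0 δ, ∀ θ ∈ Icc 0 δ, |g t θ - g 0 0| ≤ 10 * e := by
  set c := g 0 0 with hcdef
  have hcolc : ∀ η ∈ Ioc 0 D, ContinuousWithinAt (fun t => g t η) (Icc 0 T) 0 := by
    intro η hη
    have h1 := hc (0, η) ⟨⟨⟨le_rfl, hT.le⟩, hη.1.le, hη.2⟩, by simp [hη.1.ne']⟩
    refine ContinuousWithinAt.comp (f := fun t : ℝ => (t, η)) h1 (by fun_prop) ?_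
    intro t ht'
    exact ⟨⟨ht', hη.1.le, hη.2⟩, by simp [hη.1.ne']⟩
  obtain ⟨B, hB, hBb⟩ := ContinuousOn.exists_right_bound hD hθ (c := c) (e := e)
    (by simpa [hcdef] using he)
  obtain ⟨T₁, hT₁, hT₁b⟩ := ContinuousOn.exists_right_bound hT ht (c := c) (e := e)
    (by simpa [hcdef] using he)
  obtain ⟨T₂, hT₂, hT₂b⟩ := ContinuousOn.exists_right_bound hT (hcolc B hB) (c := c) (e := 2 * e)
    (by have := hBb B ⟨hB.1.le, le_rfl⟩; linarith)
  set A : ℝ := min T₁ T₂ / 2 with hA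
  have hT₁0 := hT₁.1
  have hT₂0 := hT₂.1
  have hA0 : 0 < A := by positivity
  have hA1 : A ≤ T₁ := by have := min_le_left T₁ T₂; linarith
  have hA2 : A ≤ T₂ := by have := min_le_right T₁ T₂; linarith
  have hAT : A < T := by have := min_le_left T₁ T₂; linarith [hT₁.2]
  have hl : ∀ t ∈ Icc 0 A, |g t 0 - c| ≤ e := fun t h => hT₁b t ⟨h.1, h.2.trans hA1⟩
  have hr : ∀ t ∈ Icc 0 A, |g t B - c| ≤ 2 * e := fun t h => hT₂b t ⟨h.1, h.2.trans hA2⟩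
  -- continuity away from `t = 0`
  have hcc : ∀ a > 0, ContinuousOn (Function.uncurry g) (Icc a A ×ˢ Icc 0 B) := by
    intro a ha
    refine hc.mono ?_
    rintro ⟨t, θ⟩ ⟨h1, h2⟩
    refine ⟨⟨⟨ha.le.trans h1.1, h1.2.trans hAT.le⟩, h2.1, h2.2.trans hB.2⟩, ?_⟩
    simp only [mem_singleton_iff, Prod.mk.injEq, not_and]
    intro h3; exact absurd (ha.trans_le h1.1) (by simp [h3])
  have hPDE : ∀ a > 0, ∀ t ∈ Ico a A, ∀ θ ∈ Ioo 0 B, SolvesAt g t θ := fun a ha t h θ h' =>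
    hg t ⟨ha.trans_le h.1, h.2.trans hAT⟩ θ ⟨h'.1, h'.2.trans_le hB.2⟩
  -- the top profile
  have htop : ContinuousOn (fun θ => g A θ) (Icc 0 B) := by
    refine (hcc A hA0).comp (f := fun θ : ℝ => (A, θ)) (by fun_prop) ?_
    intro θ hθ'; exact ⟨⟨le_rfl, le_rfl⟩, hθ'⟩
  obtain ⟨η, hη, hηb⟩ := ContinuousOn.exists_right_bound hB.1
    (htop 0 ⟨le_rfl, hB.1.le⟩) (c := c) (e := 2 * e)
    (by have := hl A ⟨hA0.le, le_rfl⟩; linarith)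
  have hη0 := hη.1
  obtain ⟨m, hm⟩ : ∃ m : ℝ, ∀ θ ∈ Icc 0 B, |g A θ - c| ≤ m := by
    obtain ⟨m, hm⟩ := (isCompact_Icc (a := (0 : ℝ)) (b := B)).exists_bound_of_continuousOn
      (htop.sub (continuousOn_const (c := c)))
    exact ⟨m, fun θ hθ' => by simpa using hm θ hθ'⟩
  have hm0 : 0 ≤ m := (abs_nonneg _).trans (hm 0 ⟨le_rfl, hB.1.le⟩)
  set l : ℝ := (2 * m + 2 * e + 1) / η with hldef
  have hl0 : 0 < l := by positivity
  have hlη : l * η = 2 * m + 2 * e + 1 := by rw [hldef]; field_simp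
  have hlη' : ∀ θ, η ≤ θ → 2 * m + 2 * e + 1 ≤ l * θ := fun θ h => by
    rw [← hlη]; gcongr
  -- lower bound
  have hlow : ∀ t ∈ Ioc 0 A, ∀ θ ∈ Icc 0 B, c - 2 * e - l * θ ≤ g t θ := by
    intro t ht' θ hθ'
    have := max_principle_backward (isCompact_Icc (a := (0 : ℝ)) (b := B)) (a := t) (T := A)
      (F := fun t θ => c - 2 * e - (g t θ + l * θ)) ?_ ?_ ?_ t ⟨le_rfl, ht'.2⟩ θ hθ'
    · linarith
    · have := hcc t ht'.1
      have h2 : ContinuousOn (fun z : ℝ × ℝ => c - 2 * e - (Function.uncurry g z + l * z.2))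
        (Icc t A ×ˢ Icc 0 B) := by fun_prop
      exact h2
    · intro θ hθ
      rcases le_total θ η with h | h
      · have := (abs_le.1 (hηb θ ⟨hθ.1, h⟩)).1
        have := mul_nonneg hl0.le hθ.1
        linarith
      · have := (abs_le.1 (hm θ hθ)).1
        linarith [hlη' θ h]
    · intro s hs θ hθ hpos hmax
      have hs0 : 0 < s := ht'.1.trans_le hs.1
      have hθi : θ ∈ Ioo 0 B := by
        refine ⟨lt_of_le_of_ne hθ.1 ?_, lt_of_le_of_ne hθ.2 ?_⟩
        · rintro rfl
          have := (abs_le.1 (hl s ⟨hs0.le, hs.2.le⟩)).1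
          linarith
        · rintro rfl
          have := (abs_le.1 (hr s ⟨hs0.le, hs.2.le⟩)).1
          have := mul_nonneg hl0.le hθ.1
          linarith
      obtain ⟨h1, h2⟩ := hPDE t ht'.1 s hs θ hθi
      have h3 : IsLocalMin (fun y => g s y - (-l) * y) θ := isLocalMin_of_Icc hθi fun y hy => by
        have := hmax y hy; linarith
      obtain ⟨h4, h5⟩ := h3.deriv_of_sub_linear h1
      refine ⟨_, (h2.add_const (l * θ)).const_sub (c - 2 * e), ?_⟩
      rw [h4]
      have := mul_nonneg hl0.le h5
      linarith
  -- upper bound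
  have hup : ∀ t ∈ Ioc 0 A, ∀ θ ∈ Icc 0 B, g t θ ≤ c + m + 2 * e := by
    intro t ht' θ hθ'
    have := max_principle_backward (isCompact_Icc (a := (0 : ℝ)) (b := B)) (a := t) (T := A)
      (F := fun t θ => g t θ - (c + m + 2 * e)) ?_ ?_ ?_ t ⟨le_rfl, ht'.2⟩ θ hθ'
    · linarith
    · exact (hcc t ht'.1).sub continuousOn_const
    · intro θ hθ
      have := (abs_le.1 (hm θ hθ)).2
      linarith
    · intro s hs θ hθ hpos hmax
      have hs0 : 0 < s := ht'.1.trans_le hs.1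
      have hθi : θ ∈ Ioo 0 B := by
        refine ⟨lt_of_le_of_ne hθ.1 ?_, lt_of_le_of_ne hθ.2 ?_⟩
        · rintro rfl
          have := (abs_le.1 (hl s ⟨hs0.le, hs.2.le⟩)).2
          linarith
        · rintro rfl
          have := (abs_le.1 (hr s ⟨hs0.le, hs.2.le⟩)).2
          linarith
      obtain ⟨h1, h2⟩ := hPDE t ht'.1 s hs θ hθi
      have h3 : IsLocalMax (fun y => g s y - 0 * y) θ := isLocalMax_of_Icc hθi fun y hy => by
        have := hmax y hy; linarith
      obtain ⟨h4, -⟩ := h3.deriv_of_sub_linear h1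
      refine ⟨_, h2.sub_const _, ?_⟩
      rw [h4]; simp
  -- a second slope, large enough for the doubling argument
  set l' : ℝ := max l ((m + 4 * e) / B) with hl'
  have hB0 := hB.1
  have hl'0 : 0 < l' := hl0.trans_le (le_max_left _ _)
  have hll' : l ≤ l' := le_max_left _ _
  have hl'B : m + 4 * e ≤ l' * B := by
    have : (m + 4 * e) / B ≤ l' := le_max_right _ _
    rwa [div_le_iff₀ hB.1] at this
  have hdrop : ∀ t ∈ Ioc 0 A, ∀ θ₁ ∈ Icc 0 B, ∀ θ₂ ∈ Icc 0 B, θ₁ ≤ θ₂ →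
      g t θ₁ ≤ g t θ₂ + l' * θ₂ + 4 * e := by
    intro t ht' θ₁ hθ₁ θ₂ hθ₂ h12
    have hScl : IsClosed {z : ℝ × ℝ | z.1 ≤ z.2} := isClosed_le continuous_fst continuous_snd
    have hS : IsCompact ((Icc 0 B ×ˢ Icc 0 B) ∩ {z : ℝ × ℝ | z.1 ≤ z.2}) :=
      (isCompact_Icc.prod isCompact_Icc).inter_right hScl
    have := max_principle_backward hS (a := t) (T := A)
      (F := fun t z => g t z.1 - g t z.2 - l' * z.2 - 4 * e) ?_ ?_ ?_ t ⟨le_rfl, ht'.2⟩ (θ₁, θ₂)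
      ⟨⟨hθ₁, hθ₂⟩, h12⟩
    · linarith
    · have h0 := hcc t ht'.1
      have h1 : ContinuousOn (fun z : ℝ × ℝ × ℝ => g z.1 z.2.1)
          (Icc t A ×ˢ ((Icc 0 B ×ˢ Icc 0 B) ∩ {z : ℝ × ℝ | z.1 ≤ z.2})) :=
        h0.comp (f := fun z : ℝ × ℝ × ℝ => (z.1, z.2.1)) (by fun_prop)
          (fun z hz => ⟨hz.1, hz.2.1.1⟩)
      have h2 : ContinuousOn (fun z : ℝ × ℝ × ℝ => g z.1 z.2.2)
          (Icc t A ×ˢ ((Icc 0 B ×ˢ Icc 0 B) ∩ {z : ℝ × ℝ | z.1 ≤ z.2})) :=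
        h0.comp (f := fun z : ℝ × ℝ × ℝ => (z.1, z.2.2)) (by fun_prop)
          (fun z hz => ⟨hz.1, hz.2.1.2⟩)
      have h3 : ContinuousOn (fun z : ℝ × ℝ × ℝ => g z.1 z.2.1 - g z.1 z.2.2 - l' * z.2.2 - 4 * e)
          (Icc t A ×ˢ ((Icc 0 B ×ˢ Icc 0 B) ∩ {z : ℝ × ℝ | z.1 ≤ z.2})) :=
        ((h1.sub h2).sub (by fun_prop)).sub continuousOn_const
      exact h3
    · rintro ⟨x, y⟩ ⟨⟨hx, hy⟩, hxy⟩
      simp only [mem_ofPred_eq] at hx hy hxy ⊢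
      rcases le_total y η with h | h
      · have h1 := (abs_le.1 (hηb y ⟨hy.1, h⟩)).1
        have h2 := (abs_le.1 (hηb x ⟨hx.1, hxy.trans h⟩)).2
        have := mul_nonneg hl'0.le hy.1
        linarith
      · have h1 := (abs_le.1 (hm y hy)).1
        have h2 := (abs_le.1 (hm x hx)).2
        have h3 : l * y ≤ l' * y := mul_le_mul_of_nonneg_right hll' hy.1
        linarith [hlη' y h]
    · rintro s hs ⟨x, y⟩ ⟨⟨hx, hy⟩, hxy⟩ hpos hmax
      simp only [mem_ofPred_eq] at hx hy hxy hpos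
      have hs0 : 0 < s := ht'.1.trans_le hs.1
      have hsA : s ∈ Ioc 0 A := ⟨hs0, hs.2.le⟩
      have hyl : 0 ≤ l' * y := mul_nonneg hl'0.le hy.1
      have hlt : x < y := by
        refine lt_of_le_of_ne hxy ?_
        rintro rfl
        linarith
      have hx0 : 0 < x := by
        refine lt_of_le_of_ne hx.1 ?_
        rintro rfl
        have h1 := (abs_le.1 (hl s ⟨hs0.le, hs.2.le⟩)).2
        have h2 := hlow s hsA y hy
        have h3 : l * y ≤ l' * y := mul_le_mul_of_nonneg_right hll' hy.1
        linarith
      have hyB : y < B := by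
        refine lt_of_le_of_ne hy.2 ?_
        rintro rfl
        have h1 := (abs_le.1 (hr s ⟨hs0.le, hs.2.le⟩)).1
        have h2 := hup s hsA x hx
        linarith
      obtain ⟨h1, h2⟩ := hPDE t ht'.1 s hs x ⟨hx0, hlt.trans hyB⟩
      obtain ⟨-, h2'⟩ := hPDE t ht'.1 s hs y ⟨hx0.trans hlt, hyB⟩
      have h3 : IsLocalMax (fun z => g s z - 0 * z) x :=
        isLocalMax_of_Icc (a := 0) (b := y) ⟨hx0, hlt⟩ fun z hz => by
          have := hmax (z, y) ⟨⟨⟨hz.1, hz.2.trans hy.2⟩, hy⟩, hz.2⟩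
          linarith
      have h4 : IsLocalMin (fun z => g s z - (-l') * z) y :=
        isLocalMin_of_Icc (a := x) (b := B) ⟨hlt, hyB⟩ fun z hz => by
          have := hmax (x, z) ⟨⟨hx, ⟨hx.1.trans hz.1, hz.2⟩⟩, hz.1⟩
          linarith
      obtain ⟨h5, -⟩ := h3.deriv_of_sub_linear h1
      obtain ⟨h6, h7⟩ := h4.deriv_of_sub_linear h1
      refine ⟨_, ((h2.sub h2').sub_const (l' * y)).sub_const (4 * e), ?_⟩
      rw [h5, h6]
      have := mul_nonneg hl'0.le h7
      linarith
  -- conclusion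
  set ζ : ℝ := min B (e / l') with hζ
  have hζ0 : 0 < ζ := by positivity
  have hζB : ζ ≤ B := min_le_left _ _
  have hζl : l' * ζ ≤ e := by
    have : ζ ≤ e / l' := min_le_right _ _
    rw [le_div_iff₀ hl'0] at this; linarith
  obtain ⟨T₃, hT₃, hT₃b⟩ := ContinuousOn.exists_right_bound hT
    (hcolc ζ ⟨hζ0, hζB.trans hB.2⟩) (c := c) (e := 2 * e)
    (by have := hBb ζ ⟨hζ0.le, hζB⟩; linarith)
  have hT₃0 := hT₃.1
  refine ⟨min ζ (min A T₃), by positivity, fun t ht' θ hθ' => ?_⟩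
  have hθζ : θ ≤ ζ := hθ'.2.trans (min_le_left _ _)
  have htA : t ≤ A := ht'.2.trans ((min_le_right _ _).trans (min_le_left _ _))
  have htT : t ≤ T₃ := ht'.2.trans ((min_le_right _ _).trans (min_le_right _ _))
  rcases ht'.1.eq_or_lt with h | h
  · rw [← h]
    have := hBb θ ⟨hθ'.1, hθζ.trans hζB⟩
    linarith
  · have h1 := hlow t ⟨h, htA⟩ θ ⟨hθ'.1, hθζ.trans hζB⟩
    have h2 := hdrop t ⟨h, htA⟩ θ ⟨hθ'.1, hθζ.trans hζB⟩ ζ ⟨hζ0.le, hζB⟩ hθζ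
    have h3 := (abs_le.1 (hT₃b t ⟨h.le, htT⟩)).2
    have h4 : l * θ ≤ l' * ζ := mul_le_mul hll' hθζ hθ'.1 hl'0.le
    rw [abs_le]
    constructor <;> linarith

/-- Reflections and translations preserve the equation up to the appropriate sign. -/
lemma SolvesAt.flip {g : ℝ → ℝ → ℝ} {t₀ θ₀ ε₁ ε₂ t θ : ℝ} (h₂ : ε₂ ^ 2 = 1)
    (h : SolvesAt g (t₀ + ε₁ * t) (θ₀ + ε₂ * θ)) :
    SolvesAt (fun t θ => ε₁ * ε₂ * g (t₀ + ε₁ * t) (θ₀ + ε₂ * θ)) t θ := by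
  obtain ⟨hc, hd⟩ := h
  obtain ⟨h3, h4⟩ := hc.hasDerivAt_deriv_two
  have haff : ∀ y, HasDerivAt (fun y => θ₀ + ε₂ * y) ε₂ y := fun y => by
    simpa using ((hasDerivAt_id y).const_mul ε₂).const_add θ₀
  have hafft : HasDerivAt (fun y => t₀ + ε₁ * y) ε₁ t := by
    simpa using ((hasDerivAt_id t).const_mul ε₁).const_add t₀
  have e1 : ∀ y, HasDerivAt (fun θ => ε₁ * ε₂ * g (t₀ + ε₁ * t) (θ₀ + ε₂ * θ))
      (ε₁ * ε₂ * (deriv (g (t₀ + ε₁ * t)) (θ₀ + ε₂ * y) * ε₂)) y := fun y =>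
    ((h3 _).comp y (haff y)).const_mul _
  have e2 : ∀ y, HasDerivAt (fun y => ε₁ * ε₂ * (deriv (g (t₀ + ε₁ * t)) (θ₀ + ε₂ * y) * ε₂))
      (ε₁ * ε₂ * (deriv (deriv (g (t₀ + ε₁ * t))) (θ₀ + ε₂ * y) * ε₂ * ε₂)) y := fun y =>
    (((h4 _).comp y (haff y)).mul_const _).const_mul _
  have e1' : deriv (fun θ => ε₁ * ε₂ * g (t₀ + ε₁ * t) (θ₀ + ε₂ * θ)) =
      fun y => ε₁ * ε₂ * (deriv (g (t₀ + ε₁ * t)) (θ₀ + ε₂ * y) * ε₂) :=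
    funext fun y => (e1 y).deriv
  refine ⟨?_, ?_⟩
  · have : ContDiff ℝ 2 (fun θ => θ₀ + ε₂ * θ) := by fun_prop
    exact contDiff_const.mul (hc.comp this)
  · rw [e1', (e2 θ).deriv]
    have h5 := (hd.comp t hafft).const_mul (ε₁ * ε₂)
    refine h5.congr_deriv ?_
    linear_combination (-(1 / 2 * deriv (g (t₀ + ε₁ * t)) (θ₀ + ε₂ * θ) *
      deriv (deriv (g (t₀ + ε₁ * t))) (θ₀ + ε₂ * θ) * ε₂ * ε₁ ^ 2 * (ε₂ ^ 2 + 1))) * h₂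

lemma corner_continuous_flip {g : ℝ → ℝ → ℝ} {t₀ θ₀ ε₁ ε₂ T D : ℝ} (h₁ : ε₁ ^ 2 = 1)
    (h₂ : ε₂ ^ 2 = 1) (hT : 0 < T) (hD : 0 < D) {B : Set (ℝ × ℝ)}
    (hB : ∀ t ∈ Icc 0 T, ∀ θ ∈ Icc 0 D, (t, θ) ≠ (0, 0) → (t₀ + ε₁ * t, θ₀ + ε₂ * θ) ∈ B)
    (hc : ContinuousOn (Function.uncurry g) B)
    (ht : ContinuousOn (fun t => g (t₀ + ε₁ * t) θ₀) (Icc 0 T))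
    (hθ : ContinuousOn (fun θ => g t₀ (θ₀ + ε₂ * θ)) (Icc 0 D))
    (hg : ∀ t ∈ Ioo 0 T, ∀ θ ∈ Ioo 0 D, SolvesAt g (t₀ + ε₁ * t) (θ₀ + ε₂ * θ))
    {e : ℝ} (he : 0 < e) :
    ∃ δ > 0, ∀ t ∈ Icc 0 δ, ∀ θ ∈ Icc 0 δ, |g (t₀ + ε₁ * t) (θ₀ + ε₂ * θ) - g t₀ θ₀| ≤ e := by
  have habs : |ε₁ * ε₂| = 1 := by
    rw [← abs_one, ← sq_eq_sq_iff_abs_eq_abs, mul_pow, h₁, h₂]; norm_num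
  have k1 : ContinuousOn (fun z : ℝ × ℝ => Function.uncurry g (t₀ + ε₁ * z.1, θ₀ + ε₂ * z.2))
      ((Icc 0 T ×ˢ Icc 0 D) \ {(0, 0)}) :=
    hc.comp (f := fun z : ℝ × ℝ => (t₀ + ε₁ * z.1, θ₀ + ε₂ * z.2)) (by fun_prop)
      (fun z hz => hB z.1 hz.1.1 z.2 hz.1.2 hz.2)
  have k2 := (continuousOn_const (c := ε₁ * ε₂)).mul ht 0 ⟨le_rfl, hT.le⟩
  have k3 := (continuousOn_const (c := ε₁ * ε₂)).mul hθ 0 ⟨le_rfl, hD.le⟩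
  obtain ⟨δ, hδ, h⟩ := corner_continuous
    (g := fun t θ => ε₁ * ε₂ * g (t₀ + ε₁ * t) (θ₀ + ε₂ * θ)) hT hD
    ((continuousOn_const (c := ε₁ * ε₂)).mul k1)
    (by simp only [mul_zero, add_zero]; exact k2) (by simp only [mul_zero, add_zero]; exact k3)
    (fun t ht θ hθ => (hg t ht θ hθ).flip h₂) (e := e / 10) (by positivity)
  refine ⟨δ, hδ, fun t ht θ hθ => ?_⟩
  have := h t ht θ hθ
  simp only [mul_zero, add_zero] at this
  rw [← mul_sub, abs_mul, habs] at this
  linarith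

/-- Continuity of a function of two variables at a point follows from bounds in the
four quadrants, or in those of them which meet the domain. -/
lemma continuousWithinAt_of_quadrants {g : ℝ → ℝ → ℝ} {S : Set (ℝ × ℝ)} {t₀ θ₀ : ℝ}
    (h : ∀ e > 0, ∃ δ > 0, ∀ t θ, (t, θ) ∈ S → |t - t₀| ≤ δ → |θ - θ₀| ≤ δ →
      |g t θ - g t₀ θ₀| ≤ e) :
    ContinuousWithinAt (Function.uncurry g) S (t₀, θ₀) := by
  rw [Metric.continuousWithinAt_iff]
  intro e he
  obtain ⟨δ, hδ, h⟩ := h (e / 2) (by positivity)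
  refine ⟨δ, hδ, ?_⟩
  rintro ⟨t, θ⟩ hS hd
  rw [Prod.dist_eq, max_lt_iff, Real.dist_eq, Real.dist_eq] at hd
  rw [Real.dist_eq]
  have := h t θ hS hd.1.le hd.2.le
  simp only [Function.uncurry]
  linarith

lemma rect_continuousOn {g : ℝ → ℝ → ℝ} {a a' b b' : ℝ} (ha : a < a') (hb : b < b')
    (hc : ContinuousOn (Function.uncurry g)
      ((Icc a a' ×ˢ Icc b b') \ {z | (z.1 = a ∨ z.1 = a') ∧ (z.2 = b ∨ z.2 = b')}))
    (hrow : ∀ t ∈ Icc a a', ContinuousOn (fun θ => g t θ) (Icc b b'))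
    (hcol : ∀ θ ∈ Icc b b', ContinuousOn (fun t => g t θ) (Icc a a'))
    (hg : ∀ t ∈ Ioo a a', ∀ θ ∈ Ioo b b', SolvesAt g t θ) :
    ContinuousOn (Function.uncurry g) (Icc a a' ×ˢ Icc b b') := by
  rintro ⟨t₀, θ₀⟩ ⟨h1, h2⟩
  simp only at h1 h2
  by_cases hcorner : (t₀ = a ∨ t₀ = a') ∧ (θ₀ = b ∨ θ₀ = b')
  swap
  · have h3 := hc (t₀, θ₀) ⟨⟨h1, h2⟩, hcorner⟩
    refine h3.mono_of_mem_nhdsWithin ?_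
    have hcl : IsClosed {z : ℝ × ℝ | (z.1 = a ∨ z.1 = a') ∧ (z.2 = b ∨ z.2 = b')} := by
      refine IsClosed.inter (IsClosed.union ?_ ?_) (IsClosed.union ?_ ?_) <;>
      exact isClosed_eq (by fun_prop) (by fun_prop)
    exact inter_mem self_mem_nhdsWithin
      (mem_nhdsWithin_of_mem_nhds (hcl.isOpen_compl.mem_nhds hcorner))
  · obtain ⟨hE1, hE2⟩ := hcorner
    obtain ⟨ε₁, hε₁, hA⟩ : ∃ ε₁ : ℝ, ε₁ ^ 2 = 1 ∧ ((t₀ = a ∧ ε₁ = 1) ∨ (t₀ = a' ∧ ε₁ = -1)) := by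
      rcases hE1 with h | h
      · exact ⟨1, by norm_num, Or.inl ⟨h, rfl⟩⟩
      · exact ⟨-1, by norm_num, Or.inr ⟨h, rfl⟩⟩
    obtain ⟨ε₂, hε₂, hB⟩ : ∃ ε₂ : ℝ, ε₂ ^ 2 = 1 ∧ ((θ₀ = b ∧ ε₂ = 1) ∨ (θ₀ = b' ∧ ε₂ = -1)) := by
      rcases hE2 with h | h
      · exact ⟨1, by norm_num, Or.inl ⟨h, rfl⟩⟩
      · exact ⟨-1, by norm_num, Or.inr ⟨h, rfl⟩⟩
    have hm1 : ∀ t ∈ Icc 0 ((a' - a) / 2), t₀ + ε₁ * t ∈ Icc a a' ∧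
        ((t₀ + ε₁ * t = a ∨ t₀ + ε₁ * t = a') → t = 0) := by
      rintro t ⟨ht1, ht2⟩
      rcases hA with ⟨rfl, rfl⟩ | ⟨rfl, rfl⟩
      · refine ⟨⟨by linarith, by linarith⟩, ?_⟩
        rintro (h | h) <;> linarith
      · refine ⟨⟨by linarith, by linarith⟩, ?_⟩
        rintro (h | h) <;> linarith
    have hm2 : ∀ t ∈ Icc 0 ((b' - b) / 2), θ₀ + ε₂ * t ∈ Icc b b' ∧
        ((θ₀ + ε₂ * t = b ∨ θ₀ + ε₂ * t = b') → t = 0) := by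
      rintro t ⟨ht1, ht2⟩
      rcases hB with ⟨rfl, rfl⟩ | ⟨rfl, rfl⟩
      · refine ⟨⟨by linarith, by linarith⟩, ?_⟩
        rintro (h | h) <;> linarith
      · refine ⟨⟨by linarith, by linarith⟩, ?_⟩
        rintro (h | h) <;> linarith
    apply continuousWithinAt_of_quadrants
    intro e he
    have hsol : ∀ t ∈ Ioo 0 ((a' - a) / 2), ∀ θ ∈ Ioo 0 ((b' - b) / 2),
        SolvesAt g (t₀ + ε₁ * t) (θ₀ + ε₂ * θ) := by
      rintro t ⟨ht, ht'⟩ θ ⟨hθ, hθ'⟩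
      apply hg
      · rcases hA with ⟨rfl, rfl⟩ | ⟨rfl, rfl⟩ <;> constructor <;> linarith
      · rcases hB with ⟨rfl, rfl⟩ | ⟨rfl, rfl⟩ <;> constructor <;> linarith
    obtain ⟨δ, hδ, h⟩ := corner_continuous_flip (g := g) (t₀ := t₀) (θ₀ := θ₀) hε₁ hε₂
      (T := (a' - a) / 2) (D := (b' - b) / 2) (by linarith) (by linarith)
      (B := (Icc a a' ×ˢ Icc b b') \ {z | (z.1 = a ∨ z.1 = a') ∧ (z.2 = b ∨ z.2 = b')})
      (fun t ht θ hθ hne => ⟨⟨(hm1 t ht).1, (hm2 θ hθ).1⟩, fun hcor =>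
        hne (by rw [(hm1 t ht).2 hcor.1, (hm2 θ hθ).2 hcor.2])⟩) hc
      ((hcol θ₀ h2).comp (by fun_prop) (fun t ht => (hm1 t ht).1))
      ((hrow t₀ h1).comp (by fun_prop) (fun t ht => (hm2 t ht).1))
      hsol he
    · refine ⟨δ, hδ, fun t θ hS ht hθ => ?_⟩
      have k1 : ε₁ * (t - t₀) ∈ Icc 0 δ := by
        have := hS.1.1
        have := hS.1.2
        rw [abs_le] at ht
        simp only at *
        rcases hA with ⟨rfl, rfl⟩ | ⟨rfl, rfl⟩ <;> constructor <;> linarith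
      have k2 : ε₂ * (θ - θ₀) ∈ Icc 0 δ := by
        have := hS.2.1
        have := hS.2.2
        rw [abs_le] at hθ
        simp only at *
        rcases hB with ⟨rfl, rfl⟩ | ⟨rfl, rfl⟩ <;> constructor <;> linarith
      have := h _ k1 _ k2
      rwa [show t₀ + ε₁ * (ε₁ * (t - t₀)) = t by linear_combination (t - t₀) * hε₁,
        show θ₀ + ε₂ * (ε₂ * (θ - θ₀)) = θ by linear_combination (θ - θ₀) * hε₂] at this

lemma rect_bound {g : ℝ → ℝ → ℝ} {a a' b b' c σ : ℝ}
    (hc : ContinuousOn (Function.uncurry g) (Icc a a' ×ˢ Icc b b'))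
    (hg : ∀ t ∈ Ioo a a', ∀ θ ∈ Ioo b b', SolvesAt g t θ)
    (hside : ∀ t ∈ Icc a a', |g t b - c| ≤ σ ∧ |g t b' - c| ≤ σ)
    (hside' : ∀ θ ∈ Icc b b', |g a θ - c| ≤ σ ∧ |g a' θ - c| ≤ σ) :
    ∀ t ∈ Icc a a', ∀ θ ∈ Icc b b', |g t θ - c| ≤ σ := by
  have hinside : ∀ t ∈ Ico a a', ∀ θ ∈ Icc b b', σ < |g t θ - c| → t ∈ Ioo a a' ∧ θ ∈ Ioo b b' := by
    intro t ht θ hθ hlt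
    refine ⟨⟨lt_of_le_of_ne ht.1 ?_, ht.2⟩, lt_of_le_of_ne hθ.1 ?_, lt_of_le_of_ne hθ.2 ?_⟩
    · rintro rfl; exact absurd (hside' θ hθ).1 (not_le.2 hlt)
    · rintro rfl; exact absurd (hside t ⟨ht.1, ht.2.le⟩).1 (not_le.2 hlt)
    · rintro rfl; exact absurd (hside t ⟨ht.1, ht.2.le⟩).2 (not_le.2 hlt)
  have hup : ∀ t ∈ Icc a a', ∀ θ ∈ Icc b b', g t θ - c - σ ≤ 0 := by
    refine max_principle_backward isCompact_Icc ?_ ?_ ?_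
    · exact (hc.sub continuousOn_const).sub continuousOn_const
    · intro θ hθ; have := (abs_le.1 (hside' θ hθ).2).2; linarith
    · intro t ht θ hθ hpos hmax
      obtain ⟨h1, h2⟩ := hinside t ht θ hθ (by have := le_abs_self (g t θ - c); linarith)
      obtain ⟨h3, h4⟩ := hg t h1 θ h2
      obtain ⟨h5, -⟩ := IsLocalMax.deriv_of_sub_linear (l := 0) h3
        (isLocalMax_of_Icc h2 fun y hy => by have := hmax y hy; linarith)
      exact ⟨_, (h4.sub_const c).sub_const σ, by rw [h5]; simp⟩
  have hlo : ∀ t ∈ Icc a a', ∀ θ ∈ Icc b b', c - g t θ - σ ≤ 0 := by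
    refine max_principle_backward isCompact_Icc ?_ ?_ ?_
    · exact (continuousOn_const.sub hc).sub continuousOn_const
    · intro θ hθ; have := (abs_le.1 (hside' θ hθ).2).1; linarith
    · intro t ht θ hθ hpos hmax
      obtain ⟨h1, h2⟩ := hinside t ht θ hθ (by have := neg_abs_le (g t θ - c); linarith)
      obtain ⟨h3, h4⟩ := hg t h1 θ h2
      obtain ⟨h5, -⟩ := IsLocalMin.deriv_of_sub_linear (l := 0) h3
        (isLocalMin_of_Icc h2 fun y hy => by have := hmax y hy; linarith)
      exact ⟨_, (h4.const_sub c).sub_const σ, by rw [h5]; simp⟩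
  intro t ht θ hθ
  have := hup t ht θ hθ
  have := hlo t ht θ hθ
  rw [abs_le]; constructor <;> linarith

lemma IsClosed.exists_gap {R : Set ℝ} (hR : IsClosed R) {a b t : ℝ} (ha : a ∈ R) (hb : b ∈ R)
    (hat : a ≤ t) (htb : t ≤ b) (ht : t ∉ R) :
    ∃ u ∈ R, ∃ v ∈ R, a ≤ u ∧ u < t ∧ t < v ∧ v ≤ b ∧ ∀ s ∈ Icc u v, s ∈ R → s = u ∨ s = v := by
  obtain ⟨u, ⟨huR, hu⟩, hu'⟩ := (isCompact_Icc.inter_left hR).exists_isGreatest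
    (⟨a, ha, le_rfl, hat⟩ : (R ∩ Icc a t).Nonempty)
  obtain ⟨v, ⟨hvR, hv⟩, hv'⟩ := (isCompact_Icc.inter_left hR).exists_isLeast
    (⟨b, hb, htb, le_rfl⟩ : (R ∩ Icc t b).Nonempty)
  refine ⟨u, huR, v, hvR, hu.1, lt_of_le_of_ne hu.2 (by rintro rfl; exact ht huR),
    lt_of_le_of_ne hv.1 (by rintro rfl; exact ht hvR), hv.2, fun s hs hsR => ?_⟩
  rcases le_total s t with h | h
  · exact Or.inl (le_antisymm (hu' ⟨hsR, hu.1.trans hs.1, h⟩) hs.1)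
  · exact Or.inr (le_antisymm hs.2 (hv' ⟨hsR, h, hs.2.trans hv.2⟩))

/-- If the sides of a rectangle and all axis-parallel lines through a closed exceptional set are
controlled, so is the whole rectangle. -/
lemma box_bound {g : ℝ → ℝ → ℝ} {K : Set (ℝ × ℝ)} (hK : IsClosed K) {A B c σ : ℝ}
    (hc : ContinuousOn (Function.uncurry g) ((Icc 0 A ×ˢ Icc 0 B) \ K))
    (hrow : ∀ t ∈ Icc 0 A, ContinuousOn (fun θ => g t θ) (Icc 0 B))
    (hcol : ∀ θ ∈ Icc 0 B, ContinuousOn (fun t => g t θ) (Icc 0 A))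
    (hg : ∀ t ∈ Ioo 0 A, ∀ θ ∈ Ioo 0 B, SolvesAt g t θ)
    (hKσ : ∀ t ∈ Icc 0 A, ∀ θ ∈ Icc 0 B, (t, θ) ∈ K →
      (∀ s ∈ Icc 0 A, |g s θ - c| ≤ σ) ∧ ∀ η ∈ Icc 0 B, |g t η - c| ≤ σ)
    (hside : ∀ t ∈ Icc 0 A, |g t 0 - c| ≤ σ ∧ |g t B - c| ≤ σ)
    (hside' : ∀ θ ∈ Icc 0 B, |g 0 θ - c| ≤ σ ∧ |g A θ - c| ≤ σ) :
    ∀ t ∈ Icc 0 A, ∀ θ ∈ Icc 0 B, |g t θ - c| ≤ σ := by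
  have hKc : IsCompact (K ∩ (Icc 0 A ×ˢ Icc 0 B)) :=
    (isCompact_Icc.prod isCompact_Icc).inter_left hK
  set R : Set ℝ := {0, A} ∪ Prod.fst '' (K ∩ (Icc 0 A ×ˢ Icc 0 B)) with hRdef
  set R' : Set ℝ := {0, B} ∪ Prod.snd '' (K ∩ (Icc 0 A ×ˢ Icc 0 B)) with hR'def
  have hR : IsClosed R :=
    (Set.toFinite _).isClosed.union (hKc.image continuous_fst).isClosed
  have hR' : IsClosed R' :=
    (Set.toFinite _).isClosed.union (hKc.image continuous_snd).isClosed
  have hRσ : ∀ t ∈ R, ∀ η ∈ Icc 0 B, |g t η - c| ≤ σ := by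
    rintro t ((rfl | rfl) | ⟨⟨s, θ⟩, ⟨h1, h2⟩, rfl⟩) η hη
    · exact (hside' η hη).1
    · exact (hside' η hη).2
    · exact (hKσ s h2.1 θ h2.2 h1).2 η hη
  have hR'σ : ∀ θ ∈ R', ∀ s ∈ Icc 0 A, |g s θ - c| ≤ σ := by
    rintro t ((rfl | rfl) | ⟨⟨s, θ⟩, ⟨h1, h2⟩, rfl⟩) η hη
    · exact (hside η hη).1
    · exact (hside η hη).2
    · exact (hKσ s h2.1 θ h2.2 h1).1 η hη
  intro t ht θ hθ
  by_cases htR : t ∈ R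
  · exact hRσ t htR θ hθ
  by_cases hθR : θ ∈ R'
  · exact hR'σ θ hθR t ht
  obtain ⟨a, haR, a', haR', h1, h2, h3, h4, h5⟩ := hR.exists_gap (a := 0) (b := A)
    (by simp [hRdef]) (by simp [hRdef]) ht.1 ht.2 htR
  obtain ⟨b, hbR, b', hbR', k1, k2, k3, k4, k5⟩ := hR'.exists_gap (a := 0) (b := B)
    (by simp [hR'def]) (by simp [hR'def]) hθ.1 hθ.2 hθR
  have m1 : Icc a a' ⊆ Icc 0 A := Icc_subset_Icc h1 h4
  have m2 : Icc b b' ⊆ Icc 0 B := Icc_subset_Icc k1 k4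
  have hsol : ∀ t ∈ Ioo a a', ∀ θ ∈ Ioo b b', SolvesAt g t θ := fun t ht θ hθ =>
    hg t ⟨h1.trans_lt ht.1, ht.2.trans_le h4⟩ θ ⟨k1.trans_lt hθ.1, hθ.2.trans_le k4⟩
  refine rect_bound (rect_continuousOn (h2.trans h3) (k2.trans k3) (hc.mono ?_)
    (fun t ht => (hrow t (m1 ht)).mono m2) (fun t ht => (hcol t (m2 ht)).mono m1) hsol)
    hsol (fun s hs => ⟨hR'σ b hbR s (m1 hs), hR'σ b' hbR' s (m1 hs)⟩)
    (fun s hs => ⟨hRσ a haR s (m2 hs), hRσ a' haR' s (m2 hs)⟩) t ⟨h2.le, h3.le⟩ θ ⟨k2.le, k3.le⟩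
  rintro ⟨s, η⟩ ⟨⟨hs, hη⟩, hne⟩
  refine ⟨⟨m1 hs, m2 hη⟩, fun hK' => hne ⟨?_, ?_⟩⟩
  · exact h5 s hs (Or.inr ⟨(s, η), ⟨hK', m1 hs, m2 hη⟩, rfl⟩)
  · exact k5 η hη (Or.inr ⟨(s, η), ⟨hK', m1 hs, m2 hη⟩, rfl⟩)

lemma quadrant_continuous {g : ℝ → ℝ → ℝ} {K : Set (ℝ × ℝ)} (hK : IsClosed K)
    (h0 : ((0 : ℝ), (0 : ℝ)) ∈ K) {r n : ℝ} (hr : 0 < r) (hn : 0 < n)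
    (hc : ContinuousOn (Function.uncurry g) ((Icc 0 r ×ˢ Icc 0 r) \ K))
    (hrow : ∀ t ∈ Icc 0 r, ContinuousOn (fun θ => g t θ) (Icc 0 r))
    (hcol : ∀ θ ∈ Icc 0 r, ContinuousOn (fun t => g t θ) (Icc 0 r))
    (hg : ∀ t ∈ Ioo 0 r, ∀ θ ∈ Ioo 0 r, SolvesAt g t θ)
    (hLip : ∀ t ∈ Icc 0 r, ∀ θ ∈ Icc 0 r, (t, θ) ∈ K →
      (∀ s ∈ Icc 0 r, |g s θ - g t θ| ≤ n * |s - t|) ∧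
        ∀ η ∈ Icc 0 r, |g t η - g t θ| ≤ n * |η - θ|) {e : ℝ} (he : 0 < e) :
    ∃ δ > 0, ∀ t ∈ Icc 0 δ, ∀ θ ∈ Icc 0 δ, |g t θ - g 0 0| ≤ e := by
  set c := g 0 0 with hcdef
  -- shrink the box
  obtain ⟨ρ, hρ, hρr, hρe⟩ : ∃ ρ > 0, ρ ≤ r ∧ 6 * (n * ρ) ≤ e := by
    refine ⟨min r (e / (6 * n)), by positivity, min_le_left _ _, ?_⟩
    have : min r (e / (6 * n)) ≤ e / (6 * n) := min_le_right _ _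
    rw [le_div_iff₀ (by positivity)] at this
    linarith
  set σ : ℝ := 3 * (n * ρ) with hσ
  have hσ0 : 0 < σ := by positivity
  have mr : Icc 0 ρ ⊆ Icc 0 r := Icc_subset_Icc_right hρr
  have hz : (0 : ℝ) ∈ Icc 0 r := ⟨le_rfl, hr.le⟩
  have hzρ : (0 : ℝ) ∈ Icc 0 ρ := ⟨le_rfl, hρ.le⟩
  have habs : ∀ s ∈ Icc 0 ρ, ∀ t ∈ Icc 0 ρ, n * |s - t| ≤ n * ρ := by
    rintro s ⟨h1, h2⟩ t ⟨h3, h4⟩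
    gcongr; rw [abs_le]; constructor <;> linarith
  -- the axes
  have hax1 : ∀ s ∈ Icc 0 ρ, |g s 0 - c| ≤ n * ρ := fun s hs =>
    ((hLip 0 hz 0 hz h0).1 s (mr hs)).trans (habs s hs 0 hzρ)
  have hax2 : ∀ s ∈ Icc 0 ρ, |g 0 s - c| ≤ n * ρ := fun s hs =>
    ((hLip 0 hz 0 hz h0).2 s (mr hs)).trans (habs s hs 0 hzρ)
  have hKσ : ∀ t ∈ Icc 0 ρ, ∀ θ ∈ Icc 0 ρ, (t, θ) ∈ K →
      (∀ s ∈ Icc 0 ρ, |g s θ - c| ≤ σ) ∧ ∀ η ∈ Icc 0 ρ, |g t η - c| ≤ σ := by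
    intro t ht θ hθ hK'
    obtain ⟨h1, h2⟩ := hLip t (mr ht) θ (mr hθ) hK'
    have a1 := (h2 0 hz).trans (habs 0 hzρ θ hθ)
    have a2 := hax1 t ht
    have a3 : |g t θ - c| ≤ 2 * (n * ρ) := by
      rw [abs_le] at *; constructor <;> linarith
    refine ⟨fun s hs => ?_, fun η hη => ?_⟩
    · have a4 := (h1 s (mr hs)).trans (habs s hs t ht)
      rw [abs_le] at *; constructor <;> linarith
    · have a4 := (h2 η (mr hη)).trans (habs η hη θ hθ)
      rw [abs_le] at *; constructor <;> linarith
  have hbox : ∀ A ∈ Ioc 0 ρ, ∀ B ∈ Ioc 0 ρ, (∀ t ∈ Icc 0 A, |g t B - c| ≤ σ) →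
      (∀ θ ∈ Icc 0 B, |g A θ - c| ≤ σ) →
      ∃ δ > 0, ∀ t ∈ Icc 0 δ, ∀ θ ∈ Icc 0 δ, |g t θ - c| ≤ e := by
    intro A hA B hB hAB hBA
    have mA : Icc 0 A ⊆ Icc 0 ρ := Icc_subset_Icc_right hA.2
    have mB : Icc 0 B ⊆ Icc 0 ρ := Icc_subset_Icc_right hB.2
    have hA0 := hA.1
    have hB0 := hB.1
    have := box_bound hK (A := A) (B := B) (c := c) (σ := σ)
      (hc.mono (sdiff_subset_sdiff_left (prod_mono (mA.trans mr) (mB.trans mr))))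
      (fun t ht => (hrow t (mr (mA ht))).mono (mB.trans mr))
      (fun t ht => (hcol t (mr (mB ht))).mono (mA.trans mr))
      (fun t ht θ hθ => hg t ⟨ht.1, ht.2.trans_le (hA.2.trans hρr)⟩ θ
        ⟨hθ.1, hθ.2.trans_le (hB.2.trans hρr)⟩)
      (fun t ht θ hθ hk => ⟨fun s hs => (hKσ t (mA ht) θ (mB hθ) hk).1 s (mA hs),
        fun s hs => (hKσ t (mA ht) θ (mB hθ) hk).2 s (mB hs)⟩)
      (fun t ht => ⟨by linarith [hax1 t (mA ht), mul_pos hn hρ], hAB t ht⟩)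
      (fun t ht => ⟨by linarith [hax2 t (mB ht), mul_pos hn hρ], hBA t ht⟩)
    refine ⟨min A B, by positivity, fun t ht θ hθ => ?_⟩
    have := this t ⟨ht.1, ht.2.trans (min_le_left _ _)⟩ θ ⟨hθ.1, hθ.2.trans (min_le_right _ _)⟩
    linarith
  have hρρ : ρ ∈ Icc 0 ρ := ⟨hρ.le, le_rfl⟩
  obtain ⟨A, hA, hAb⟩ := ContinuousOn.exists_right_bound hρ
    (((hcol ρ (mr hρρ)).mono mr) 0 hzρ) (c := c) (e := σ)
    (by have := hax2 ρ hρρ; linarith [mul_pos hn hρ])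
  have hA0 := hA.1
  by_cases h1 : ∃ a ∈ Ioc 0 A, ∃ θ ∈ Icc 0 ρ, (a, θ) ∈ K
  · obtain ⟨a, ha, θ, hθ, haK⟩ := h1
    have ha' : a ∈ Ioc 0 ρ := ⟨ha.1, ha.2.trans hA.2⟩
    exact hbox a ha' ρ ⟨hρ, le_rfl⟩ (fun t ht => hAb t ⟨ht.1, ht.2.trans ha.2⟩)
      (hKσ a ⟨ha'.1.le, ha'.2⟩ θ hθ haK).2
  push Not at h1
  have hA' : A ∈ Icc 0 ρ := ⟨hA.1.le, hA.2⟩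
  obtain ⟨ω, hω, hωb⟩ := ContinuousOn.exists_right_bound hρ
    (((hrow A (mr hA')).mono mr) 0 hzρ) (c := c) (e := σ)
    (by have := hax1 A hA'; linarith [mul_pos hn hρ])
  by_cases h2 : ∃ b ∈ Ioc 0 ω, ((0 : ℝ), b) ∈ K
  · obtain ⟨b, hb, hbK⟩ := h2
    have hb' : b ∈ Ioc 0 ρ := ⟨hb.1, hb.2.trans hω.2⟩
    exact hbox A hA b hb' (fun t ht => (hKσ 0 hzρ b ⟨hb'.1.le, hb'.2⟩ hbK).1 t
      ⟨ht.1, ht.2.trans hA.2⟩) (fun t ht => hωb t ⟨ht.1, ht.2.trans hb.2⟩)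
  push Not at h2
  have mA : Icc 0 A ⊆ Icc 0 r := Icc_subset_Icc_right (hA.2.trans hρr)
  have mω : Icc 0 ω ⊆ Icc 0 r := Icc_subset_Icc_right (hω.2.trans hρr)
  obtain ⟨δ, hδ, h⟩ := corner_continuous (g := g) (T := A) (D := ω) hA.1 hω.1
    (hc.mono (by
      rintro ⟨t, θ⟩ ⟨⟨ht, hθ⟩, hne⟩
      refine ⟨⟨mA ht, mω hθ⟩, fun hk => hne ?_⟩
      have ht0 : t = 0 := by
        by_contra hne'
        exact h1 t ⟨lt_of_le_of_ne ht.1 (Ne.symm hne'), ht.2⟩ θ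
          ⟨hθ.1, hθ.2.trans hω.2⟩ hk
      subst ht0
      have hθ0 : θ = 0 := by
        by_contra hne'
        exact h2 θ ⟨lt_of_le_of_ne hθ.1 (Ne.symm hne'), hθ.2⟩ hk
      simp [hθ0]))
    (((hcol 0 hz).mono mA) 0 ⟨le_rfl, hA.1.le⟩) (((hrow 0 hz).mono mω) 0 ⟨le_rfl, hω.1.le⟩)
    (fun t ht θ hθ => hg t ⟨ht.1, ht.2.trans_le (hA.2.trans hρr)⟩ θ
        ⟨hθ.1, hθ.2.trans_le (hω.2.trans hρr)⟩) (e := e / 10) (by positivity)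
  exact ⟨δ, hδ, fun t ht θ hθ => by have := h t ht θ hθ; linarith⟩

/-- `X` obeys Lipschitz bounds with constant `n + 1` along both axes through `p`, at distances
below `1 / (n + 1)`. -/
def AxisLipschitzAt (X : ℝ → ℝ → ℝ) (n : ℕ) (p : ℝ × ℝ) : Prop :=
  (∀ s, 0 ≤ s → |s - p.1| < 1 / ((n : ℝ) + 1) → |X s p.2 - X p.1 p.2| ≤ (n + 1) * |s - p.1|) ∧
    ∀ η ∈ Icc (0 : ℝ) 1, |η - p.2| < 1 / ((n : ℝ) + 1) →
      |X p.1 η - X p.1 p.2| ≤ (n + 1) * |η - p.2|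

lemma HasDerivAt.exists_local_lipschitz {f : ℝ → ℝ} {d x : ℝ} (h : HasDerivAt f d x) :
    ∃ n₀ : ℕ, ∀ n ≥ n₀, ∀ y, |y - x| < 1 / ((n : ℝ) + 1) → |f y - f x| ≤ (n + 1) * |y - x| := by
  obtain ⟨C, hC⟩ := h.hasFDerivAt.isBigO_sub.bound
  obtain ⟨ε, hε, h1⟩ := Metric.eventually_nhds_iff.1 hC
  obtain ⟨n₁, hn₁⟩ := exists_nat_ge C
  obtain ⟨n₂, hn₂⟩ := exists_nat_one_div_lt hε
  refine ⟨max n₁ n₂, fun n hn y hy => ?_⟩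
  have e1 : (n₁ : ℝ) ≤ n := by exact_mod_cast (le_max_left _ _).trans hn
  have e2 : (n₂ : ℝ) ≤ n := by exact_mod_cast (le_max_right _ _).trans hn
  have e3 : 1 / ((n : ℝ) + 1) ≤ 1 / ((n₂ : ℝ) + 1) := by gcongr
  have := h1 (y := y) (by rw [Real.dist_eq]; linarith)
  rw [Real.norm_eq_abs, Real.norm_eq_abs] at this
  refine this.trans ?_
  gcongr
  linarith

/-- A separately differentiable solution is jointly continuous. -/
theorem joint_continuity {X : ℝ → ℝ → ℝ}
    (hX : ∀ t, 0 ≤ t → ∀ θ ∈ Icc (0 : ℝ) 1, SolvesAt X t θ) :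
    ContinuousOn (Function.uncurry X) (Ici 0 ×ˢ Icc 0 1) := by
  set S : Set (ℝ × ℝ) := Ici 0 ×ˢ Icc 0 1 with hS
  have hScl : IsClosed S := isClosed_Ici.prod isClosed_Icc
  have hrow : ∀ t, 0 ≤ t → Continuous (X t) := fun t ht =>
    (hX t ht 0 ⟨le_rfl, zero_le_one⟩).1.continuous
  have hcol : ∀ θ ∈ Icc (0 : ℝ) 1, ∀ t, 0 ≤ t → ContinuousAt (fun s => X s θ) t :=
    fun θ hθ t ht => (hX t ht θ hθ).2.continuousAt
  set Dset : Set (ℝ × ℝ) := {p | p ∈ S ∧ ¬ ContinuousWithinAt (Function.uncurry X) S p} with hD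
  suffices hempty : Dset = ∅ by
    intro p hp
    by_contra hcon
    exact (hempty ▸ (⟨hp, hcon⟩ : p ∈ Dset) : p ∈ (∅ : Set (ℝ × ℝ)))
  by_contra hne
  obtain ⟨q₀, hq₀⟩ := nonempty_iff_ne_empty.2 hne
  set K := closure Dset with hKdef
  have hKcl : IsClosed K := isClosed_closure
  have hKS : K ⊆ S := closure_minimal (fun p hp => hp.1) hScl
  have hoff : ContinuousOn (Function.uncurry X) (S \ K) := by
    rintro p ⟨hpS, hpK⟩
    by_contra hcon
    exact hpK (subset_closure ⟨hpS, fun h => hcon (h.mono sdiff_subset)⟩)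
  have : Nonempty K := ⟨⟨q₀, subset_closure hq₀⟩⟩
  have : CompleteSpace K := hKcl.completeSpace_coe
  have hcover : ⋃ n : ℕ, {p : K | AxisLipschitzAt X n p} = univ := by
    refine eq_univ_of_forall fun p => mem_iUnion.2 ?_
    obtain ⟨⟨t, θ⟩, hp⟩ := p
    obtain ⟨ht, hθ⟩ := hKS hp
    obtain ⟨hc2, hd⟩ := hX t ht θ hθ
    obtain ⟨n₁, h1⟩ := hd.exists_local_lipschitz
    obtain ⟨n₂, h2⟩ := (hc2.hasDerivAt_deriv_two.1 θ).exists_local_lipschitz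
    exact ⟨max n₁ n₂, fun s _ => h1 _ (le_max_left _ _) s, fun η _ => h2 _ (le_max_right _ _) η⟩
  have hclosed : ∀ n : ℕ, IsClosed {p : K | AxisLipschitzAt X n p} := by
    intro n
    refine IsSeqClosed.isClosed ?_
    rintro u ⟨⟨t, θ⟩, hp⟩ hu hlim
    obtain ⟨ht, hθ⟩ := hKS hp
    simp only [mem_Ici] at ht hθ
    have hlim' : Tendsto (fun k => (u k : ℝ × ℝ)) atTop (𝓝 (t, θ)) :=
      (continuous_subtype_val.tendsto _).comp hlim
    have l1 : Tendsto (fun k => (u k : ℝ × ℝ).1) atTop (𝓝 t) :=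
      (continuous_fst.tendsto _).comp hlim'
    have l2 : Tendsto (fun k => (u k : ℝ × ℝ).2) atTop (𝓝 θ) :=
      (continuous_snd.tendsto _).comp hlim'
    have hpos : (0 : ℝ) < 1 / ((n : ℝ) + 1) := by positivity
    have huS : ∀ k, 0 ≤ (u k : ℝ × ℝ).1 ∧ (u k : ℝ × ℝ).2 ∈ Icc (0 : ℝ) 1 := fun k =>
      ⟨(hKS (u k).2).1, (hKS (u k).2).2⟩
    have l0 : Tendsto (fun k => X (u k : ℝ × ℝ).1 θ) atTop (𝓝 (X t θ)) :=
      (hcol θ hθ t ht).tendsto.comp l1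
    have lX : Tendsto (fun k => X (u k : ℝ × ℝ).1 (u k : ℝ × ℝ).2) atTop (𝓝 (X t θ)) := by
      have hb : ∀ᶠ k in atTop, |X (u k : ℝ × ℝ).1 θ - X (u k : ℝ × ℝ).1 (u k : ℝ × ℝ).2| ≤
          (n + 1) * |θ - (u k : ℝ × ℝ).2| := by
        have := ((tendsto_const_nhds (x := θ)).sub l2).abs
        simp only [sub_self, abs_zero] at this
        filter_upwards [this.eventually (gt_mem_nhds hpos)] with k hk
        exact (hu k).2 θ hθ hk
      have hz : Tendsto (fun k => ((n : ℝ) + 1) * |θ - (u k : ℝ × ℝ).2|) atTop (𝓝 0) := by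
        have := (((tendsto_const_nhds (x := θ)).sub l2).abs).const_mul ((n : ℝ) + 1)
        simpa using this
      have hd := squeeze_zero_norm' (a := fun k => ((n : ℝ) + 1) * |θ - (u k : ℝ × ℝ).2|)
        (f := fun k => X (u k : ℝ × ℝ).1 θ - X (u k : ℝ × ℝ).1 (u k : ℝ × ℝ).2)
        (by simpa only [Real.norm_eq_abs] using hb) hz
      simpa using l0.sub hd
    refine ⟨fun s hs hsn => ?_, fun η hη hηn => ?_⟩
    · simp only at hsn ⊢
      have l3 : Tendsto (fun k => |s - (u k : ℝ × ℝ).1|) atTop (𝓝 |s - t|) :=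
        (tendsto_const_nhds.sub l1).abs
      have l4 : Tendsto (fun k => X s (u k : ℝ × ℝ).2) atTop (𝓝 (X s θ)) :=
        ((hrow s hs).tendsto θ).comp l2
      refine le_of_tendsto_of_tendsto (l4.sub lX).abs (l3.const_mul _) ?_
      filter_upwards [l3.eventually (gt_mem_nhds hsn)] with k hk
      exact (hu k).1 s hs hk
    · simp only at hηn ⊢
      have l3 : Tendsto (fun k => |η - (u k : ℝ × ℝ).2|) atTop (𝓝 |η - θ|) :=
        (tendsto_const_nhds.sub l2).abs
      have l4 : Tendsto (fun k => X (u k : ℝ × ℝ).1 η) atTop (𝓝 (X t η)) :=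
        (hcol η hη t ht).tendsto.comp l1
      refine le_of_tendsto_of_tendsto (l4.sub lX).abs (l3.const_mul _) ?_
      filter_upwards [l3.eventually (gt_mem_nhds hηn)] with k hk
      exact (hu k).2 η hη hk
  obtain ⟨n, ⟨p₁, hp₁⟩⟩ := nonempty_interior_of_iUnion_of_closed hclosed hcover
  obtain ⟨V, hVsub, hVo, hpV⟩ := mem_interior.1 hp₁
  obtain ⟨U, hU, rfl⟩ := isOpen_induced_iff.1 hVo
  obtain ⟨⟨t₀, θ₀⟩, hp₀U, hp₀D⟩ := mem_closure_iff.1 p₁.2 U hU hpV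
  have hE : ∀ p ∈ K, p ∈ U → AxisLipschitzAt X n p := fun p hp hpU => hVsub (a := ⟨p, hp⟩) hpU
  have hp₀K : (t₀, θ₀) ∈ K := subset_closure hp₀D
  obtain ⟨ht₀, hθ₀⟩ := hKS hp₀K
  simp only [mem_Ici] at ht₀ hθ₀
  obtain ⟨ε, hε, hεU⟩ := Metric.isOpen_iff.1 hU _ hp₀U
  refine hp₀D.2 (continuousWithinAt_of_quadrants fun e he => ?_)
  have key : ∀ ε₁ ε₂ : ℝ, ((ε₁ = 1) ∨ (ε₁ = -1 ∧ 0 < t₀)) →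
      ((ε₂ = 1 ∧ θ₀ < 1) ∨ (ε₂ = -1 ∧ 0 < θ₀)) → ∃ δ > 0, ∀ t ∈ Icc 0 δ, ∀ θ ∈ Icc 0 δ,
        |X (t₀ + ε₁ * t) (θ₀ + ε₂ * θ) - X t₀ θ₀| ≤ e := by
    intro ε₁ ε₂ h1 h2
    have hq1 : ε₁ ^ 2 = 1 := by rcases h1 with rfl | ⟨rfl, -⟩ <;> norm_num
    have hq2 : ε₂ ^ 2 = 1 := by rcases h2 with ⟨rfl, -⟩ | ⟨rfl, -⟩ <;> norm_num
    have ha1 : |ε₁| = 1 := by rcases h1 with rfl | ⟨rfl, -⟩ <;> norm_num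
    have ha2 : |ε₂| = 1 := by rcases h2 with ⟨rfl, -⟩ | ⟨rfl, -⟩ <;> norm_num
    have habs : |ε₁ * ε₂| = 1 := by rw [abs_mul, ha1, ha2, one_mul]
    obtain ⟨r₁, hr₁, hr₁'⟩ : ∃ r > 0, ∀ t ∈ Icc 0 r, 0 ≤ t₀ + ε₁ * t := by
      rcases h1 with rfl | ⟨rfl, h⟩
      · exact ⟨1, one_pos, fun t ht => by linarith [ht.1]⟩
      · exact ⟨t₀, h, fun t ht => by linarith [ht.2]⟩
    obtain ⟨r₂, hr₂, hr₂'⟩ : ∃ r > 0, ∀ t ∈ Icc 0 r, θ₀ + ε₂ * t ∈ Icc (0 : ℝ) 1 := by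
      have := hθ₀.1
      have := hθ₀.2
      rcases h2 with ⟨rfl, h⟩ | ⟨rfl, h⟩
      · exact ⟨1 - θ₀, by linarith, fun t ht => ⟨by linarith [ht.1], by linarith [ht.2]⟩⟩
      · exact ⟨θ₀, h, fun t ht => ⟨by linarith [ht.2], by linarith [ht.1]⟩⟩
    have hn1 : (0 : ℝ) < (n : ℝ) + 1 := by positivity
    set r : ℝ := min (min r₁ r₂) (min (ε / 2) (1 / ((n : ℝ) + 1) / 2)) with hr
    have hr0 : 0 < r := by positivity
    have hrr₁ : r ≤ r₁ := (min_le_left _ _).trans (min_le_left _ _)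
    have hrr₂ : r ≤ r₂ := (min_le_left _ _).trans (min_le_right _ _)
    have hrε : r < ε := by
      have : r ≤ ε / 2 := (min_le_right _ _).trans (min_le_left _ _)
      linarith
    have hrn : r < 1 / ((n : ℝ) + 1) := by
      have h3 : r ≤ 1 / ((n : ℝ) + 1) / 2 := (min_le_right _ _).trans (min_le_right _ _)
      have : 0 < 1 / ((n : ℝ) + 1) := by positivity
      linarith
    have q1 : ∀ t ∈ Icc 0 r, 0 ≤ t₀ + ε₁ * t := fun t ht => hr₁' t ⟨ht.1, ht.2.trans hrr₁⟩
    have q2 : ∀ t ∈ Icc 0 r, θ₀ + ε₂ * t ∈ Icc (0 : ℝ) 1 := fun t ht =>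
      hr₂' t ⟨ht.1, ht.2.trans hrr₂⟩
    have hcont : Continuous fun z : ℝ × ℝ => (t₀ + ε₁ * z.1, θ₀ + ε₂ * z.2) := by fun_prop
    have hdiff : ∀ s ∈ Icc 0 r, ∀ t ∈ Icc 0 r, |s - t| ≤ r := by
      rintro s ⟨h1, h2⟩ t ⟨h3, h4⟩
      rw [abs_le]; constructor <;> linarith
    obtain ⟨δ, hδ, h⟩ := quadrant_continuous
      (g := fun t θ => ε₁ * ε₂ * X (t₀ + ε₁ * t) (θ₀ + ε₂ * θ)) (hKcl.preimage hcont)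
      (by simpa using hp₀K) (r := r) hr0 hn1
      (continuousOn_const.mul (hoff.comp (f := fun z : ℝ × ℝ => (t₀ + ε₁ * z.1, θ₀ + ε₂ * z.2))
        hcont.continuousOn (fun z hz => ⟨⟨q1 _ hz.1.1, q2 _ hz.1.2⟩, hz.2⟩)))
      (fun t ht => continuousOn_const.mul
        ((hrow _ (q1 t ht)).comp (by fun_prop)).continuousOn)
      (fun θ hθ => continuousOn_const.mul (fun t ht =>
        (ContinuousAt.comp (f := fun t => t₀ + ε₁ * t) (hcol _ (q2 θ hθ) _ (q1 t ht))
          (by fun_prop)).continuousWithinAt))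
      (fun t ht θ hθ => (hX _ (q1 t ⟨ht.1.le, ht.2.le⟩) _ (q2 θ ⟨hθ.1.le, hθ.2.le⟩)).flip hq2)
      (fun t ht θ hθ hk => by
        have hmem : (t₀ + ε₁ * t, θ₀ + ε₂ * θ) ∈ U := by
          apply hεU
          rw [Metric.mem_ball, Prod.dist_eq, max_lt_iff, Real.dist_eq, Real.dist_eq]
          simp only [add_sub_cancel_left, abs_mul, ha1, ha2, one_mul]
          rw [abs_of_nonneg ht.1, abs_of_nonneg hθ.1]
          exact ⟨ht.2.trans_lt hrε, hθ.2.trans_lt hrε⟩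
        obtain ⟨e1, e2⟩ := hE _ hk hmem
        refine ⟨fun s hs => ?_, fun s hs => ?_⟩
        · have e3 : |t₀ + ε₁ * s - (t₀ + ε₁ * t)| = |s - t| := by
            rw [show t₀ + ε₁ * s - (t₀ + ε₁ * t) = ε₁ * (s - t) by ring, abs_mul, ha1, one_mul]
          have := e1 (t₀ + ε₁ * s) (q1 s hs) (by
            simp only [e3]; exact (hdiff s hs t ht).trans_lt hrn)
          rw [← mul_sub, abs_mul, habs, one_mul]
          simpa only [e3] using this
        · have e3 : |θ₀ + ε₂ * s - (θ₀ + ε₂ * θ)| = |s - θ| := by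
            rw [show θ₀ + ε₂ * s - (θ₀ + ε₂ * θ) = ε₂ * (s - θ) by ring, abs_mul, ha2, one_mul]
          have := e2 (θ₀ + ε₂ * s) (q2 s hs) (by
            simp only [e3]; exact (hdiff s hs θ hθ).trans_lt hrn)
          rw [← mul_sub, abs_mul, habs, one_mul]
          simpa only [e3] using this) he
    refine ⟨δ, hδ, fun t ht θ hθ => ?_⟩
    have := h t ht θ hθ
    simp only [mul_zero, add_zero] at this
    rwa [← mul_sub, abs_mul, habs, one_mul] at this
  -- uniform choice of `δ` over the admissible quadrants
  have hθside : ∃ δ > 0, ∀ ε₁, ((ε₁ = 1) ∨ (ε₁ = -1 ∧ 0 < t₀)) → ∀ ε₂,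
      ((ε₂ = 1 ∧ θ₀ < 1) ∨ (ε₂ = -1 ∧ 0 < θ₀)) → ∀ t ∈ Icc 0 δ, ∀ θ ∈ Icc 0 δ,
        |X (t₀ + ε₁ * t) (θ₀ + ε₂ * θ) - X t₀ θ₀| ≤ e := by
    have hall : ∀ ε₁ ε₂ : ℝ, ∃ δ > 0, ((ε₁ = 1) ∨ (ε₁ = -1 ∧ 0 < t₀)) →
        ((ε₂ = 1 ∧ θ₀ < 1) ∨ (ε₂ = -1 ∧ 0 < θ₀)) → ∀ t ∈ Icc 0 δ, ∀ θ ∈ Icc 0 δ,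
        |X (t₀ + ε₁ * t) (θ₀ + ε₂ * θ) - X t₀ θ₀| ≤ e := by
      intro ε₁ ε₂
      by_cases h1 : ((ε₁ = 1) ∨ (ε₁ = -1 ∧ 0 < t₀)) ∧
        ((ε₂ = 1 ∧ θ₀ < 1) ∨ (ε₂ = -1 ∧ 0 < θ₀))
      · obtain ⟨δ, hδ, h⟩ := key ε₁ ε₂ h1.1 h1.2
        exact ⟨δ, hδ, fun _ _ => h⟩
      · exact ⟨1, one_pos, fun h2 h3 => absurd ⟨h2, h3⟩ h1⟩
    choose δ hδ h using hall
    refine ⟨min (min (δ 1 1) (δ 1 (-1))) (min (δ (-1) 1) (δ (-1) (-1))),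
      lt_min (lt_min (hδ _ _) (hδ _ _)) (lt_min (hδ _ _) (hδ _ _)), ?_⟩
    intro ε₁ h1 ε₂ h2 t ht θ hθ
    refine h ε₁ ε₂ h1 h2 t ⟨ht.1, ht.2.trans ?_⟩ θ ⟨hθ.1, hθ.2.trans ?_⟩ <;>
    · rcases h1 with rfl | ⟨rfl, -⟩ <;> rcases h2 with ⟨rfl, -⟩ | ⟨rfl, -⟩ <;> simp
  obtain ⟨δ, hδ, h⟩ := hθside
  refine ⟨δ, hδ, fun t θ hS' ht hθ => ?_⟩
  obtain ⟨hS1, hS2⟩ := hS'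
  simp only [mem_Ici] at hS1 hS2
  obtain ⟨ε₁, h1, hεt⟩ : ∃ ε₁ : ℝ, ((ε₁ = 1) ∨ (ε₁ = -1 ∧ 0 < t₀)) ∧ ε₁ * (t - t₀) = |t - t₀| := by
    rcases le_or_gt t₀ t with h' | h'
    · exact ⟨1, Or.inl rfl, by rw [abs_of_nonneg (by linarith)]; ring⟩
    · exact ⟨-1, Or.inr ⟨rfl, by linarith⟩, by rw [abs_of_neg (by linarith)]; ring⟩
  obtain ⟨ε₂, h2, hεθ⟩ : ∃ ε₂ : ℝ, ((ε₂ = 1 ∧ θ₀ < 1) ∨ (ε₂ = -1 ∧ 0 < θ₀)) ∧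
      ε₂ * (θ - θ₀) = |θ - θ₀| := by
    rcases lt_trichotomy θ θ₀ with h' | h' | h'
    · exact ⟨-1, Or.inr ⟨rfl, by linarith [hS2.1]⟩, by rw [abs_of_neg (by linarith)]; ring⟩
    · rcases lt_or_ge θ₀ 1 with h'' | h''
      · exact ⟨1, Or.inl ⟨rfl, h''⟩, by simp [h']⟩
      · exact ⟨-1, Or.inr ⟨rfl, by linarith⟩, by simp [h']⟩
    · exact ⟨1, Or.inl ⟨rfl, by linarith [hS2.2]⟩, by rw [abs_of_pos (by linarith)]; ring⟩
  have := h ε₁ h1 ε₂ h2 |t - t₀| ⟨abs_nonneg _, ht⟩ |θ - θ₀| ⟨abs_nonneg _, hθ⟩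
  have hq1 : ε₁ * ε₁ = 1 := by rcases h1 with rfl | ⟨rfl, -⟩ <;> norm_num
  have hq2 : ε₂ * ε₂ = 1 := by rcases h2 with ⟨rfl, -⟩ | ⟨rfl, -⟩ <;> norm_num
  rwa [← hεt, ← hεθ, ← mul_assoc, ← mul_assoc, hq1, hq2, one_mul, one_mul,
    add_sub_cancel, add_sub_cancel] at this

lemma HasDerivAt.le_of_sub_le {f : ℝ → ℝ} {d c x : ℝ} (hx : x ∈ Icc (0 : ℝ) 1)
    (hf : HasDerivAt f d x)
    (h : ∀ y ∈ Icc (0 : ℝ) 1, ∀ z ∈ Icc (0 : ℝ) 1, y ≤ z → f z - f y ≤ c * (z - y)) : d ≤ c := by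
  have h1 : HasDerivWithinAt f d (Icc 0 1) x := hf.hasDerivWithinAt
  rw [hasDerivWithinAt_iff_tendsto_slope] at h1
  have : (𝓝[Icc (0 : ℝ) 1 \ {x}] x).NeBot := by
    have h2 := (uniqueDiffOn_Icc (zero_lt_one (α := ℝ))) x hx
    rw [uniqueDiffWithinAt_iff_accPt, accPt_principal_iff_nhdsWithin] at h2
    exact h2
  refine le_of_tendsto h1 ?_
  filter_upwards [self_mem_nhdsWithin] with y hy
  have hne : y ≠ x := hy.2
  rw [slope_def_field]
  rcases lt_or_gt_of_ne hne with h3 | h3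
  · rw [← neg_div_neg_eq, div_le_iff₀ (by linarith)]
    linarith [h y hy.1 x hx h3.le]
  · rw [div_le_iff₀ (by linarith)]
    linarith [h x hx y hy.1 h3.le]

lemma HasDerivAt.ge_of_sub_ge {f : ℝ → ℝ} {d c x : ℝ} (hx : x ∈ Icc (0 : ℝ) 1)
    (hf : HasDerivAt f d x)
    (h : ∀ y ∈ Icc (0 : ℝ) 1, ∀ z ∈ Icc (0 : ℝ) 1, y ≤ z → c * (z - y) ≤ f z - f y) : c ≤ d := by
  have := (hf.neg).le_of_sub_le (c := -c) hx
    (fun y hy z hz hyz => by have := h y hy z hz hyz; simp only [Pi.neg_apply]; linarith)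
  linarith

lemma HasDerivAt.abs_le_of_sub_le {f : ℝ → ℝ} {d c x : ℝ} (hx : x ∈ Icc (0 : ℝ) 1)
    (hf : HasDerivAt f d x)
    (h : ∀ y ∈ Icc (0 : ℝ) 1, ∀ z ∈ Icc (0 : ℝ) 1, |f z - f y| ≤ c * |z - y|) : |d| ≤ c := by
  rw [abs_le]
  refine ⟨hf.ge_of_sub_ge hx fun y hy z hz hyz => ?_, hf.le_of_sub_le hx fun y hy z hz hyz => ?_⟩
  · have := (abs_le.1 (h y hy z hz)).1
    rw [abs_of_nonneg (by linarith)] at this; linarith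
  · have := (abs_le.1 (h y hy z hz)).2
    rw [abs_of_nonneg (by linarith)] at this; linarith

lemma hasDerivAt_right_bound {f : ℝ → ℝ} {d L t : ℝ} (hf : HasDerivAt f d t)
    (h : ∀ s > 0, |f (t + s) - f t| ≤ L * s) : |d| ≤ L := by
  have h1 := hf.tendsto_slope_zero_right
  refine le_of_tendsto h1.abs ?_
  filter_upwards [self_mem_nhdsWithin] with s hs
  have hs' : 0 < s := hs
  have := h s hs
  rw [smul_eq_mul, abs_mul, abs_inv, abs_of_pos hs', inv_mul_le_iff₀ hs']
  linarith

lemma isCompact_ordered_pairs : IsCompact {z : ℝ × ℝ | 0 ≤ z.2 ∧ z.2 ≤ z.1 ∧ z.1 ≤ 1} := by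
  refine (isCompact_Icc (a := ((0 : ℝ), (0 : ℝ))) (b := (1, 1))).of_isClosed_subset ?_ ?_
  · exact (isClosed_le continuous_const continuous_snd).inter
      ((isClosed_le continuous_snd continuous_fst).inter (isClosed_le continuous_fst continuous_const))
  · rintro ⟨x, y⟩ ⟨h1, h2, h3⟩
    simp only at h1 h2 h3
    exact ⟨⟨by simp only; linarith, h1⟩, ⟨h3, by simp only; linarith⟩⟩

lemma one_sub_exp_bounds {κ r : ℝ} (h0 : 0 ≤ r) (h1 : r ≤ 1) :
    r * (1 - Real.exp (-κ)) ≤ 1 - Real.exp (-κ * r) ∧ 1 - Real.exp (-κ * r) ≤ κ * r := by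
  constructor
  · have := convexOn_exp.2 (mem_univ (-κ)) (mem_univ 0) h0 (sub_nonneg.2 h1) (by ring)
    simp only [smul_eq_mul, mul_zero, add_zero, Real.exp_zero, mul_one] at this
    rw [show r * -κ = -κ * r by ring] at this
    linarith
  · have := Real.add_one_le_exp (-κ * r)
    linarith

/-- Reflection coupling: one-sided spatial modulus for linear parabolic equations with
homogeneous Dirichlet conditions. -/
lemma parabolic_modulus {W W₁ W₂ a b f : ℝ → ℝ → ℝ} {a₀ b₀ κ m₀ Lf : ℝ}
    (ha₀ : 0 < a₀) (hκ : 0 < κ) (hκb : b₀ ≤ a₀ * κ) (hm₀ : 0 ≤ m₀)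
    (hLf : 0 ≤ Lf)
    (hcont : ContinuousOn (Function.uncurry W) (Ici 0 ×ˢ Icc 0 1))
    (hW₁ : ∀ t, 0 < t → ∀ y, HasDerivAt (W t) (W₁ t y) y)
    (hW₂ : ∀ t, 0 < t → ∀ y, HasDerivAt (W₁ t) (W₂ t y) y)
    (hbd0 : ∀ t, 0 ≤ t → W t 0 = 0) (hbd1 : ∀ t, 0 ≤ t → W t 1 = 0)
    (heq : ∀ t, 0 < t → ∀ y ∈ Icc (0 : ℝ) 1,
      HasDerivAt (fun s => W s y) (a t y * W₂ t y + b t y * W₁ t y + f t y) t)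
    (ha : ∀ t, 0 < t → ∀ y ∈ Icc (0 : ℝ) 1, a₀ ≤ a t y)
    (hb : ∀ t, 0 < t → ∀ y ∈ Icc (0 : ℝ) 1, |b t y| ≤ b₀)
    (hf : ∀ t, 0 < t → ∀ y ∈ Icc (0 : ℝ) 1, ∀ z ∈ Icc (0 : ℝ) 1, |f t y - f t z| ≤ Lf * |y - z|)
    (hf0 : ∀ t, 0 < t → f t 0 = 0) (hf1 : ∀ t, 0 < t → f t 1 = 0)
    (hinit : ∀ y ∈ Icc (0 : ℝ) 1, ∀ z ∈ Icc (0 : ℝ) 1, y ≤ z →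
      W 0 z - W 0 y ≤ m₀ * (1 - Real.exp (-κ * (z - y))))
    {t : ℝ} (ht : 0 ≤ t) {y z : ℝ} (hy : y ∈ Icc (0 : ℝ) 1) (hz : z ∈ Icc (0 : ℝ) 1)
    (hyz : y ≤ z) :
    W t z - W t y ≤ (m₀ + Lf / (1 - Real.exp (-κ)) * t) * (1 - Real.exp (-κ * (z - y))) := by
  have hb₀ : 0 ≤ b₀ := (abs_nonneg _).trans (hb 1 one_pos 0 ⟨le_rfl, zero_le_one⟩)
  have hφ1 : 0 < 1 - Real.exp (-κ) := by
    have : Real.exp (-κ) < 1 := Real.exp_lt_one_iff.2 (by linarith)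
    linarith
  set L := Lf / (1 - Real.exp (-κ)) with hL
  have hL0 : 0 ≤ L := by positivity
  have hLφ : L * (1 - Real.exp (-κ)) = Lf := by rw [hL]; field_simp
  have := max_principle isCompact_ordered_pairs (T := t)
    (F := fun t z => W t z.1 - W t z.2 - (m₀ + L * t) * (1 - Real.exp (-κ * (z.1 - z.2)))) 0
    ?_ ?_ ?_ t ⟨ht, le_rfl⟩ (z, y) ⟨hy.1, hyz, hz.2⟩
  · linarith
  · have h1 : ContinuousOn (fun z : ℝ × ℝ × ℝ => W z.1 z.2.1)
        (Icc 0 t ×ˢ {z : ℝ × ℝ | 0 ≤ z.2 ∧ z.2 ≤ z.1 ∧ z.1 ≤ 1}) :=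
      hcont.comp (f := fun z : ℝ × ℝ × ℝ => (z.1, z.2.1)) (by fun_prop)
        (fun z hz => ⟨hz.1.1, hz.2.1.trans hz.2.2.1, hz.2.2.2⟩)
    have h2 : ContinuousOn (fun z : ℝ × ℝ × ℝ => W z.1 z.2.2)
        (Icc 0 t ×ˢ {z : ℝ × ℝ | 0 ≤ z.2 ∧ z.2 ≤ z.1 ∧ z.1 ≤ 1}) :=
      hcont.comp (f := fun z : ℝ × ℝ × ℝ => (z.1, z.2.2)) (by fun_prop)
        (fun z hz => ⟨hz.1.1, hz.2.1, hz.2.2.1.trans hz.2.2.2⟩)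
    exact (h1.sub h2).sub (by fun_prop)
  · rintro ⟨z, y⟩ ⟨h1, h2, h3⟩
    simp only at h1 h2 h3
    have := hinit y ⟨h1, by linarith⟩ z ⟨by linarith, h3⟩ h2
    simp only [mul_zero, add_zero]
    linarith
  · rintro t ⟨ht, -⟩ ⟨z, y⟩ ⟨h1, h2, h3⟩ hpos hmax
    simp only at h1 h2 h3 hpos
    set m := m₀ + L * t with hm
    have hm0 : 0 ≤ m := by positivity
    have hlt : y < z := by
      refine lt_of_le_of_ne h2 ?_
      rintro rfl
      simp at hpos
    set E := Real.exp (-κ * (z - y)) with hE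
    have hE0 : 0 < E := Real.exp_pos _
    have hφ' : ∀ c₁ c₂ : ℝ, HasDerivAt (fun s => 1 - Real.exp (-κ * (z - y + (c₁ + c₂) * s)))
        (κ * (c₁ + c₂) * E) 0 := fun c₁ c₂ => by
      have := ((((hasDerivAt_id (0 : ℝ)).const_mul (c₁ + c₂)).const_add (z - y)).const_mul
        (-κ)).exp.const_sub 1
      refine this.congr_deriv ?_
      simp [hE]; ring
    have hyI : y ∈ Icc (0 : ℝ) 1 := ⟨h1, hlt.le.trans h3⟩
    have hzI : z ∈ Icc (0 : ℝ) 1 := ⟨h1.trans hlt.le, h3⟩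
    -- first order conditions
    have hexp : ∀ w, HasDerivAt (fun w => 1 - Real.exp (-κ * w)) (κ * Real.exp (-κ * w)) w :=
      fun w => by
        refine (((hasDerivAt_id w).const_mul (-κ)).exp.const_sub 1).congr_deriv ?_
        simp; ring
    have hz1 : z < 1 → W₁ t z = m * (κ * E) := by
      intro hz1
      have hl : IsLocalMax (fun w => W t w - m * (1 - Real.exp (-κ * (w - y)))) z :=
        isLocalMax_of_Icc (a := y) (b := 1) ⟨hlt, hz1⟩ fun w hw => by
          have := hmax (w, y) ⟨h1, hw.1, hw.2⟩
          simp only at this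
          linarith
      have := hl.hasDerivAt_eq_zero ((hW₁ t ht z).sub
        (((hexp (z - y)).comp_sub_const z y).const_mul m))
      linarith
    have hy0 : 0 < y → W₁ t y = m * (κ * E) := by
      intro hy0
      have hl : IsLocalMax (fun w => - W t w - m * (1 - Real.exp (-κ * (z - w)))) y :=
        isLocalMax_of_Icc (a := 0) (b := z) ⟨hy0, hlt⟩ fun w hw => by
          have := hmax (z, w) ⟨hw.1, hw.2, h3⟩
          simp only at this
          linarith
      have := hl.hasDerivAt_eq_zero ((hW₁ t ht y).neg.sub
        (((hexp (z - y)).comp_const_sub z y).const_mul m))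
      linarith
    -- boundary time derivatives
    have hbdry : ∀ y : ℝ, (∀ t, 0 ≤ t → W t y = 0) → HasDerivAt (fun s => W s y) 0 t := fun y h =>
      (hasDerivAt_const t (0 : ℝ)).congr_of_eventuallyEq (by
        filter_upwards [Ioi_mem_nhds ht] with s hs using h s (le_of_lt hs))
    obtain ⟨α, A, hα, hαA, hA, hαd, hαs⟩ : ∃ α A : ℝ, 0 ≤ α ∧ |A| ≤ b₀ ∧
        ((α = 0 ∧ A = 0) ∨ a₀ ≤ α ^ 2) ∧
        HasDerivAt (fun s => W s z) (α ^ 2 * W₂ t z + A * (m * (κ * E)) + f t z) t ∧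
        ∀ᶠ s in 𝓝 (0 : ℝ), z + α * s ≤ 1 := by
      rcases h3.eq_or_lt with h | h
      · refine ⟨0, 0, le_rfl, by simpa using hb₀, Or.inl ⟨rfl, rfl⟩, ?_,
          Eventually.of_forall fun s => by simp [h]⟩
        rw [h, hf1 t ht]
        simpa using hbdry 1 hbd1
      · have ha' := ha t ht z hzI
        have hsq : √(a t z) ^ 2 = a t z := Real.sq_sqrt (by linarith)
        refine ⟨√(a t z), b t z, Real.sqrt_nonneg _, hb t ht z hzI, Or.inr (by rwa [hsq]), ?_, ?_⟩
        · rw [hsq, ← hz1 h]; exact heq t ht z hzI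
        · have : ContinuousAt (fun s => z + √(a t z) * s) 0 := by fun_prop
          exact (this.eventually (Iio_mem_nhds (by simpa using h))).mono fun s hs => le_of_lt hs
    obtain ⟨β, B, hβ, hβB, hB, hβd, hβs⟩ : ∃ β B : ℝ, 0 ≤ β ∧ |B| ≤ b₀ ∧
        ((β = 0 ∧ B = 0) ∨ a₀ ≤ β ^ 2) ∧
        HasDerivAt (fun s => W s y) (β ^ 2 * W₂ t y + B * (m * (κ * E)) + f t y) t ∧
        ∀ᶠ s in 𝓝 (0 : ℝ), 0 ≤ y - β * s := by
      rcases h1.eq_or_lt with h | h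
      · refine ⟨0, 0, le_rfl, by simpa using hb₀, Or.inl ⟨rfl, rfl⟩, ?_,
          Eventually.of_forall fun s => by simp [← h]⟩
        rw [← h, hf0 t ht]
        simpa using hbdry 0 hbd0
      · have ha' := ha t ht y hyI
        have hsq : √(a t y) ^ 2 = a t y := Real.sq_sqrt (by linarith)
        refine ⟨√(a t y), b t y, Real.sqrt_nonneg _, hb t ht y hyI, Or.inr (by rwa [hsq]), ?_, ?_⟩
        · rw [hsq, ← hy0 h]; exact heq t ht y hyI
        · have : ContinuousAt (fun s => y - √(a t y) * s) 0 := by fun_prop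
          exact (this.eventually (Ioi_mem_nhds (by simpa using h))).mono fun s hs => le_of_lt hs
    -- second order condition along the reflected direction
    have hsecond : α ^ 2 * W₂ t z - β ^ 2 * W₂ t y + m * ((α + β) ^ 2 * (κ ^ 2 * E)) ≤ 0 := by
      have hl : IsLocalMax (fun s => W t (z + α * s) - W t (y - β * s) -
          m * (1 - Real.exp (-κ * (z - y + (α + β) * s)))) 0 := by
        have hord : ∀ᶠ s in 𝓝 (0 : ℝ), y - β * s ≤ z + α * s := by
          have : ContinuousAt (fun s => z + α * s - (y - β * s)) 0 := by fun_prop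
          exact (this.eventually (Ioi_mem_nhds (a := 0) (by simpa using hlt))).mono fun s hs => by
            have : 0 < z + α * s - (y - β * s) := hs
            linarith
        filter_upwards [hαs, hβs, hord] with s s1 s2 s3
        have := hmax (z + α * s, y - β * s) ⟨s2, s3, s1⟩
        simp only [mul_zero, add_zero, sub_zero] at this ⊢
        rwa [show z + α * s - (y - β * s) = z - y + (α + β) * s by ring] at this
      have l1 : ∀ s, HasDerivAt (fun s => z + α * s) α s := fun s => by
        simpa using ((hasDerivAt_id s).const_mul α).const_add z
      have l2 : ∀ s, HasDerivAt (fun s => y - β * s) (-β) s := fun s => by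
        simpa using ((hasDerivAt_id s).const_mul β).const_sub y
      have l3 : ∀ s, HasDerivAt (fun s => -κ * (z - y + (α + β) * s)) (-κ * (α + β)) s :=
        fun s => by
          simpa using (((hasDerivAt_id s).const_mul (α + β)).const_add (z - y)).const_mul (-κ)
      have d1 : ∀ s, HasDerivAt (fun s => W t (z + α * s) - W t (y - β * s) -
          m * (1 - Real.exp (-κ * (z - y + (α + β) * s))))
          (W₁ t (z + α * s) * α - W₁ t (y - β * s) * -β -
            m * (-(Real.exp (-κ * (z - y + (α + β) * s)) * (-κ * (α + β))))) s := fun s =>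
        (((hW₁ t ht _).comp s (l1 s)).sub ((hW₁ t ht _).comp s (l2 s))).sub
          (((l3 s).exp.const_sub 1).const_mul m)
      have d2 : HasDerivAt (fun s => W₁ t (z + α * s) * α - W₁ t (y - β * s) * -β -
            m * (-(Real.exp (-κ * (z - y + (α + β) * s)) * (-κ * (α + β)))))
          (W₂ t (z + α * 0) * α * α - W₂ t (y - β * 0) * -β * -β -
            m * (-(Real.exp (-κ * (z - y + (α + β) * 0)) * (-κ * (α + β)) * (-κ * (α + β))))) 0 :=
        ((((hW₂ t ht _).comp 0 (l1 0)).mul_const α).sub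
          (((hW₂ t ht _).comp 0 (l2 0)).mul_const (-β))).sub
          ((((l3 0).exp.mul_const _).neg).const_mul m)
      have := (hl.second_deriv_nonpos (Eventually.of_forall d1) d2).2
      simp only [mul_zero, add_zero, sub_zero] at this
      rw [← hE] at this
      linarith
    refine ⟨_, (hαd.sub hβd).sub ((((hasDerivAt_id t).const_mul L).const_add m₀).mul_const _), ?_⟩
    simp only [mul_one, zero_mul]
    have hff := (abs_le.1 (hf t ht z hzI y hyI)).2
    rw [abs_of_pos (by linarith)] at hff
    have hφr := (one_sub_exp_bounds (κ := κ) (r := z - y) (by linarith)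
      (by linarith)).1
    have hLr : Lf * (z - y) ≤ L * (1 - Real.exp (-κ * (z - y))) := by
      rw [← hLφ, mul_assoc]
      exact mul_le_mul_of_nonneg_left (by linarith) hL0
    have hmE : 0 ≤ m * (κ * E) := by positivity
    have hAB : (A - B) ≤ (α + β) ^ 2 * κ := by
      have a1 := (abs_le.1 hαA).2
      have b1 := (abs_le.1 hβB).1
      have hαβ := mul_nonneg hα hβ
      have hexp : (α + β) ^ 2 = α ^ 2 + β ^ 2 + 2 * (α * β) := by ring
      rcases hA with ⟨rfl, rfl⟩ | hA <;> rcases hB with ⟨rfl, rfl⟩ | hB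
      · simp
      · nlinarith
      · nlinarith
      · nlinarith [mul_nonneg hαβ hκ.le]
    have h5 := mul_le_mul_of_nonneg_right hAB hmE
    have h6 : (α + β) ^ 2 * κ * (m * (κ * E)) = m * ((α + β) ^ 2 * (κ ^ 2 * E)) := by ring
    rw [h6, sub_mul] at h5
    linarith

/-- Uniform Lipschitz propagation for linear parabolic equations with homogeneous Dirichlet
conditions; the constant depends only on the ellipticity and the drift bound. -/
lemma parabolic_lipschitz {a₀ b₀ : ℝ} (ha₀ : 0 < a₀) (hb₀ : 0 ≤ b₀) :
    ∃ Λ > 0, ∀ (m₀ Lf : ℝ) (W W₁ W₂ a b f : ℝ → ℝ → ℝ), 0 ≤ m₀ → 0 ≤ Lf →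
    ContinuousOn (Function.uncurry W) (Ici 0 ×ˢ Icc 0 1) →
    (∀ t, 0 < t → ∀ y, HasDerivAt (W t) (W₁ t y) y) →
    (∀ t, 0 < t → ∀ y, HasDerivAt (W₁ t) (W₂ t y) y) →
    (∀ t, 0 ≤ t → W t 0 = 0) → (∀ t, 0 ≤ t → W t 1 = 0) →
    (∀ t, 0 < t → ∀ y ∈ Icc (0 : ℝ) 1,
      HasDerivAt (fun s => W s y) (a t y * W₂ t y + b t y * W₁ t y + f t y) t) →
    (∀ t, 0 < t → ∀ y ∈ Icc (0 : ℝ) 1, a₀ ≤ a t y) →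
    (∀ t, 0 < t → ∀ y ∈ Icc (0 : ℝ) 1, |b t y| ≤ b₀) →
    (∀ t, 0 < t → ∀ y ∈ Icc (0 : ℝ) 1, ∀ z ∈ Icc (0 : ℝ) 1, |f t y - f t z| ≤ Lf * |y - z|) →
    (∀ t, 0 < t → f t 0 = 0) → (∀ t, 0 < t → f t 1 = 0) →
    (∀ y ∈ Icc (0 : ℝ) 1, ∀ z ∈ Icc (0 : ℝ) 1, |W 0 z - W 0 y| ≤ m₀ * |z - y|) →
    ∀ t, 0 ≤ t → ∀ y ∈ Icc (0 : ℝ) 1, ∀ z ∈ Icc (0 : ℝ) 1,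
      |W t z - W t y| ≤ Λ * (m₀ + Lf * t) * |z - y| := by
  set κ := b₀ / a₀ + 1 with hκdef
  have hκ : 0 < κ := by positivity
  have hκb : b₀ ≤ a₀ * κ := by
    rw [hκdef, mul_add, mul_div_cancel₀ _ ha₀.ne']; linarith
  set q := 1 - Real.exp (-κ) with hq
  have hq0 : 0 < q := by
    have : Real.exp (-κ) < 1 := Real.exp_lt_one_iff.2 (by linarith)
    linarith
  refine ⟨κ / q, by positivity, ?_⟩
  intro m₀ Lf W W₁ W₂ a b f hm₀ hLf hcont hW₁ hW₂ h0 h1 heq ha hb hf hf0 hf1 hinit t ht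
  have hφ : ∀ y ∈ Icc (0 : ℝ) 1, ∀ z ∈ Icc (0 : ℝ) 1, y ≤ z →
      m₀ * |z - y| ≤ m₀ / q * (1 - Real.exp (-κ * (z - y))) := by
    intro y hy z hz hyz
    rw [abs_of_nonneg (by linarith), div_mul_eq_mul_div, le_div_iff₀ hq0, mul_assoc]
    exact mul_le_mul_of_nonneg_left
      (one_sub_exp_bounds (by linarith) (by linarith [hz.2, hy.1])).1 hm₀
  have key : ∀ y ∈ Icc (0 : ℝ) 1, ∀ z ∈ Icc (0 : ℝ) 1, y ≤ z →
      |W t z - W t y| ≤ κ / q * (m₀ + Lf * t) * |z - y| := by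
    intro y hy z hz hyz
    have e1 := parabolic_modulus ha₀ hκ hκb (m₀ := m₀ / q) (by positivity) hLf hcont hW₁ hW₂ h0 h1
      heq ha hb hf hf0 hf1 (fun y hy z hz hyz =>
        ((le_abs_self _).trans (hinit y hy z hz)).trans (hφ y hy z hz hyz)) ht hy hz hyz
    have e2 := parabolic_modulus (W := fun t y => - W t y) (W₁ := fun t y => - W₁ t y)
      (W₂ := fun t y => - W₂ t y) (f := fun t y => - f t y) (a := a) (b := b)
      ha₀ hκ hκb (m₀ := m₀ / q) (by positivity) hLf
      hcont.neg (fun t ht y => (hW₁ t ht y).neg) (fun t ht y => (hW₂ t ht y).neg)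
      (fun t ht => by simp [h0 t ht]) (fun t ht => by simp [h1 t ht])
      (fun t ht y hy => (heq t ht y hy).neg.congr_deriv (by ring)) ha hb
      (fun t ht y hy z hz => by
        rw [show -f t y - -f t z = -(f t y - f t z) by ring, abs_neg]; exact hf t ht y hy z hz)
      (fun t ht => by simp [hf0 t ht]) (fun t ht => by simp [hf1 t ht])
      (fun y hy z hz hyz => by
        refine le_trans ?_ (hφ y hy z hz hyz)
        refine le_trans ?_ (hinit y hy z hz)
        rw [show -W 0 z - -W 0 y = -(W 0 z - W 0 y) by ring]
        exact neg_le_abs _) ht hy hz hyz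
    have e3 := (one_sub_exp_bounds (κ := κ) (r := z - y) (by linarith)
      (by linarith [hz.2, hy.1])).2
    have e4 : (m₀ / q + Lf / q * t) * (1 - Real.exp (-κ * (z - y))) ≤
        κ / q * (m₀ + Lf * t) * |z - y| := by
      rw [abs_of_nonneg (by linarith : 0 ≤ z - y)]
      calc _ ≤ (m₀ / q + Lf / q * t) * (κ * (z - y)) := by gcongr
        _ = _ := by field_simp
    rw [abs_le]
    constructor <;> linarith
  intro y hy z hz
  rcases le_total y z with h | h
  · exact key y hy z hz h
  · rw [abs_sub_comm, abs_sub_comm z]; exact key z hz y hy h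

/-- Classical solutions of `∂ₜX = (1/2) ∂_θX ∂²_θθX` on `[0,1]` with `X(t,0)=0`, `X(t,1)=1`. -/
structure ClassicalSolution (X : ℝ → ℝ → ℝ) : Prop where
  solves : ∀ t, 0 ≤ t → ∀ θ ∈ Icc (0 : ℝ) 1, SolvesAt X t θ
  zero : ∀ t, 0 ≤ t → X t 0 = 0
  one : ∀ t, 0 ≤ t → X t 1 = 1

namespace ClassicalSolution

variable {X : ℝ → ℝ → ℝ}

lemma hasDerivAt (h : ClassicalSolution X) {t : ℝ} (ht : 0 ≤ t) :
    (∀ y, HasDerivAt (X t) (deriv (X t) y) y) ∧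
      ∀ y, HasDerivAt (deriv (X t)) (deriv (deriv (X t)) y) y :=
  (h.solves t ht 0 ⟨le_rfl, zero_le_one⟩).1.hasDerivAt_deriv_two

lemma flux_boundary (h : ClassicalSolution X) {t : ℝ} (ht : 0 ≤ t) :
    (1 / 2) * deriv (X t) 0 * deriv (deriv (X t)) 0 = 0 ∧
      (1 / 2) * deriv (X t) 1 * deriv (deriv (X t)) 1 = 0 := by
  have key : ∀ θ ∈ Icc (0 : ℝ) 1, ∀ c, (∀ t, 0 ≤ t → X t θ = c) →
      (1 / 2) * deriv (X t) θ * deriv (deriv (X t)) θ = 0 := by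
    intro θ hθ c hc
    have h1 := (h.solves t ht θ hθ).2.hasDerivWithinAt (s := Ici t)
    have h2 : HasDerivWithinAt (fun s => X s θ) 0 (Ici t) t :=
      (hasDerivWithinAt_const t (Ici t) c).congr (fun s hs => hc s (ht.trans hs)) (hc t ht)
    exact (uniqueDiffWithinAt_Ici t).eq_deriv _ h1 h2
  exact ⟨key 0 ⟨le_rfl, zero_le_one⟩ 0 h.zero, key 1 ⟨zero_le_one, le_rfl⟩ 1 h.one⟩

/-- Two-sided slope bounds propagate. -/
lemma slope_bounds (h : ClassicalSolution X) {c₀ C₀ : ℝ} (hc₀ : 0 < c₀) (hC₀ : 0 < C₀)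
    (hinit : ∀ θ ∈ Icc (0 : ℝ) 1, c₀ ≤ deriv (X 0) θ ∧ deriv (X 0) θ ≤ C₀) {t : ℝ} (ht : 0 ≤ t)
    {y z : ℝ} (hy : y ∈ Icc (0 : ℝ) 1) (hz : z ∈ Icc (0 : ℝ) 1) (hyz : y ≤ z) :
    c₀ * (z - y) ≤ X t z - X t y ∧ X t z - X t y ≤ C₀ * (z - y) := by
  have hcont := joint_continuity h.solves
  have h1 : ContinuousOn (fun z : ℝ × ℝ × ℝ => X z.1 z.2.1)
      (Icc 0 t ×ˢ {z : ℝ × ℝ | 0 ≤ z.2 ∧ z.2 ≤ z.1 ∧ z.1 ≤ 1}) :=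
    hcont.comp (f := fun z : ℝ × ℝ × ℝ => (z.1, z.2.1)) (by fun_prop)
      (fun z hz => ⟨hz.1.1, hz.2.1.trans hz.2.2.1, hz.2.2.2⟩)
  have h2 : ContinuousOn (fun z : ℝ × ℝ × ℝ => X z.1 z.2.2)
      (Icc 0 t ×ˢ {z : ℝ × ℝ | 0 ≤ z.2 ∧ z.2 ≤ z.1 ∧ z.1 ≤ 1}) :=
    hcont.comp (f := fun z : ℝ × ℝ × ℝ => (z.1, z.2.2)) (by fun_prop)
      (fun z hz => ⟨hz.1.1, hz.2.1, hz.2.2.1.trans hz.2.2.2⟩)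
  have hmvt : ∀ y ∈ Icc (0 : ℝ) 1, ∀ z ∈ Icc (0 : ℝ) 1, y ≤ z →
      c₀ * (z - y) ≤ X 0 z - X 0 y ∧ X 0 z - X 0 y ≤ C₀ * (z - y) := by
    intro y hy z hz hyz
    have hd := (h.hasDerivAt le_rfl).1
    have hcX : ContinuousOn (X 0) (Icc 0 1) := fun w _ => (hd w).continuousAt.continuousWithinAt
    refine ⟨(convex_Icc 0 1).mul_sub_le_image_sub_of_le_deriv hcX
      (fun w _ => (hd w).differentiableAt.differentiableWithinAt) (fun w hw => ?_) y hy z hz hyz,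
      (convex_Icc 0 1).image_sub_le_mul_sub_of_deriv_le hcX
      (fun w _ => (hd w).differentiableAt.differentiableWithinAt) (fun w hw => ?_) y hy z hz hyz⟩
    · exact (hinit w (interior_subset hw)).1
    · exact (hinit w (interior_subset hw)).2
  constructor
  · have := max_principle isCompact_ordered_pairs (T := t)
      (F := fun t z => c₀ * (z.1 - z.2) - (X t z.1 - X t z.2)) 0 ?_ ?_ ?_ t ⟨ht, le_rfl⟩
      (z, y) ⟨hy.1, hyz, hz.2⟩
    · simp only at this; linarith
    · exact ContinuousOn.sub (by fun_prop) (h1.sub h2)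
    · rintro ⟨z, y⟩ ⟨k1, k2, k3⟩
      simp only at k1 k2 k3 ⊢
      have := (hmvt y ⟨k1, by linarith⟩ z ⟨by linarith, k3⟩ k2).1
      linarith
    · rintro t ⟨ht, -⟩ ⟨z, y⟩ ⟨k1, k2, k3⟩ hpos hmax
      simp only at k1 k2 k3 hpos
      have hlt : y < z := lt_of_le_of_ne k2 (by rintro rfl; simp at hpos)
      have hz := h.solves t ht.le z ⟨k1.trans k2, k3⟩
      have hy := h.solves t ht.le y ⟨k1, k2.trans k3⟩
      have hzn : 0 ≤ (1 / 2) * deriv (X t) z * deriv (deriv (X t)) z := by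
        rcases k3.eq_or_lt with rfl | k3
        · exact (h.flux_boundary ht.le).2.ge
        · obtain ⟨e1, e2⟩ := IsLocalMin.deriv_of_sub_linear (l := c₀) hz.1
            (isLocalMin_of_Icc (a := y) (b := 1) ⟨hlt, k3⟩ fun w hw => by
              have := hmax (w, y) ⟨k1, hw.1, hw.2⟩
              simp only at this
              linarith)
          rw [e1]; positivity
      have hyn : (1 / 2) * deriv (X t) y * deriv (deriv (X t)) y ≤ 0 := by
        rcases k1.eq_or_lt with rfl | k1
        · exact (h.flux_boundary ht.le).1.le
        · obtain ⟨e1, e2⟩ := IsLocalMax.deriv_of_sub_linear (l := c₀) hy.1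
            (isLocalMax_of_Icc (a := 0) (b := z) ⟨k1, hlt⟩ fun w hw => by
              have := hmax (z, w) ⟨hw.1, hw.2, k3⟩
              simp only at this
              linarith)
          rw [e1]; exact mul_nonpos_of_nonneg_of_nonpos (by positivity) e2
      exact ⟨_, (hz.2.sub hy.2).const_sub _, by linarith⟩
  · have := max_principle isCompact_ordered_pairs (T := t)
      (F := fun t z => X t z.1 - X t z.2 - C₀ * (z.1 - z.2)) 0 ?_ ?_ ?_ t ⟨ht, le_rfl⟩
      (z, y) ⟨hy.1, hyz, hz.2⟩
    · simp only at this; linarith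
    · exact (h1.sub h2).sub (by fun_prop)
    · rintro ⟨z, y⟩ ⟨k1, k2, k3⟩
      simp only at k1 k2 k3 ⊢
      have := (hmvt y ⟨k1, by linarith⟩ z ⟨by linarith, k3⟩ k2).2
      linarith
    · rintro t ⟨ht, -⟩ ⟨z, y⟩ ⟨k1, k2, k3⟩ hpos hmax
      simp only at k1 k2 k3 hpos
      have hlt : y < z := lt_of_le_of_ne k2 (by rintro rfl; simp at hpos)
      have hz := h.solves t ht.le z ⟨k1.trans k2, k3⟩
      have hy := h.solves t ht.le y ⟨k1, k2.trans k3⟩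
      have hzn : (1 / 2) * deriv (X t) z * deriv (deriv (X t)) z ≤ 0 := by
        rcases k3.eq_or_lt with rfl | k3
        · exact (h.flux_boundary ht.le).2.le
        · obtain ⟨e1, e2⟩ := IsLocalMax.deriv_of_sub_linear (l := C₀) hz.1
            (isLocalMax_of_Icc (a := y) (b := 1) ⟨hlt, k3⟩ fun w hw => by
              have := hmax (w, y) ⟨k1, hw.1, hw.2⟩
              simp only at this
              linarith)
          rw [e1]; exact mul_nonpos_of_nonneg_of_nonpos (by positivity) e2
      have hyn : 0 ≤ (1 / 2) * deriv (X t) y * deriv (deriv (X t)) y := by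
        rcases k1.eq_or_lt with rfl | k1
        · exact (h.flux_boundary ht.le).1.ge
        · obtain ⟨e1, e2⟩ := IsLocalMin.deriv_of_sub_linear (l := C₀) hy.1
            (isLocalMin_of_Icc (a := 0) (b := z) ⟨k1, hlt⟩ fun w hw => by
              have := hmax (z, w) ⟨hw.1, hw.2, k3⟩
              simp only at this
              linarith)
          rw [e1]; positivity
      exact ⟨_, (hz.2.sub hy.2).sub_const _, by linarith⟩

lemma deriv_bounds (h : ClassicalSolution X) {c₀ C₀ : ℝ} (hc₀ : 0 < c₀) (hC₀ : 0 < C₀)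
    (hinit : ∀ θ ∈ Icc (0 : ℝ) 1, c₀ ≤ deriv (X 0) θ ∧ deriv (X 0) θ ≤ C₀) {t : ℝ} (ht : 0 ≤ t)
    {y : ℝ} (hy : y ∈ Icc (0 : ℝ) 1) : c₀ ≤ deriv (X t) y ∧ deriv (X t) y ≤ C₀ :=
  ⟨((h.hasDerivAt ht).1 y).ge_of_sub_ge hy fun _ hy _ hz hyz =>
      (h.slope_bounds hc₀ hC₀ hinit ht hy hz hyz).1,
    ((h.hasDerivAt ht).1 y).le_of_sub_le hy fun _ hy _ hz hyz =>
      (h.slope_bounds hc₀ hC₀ hinit ht hy hz hyz).2⟩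

end ClassicalSolution

/-- Quantitative `C³` data with slopes in `[c₀, C₀]`. -/
structure BoundedDatum (c₀ C₀ K : ℝ) (f : ℝ → ℝ) : Prop where
  contDiff : ContDiff ℝ 3 f
  bound : ∀ k : ℕ, k ≤ 3 → ∀ θ ∈ Icc (0 : ℝ) 1, |iteratedDeriv k f θ| ≤ K
  slope : ∀ θ ∈ Icc (0 : ℝ) 1, c₀ ≤ deriv f θ ∧ deriv f θ ≤ C₀

namespace BoundedDatum

variable {c₀ C₀ K : ℝ} {f : ℝ → ℝ}

lemma hasDerivAt (h : BoundedDatum c₀ C₀ K f) (y : ℝ) :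
    HasDerivAt (deriv (deriv f)) (iteratedDeriv 3 f y) y := by
  have h2 : deriv (deriv f) = iteratedDeriv 2 f := by
    simp [iteratedDeriv_succ]
  rw [h2, iteratedDeriv_succ (n := 2)]
  exact ((h.contDiff.differentiable_iteratedDeriv 2 (by norm_num)) y).hasDerivAt

lemma deriv_le (h : BoundedDatum c₀ C₀ K f) {y : ℝ} (hy : y ∈ Icc (0 : ℝ) 1) :
    |deriv f y| ≤ K := by
  have := h.bound 1 (by norm_num) y hy
  rwa [iteratedDeriv_one] at this

lemma deriv_two_le (h : BoundedDatum c₀ C₀ K f) {y : ℝ} (hy : y ∈ Icc (0 : ℝ) 1) :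
    |deriv (deriv f) y| ≤ K := by
  have := h.bound 2 (by norm_num) y hy
  simpa [iteratedDeriv_succ] using this

lemma flux_lipschitz (h : BoundedDatum c₀ C₀ K f) {y z : ℝ} (hy : y ∈ Icc (0 : ℝ) 1)
    (hz : z ∈ Icc (0 : ℝ) 1) :
    |(1 / 2) * deriv f y * deriv (deriv f) y - (1 / 2) * deriv f z * deriv (deriv f) z| ≤
      K ^ 2 * |y - z| := by
  have h1 := (ContDiff.hasDerivAt_deriv_two (f := f) (h.contDiff.of_le (by norm_num))).2
  have hd : ∀ w, HasDerivAt (fun w => (1 / 2) * deriv f w * deriv (deriv f) w)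
      (((1 / 2) * deriv (deriv f) w) * deriv (deriv f) w +
        (1 / 2) * deriv f w * iteratedDeriv 3 f w) w := fun w =>
    ((h1 w).const_mul (1 / 2)).mul (h.hasDerivAt w)
  have hb : ∀ w ∈ Icc (0 : ℝ) 1, ‖((1 / 2) * deriv (deriv f) w) * deriv (deriv f) w +
        (1 / 2) * deriv f w * iteratedDeriv 3 f w‖ ≤ K ^ 2 := by
    intro w hw
    have e1 := h.deriv_le hw
    have e2 := h.deriv_two_le hw
    have e3 := h.bound 3 le_rfl w hw
    have hK : 0 ≤ K := (abs_nonneg _).trans e1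
    rw [Real.norm_eq_abs]
    calc _ ≤ _ := abs_add_le _ _
      _ = (1 / 2) * |deriv (deriv f) w| * |deriv (deriv f) w| +
          (1 / 2) * |deriv f w| * |iteratedDeriv 3 f w| := by
            simp only [abs_mul]; norm_num
      _ ≤ (1 / 2) * K * K + (1 / 2) * K * K := by gcongr
      _ = K ^ 2 := by ring
  simpa using (convex_Icc (0 : ℝ) 1).norm_image_sub_le_of_norm_hasDerivWithin_le
    (fun w hw => (hd w).hasDerivWithinAt) hb hz hy

end BoundedDatum

namespace ClassicalSolution

lemma exists_increment_bound {c₀ C₀ K : ℝ} (hc₀ : 0 < c₀) (hC₀ : 0 < C₀) (hK : 0 < K) :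
    ∃ A > 0, ∀ X, ClassicalSolution X → BoundedDatum c₀ C₀ K (X 0) →
      ∀ t, 0 ≤ t → ∀ y ∈ Icc (0 : ℝ) 1, ∀ z ∈ Icc (0 : ℝ) 1,
        |(X t z - X 0 z) - (X t y - X 0 y)| ≤ A * t * |z - y| := by
  obtain ⟨Λ, hΛ, H⟩ := parabolic_lipschitz (a₀ := c₀ / 2) (b₀ := K / 2) (by positivity)
    (by positivity)
  refine ⟨Λ * K ^ 2, by positivity, fun X h hb t ht y hy z hz => ?_⟩
  have hd := fun t (ht : 0 ≤ t) => h.hasDerivAt ht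
  have h0 := hd 0 le_rfl
  have hcont : ContinuousOn (Function.uncurry fun t y => X t y - X 0 y)
      (Ici 0 ×ˢ Icc 0 1) := by
    refine (joint_continuity h.solves).sub ?_
    have : Continuous (X 0) := (h.solves 0 le_rfl 0 ⟨le_rfl, zero_le_one⟩).1.continuous
    exact (this.comp continuous_snd).continuousOn
  have := H 0 (K ^ 2) (fun t y => X t y - X 0 y) (fun t y => deriv (X t) y - deriv (X 0) y)
    (fun t y => deriv (deriv (X t)) y - deriv (deriv (X 0)) y)
    (fun t y => (1 / 2) * deriv (X t) y) (fun t y => (1 / 2) * deriv (deriv (X 0)) y)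
    (fun t y => (1 / 2) * deriv (X 0) y * deriv (deriv (X 0)) y) le_rfl (by positivity) hcont
    (fun t ht y => ((hd t ht.le).1 y).sub (h0.1 y))
    (fun t ht y => ((hd t ht.le).2 y).sub (h0.2 y))
    (fun t ht => by simp [h.zero t ht, h.zero 0 le_rfl])
    (fun t ht => by simp [h.one t ht, h.one 0 le_rfl])
    (fun t ht y hy => by
      refine ((h.solves t ht.le y hy).2.sub_const (X 0 y)).congr_deriv ?_
      ring)
    (fun t ht y hy => by
      have := (h.deriv_bounds hc₀ hC₀ hb.slope ht.le hy).1
      linarith)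
    (fun t ht y hy => by
      have := hb.deriv_two_le hy
      rw [abs_mul]; norm_num; linarith)
    (fun t ht y hy z hz => hb.flux_lipschitz hy hz)
    (fun t ht => (h.flux_boundary le_rfl).1) (fun t ht => (h.flux_boundary le_rfl).2)
    (fun y hy z hz => by simp) t ht y hy z hz
  refine this.trans (le_of_eq (by ring))

lemma shift_abs_le {X : ℝ → ℝ → ℝ} (h : ClassicalSolution X) {c₀ C₀ K L : ℝ} (hc₀ : 0 < c₀)
    (hC₀ : 0 < C₀) (hb : BoundedDatum c₀ C₀ K (X 0)) {s : ℝ} (hs : 0 ≤ s) (hL : 0 ≤ L)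
    (hinit : ∀ y ∈ Icc (0 : ℝ) 1, |X s y - X 0 y| ≤ L) {t : ℝ} (ht : 0 ≤ t) {y : ℝ}
    (hy : y ∈ Icc (0 : ℝ) 1) : |X (t + s) y - X t y| ≤ L := by
  have hcont := joint_continuity h.solves
  have h1 : ContinuousOn (fun p : ℝ × ℝ => X (p.1 + s) p.2 - X p.1 p.2)
      (Icc 0 t ×ˢ Icc 0 1) := by
    refine ContinuousOn.sub ?_ (hcont.mono ?_)
    · exact hcont.comp (f := fun p : ℝ × ℝ => (p.1 + s, p.2)) (by fun_prop)
        (fun p hp => ⟨add_nonneg hp.1.1 hs, hp.2⟩)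
    · exact fun p hp => ⟨hp.1.1, hp.2⟩
  have hder : ∀ t, 0 ≤ t → ∀ y ∈ Icc (0 : ℝ) 1, HasDerivAt (fun t => X (t + s) y - X t y)
      ((1 / 2) * deriv (X (t + s)) y * (deriv (deriv (X (t + s))) y - deriv (deriv (X t)) y) +
        (1 / 2) * deriv (deriv (X t)) y * (deriv (X (t + s)) y - deriv (X t) y)) t := by
    intro t ht y hy
    have e1 := (h.solves (t + s) (add_nonneg ht hs) y hy).2.comp_add_const t s
    refine (e1.sub (h.solves t ht y hy).2).congr_deriv ?_
    ring
  have hbdry : ∀ t, 0 ≤ t → X (t + s) 0 - X t 0 = 0 ∧ X (t + s) 1 - X t 1 = 0 := by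
    intro t ht
    simp [h.zero t ht, h.zero _ (add_nonneg ht hs), h.one t ht, h.one _ (add_nonneg ht hs)]
  have hcd : ∀ t, 0 ≤ t → ContDiff ℝ 2 (X t) := fun t ht =>
    (h.solves t ht 0 ⟨le_rfl, zero_le_one⟩).1
  have hdsub : ∀ t, 0 ≤ t → ∀ y, deriv (fun w => X (t + s) w - X t w) y =
      deriv (X (t + s)) y - deriv (X t) y ∧
      deriv (deriv (fun w => X (t + s) w - X t w)) y =
      deriv (deriv (X (t + s))) y - deriv (deriv (X t)) y := by
    intro t ht y
    have e := h.hasDerivAt ht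
    have e' := h.hasDerivAt (add_nonneg ht hs)
    have k1 : deriv (fun w => X (t + s) w - X t w) =
        fun w => deriv (X (t + s)) w - deriv (X t) w :=
      funext fun w => ((e'.1 w).sub (e.1 w)).deriv
    exact ⟨congrFun k1 y, by rw [k1]; exact ((e'.2 y).sub (e.2 y)).deriv⟩
  have up := max_principle isCompact_Icc (T := t)
      (F := fun t y => X (t + s) y - X t y - L) 0 (h1.sub continuousOn_const)
      (fun y hy => by have := (abs_le.1 (hinit y hy)).2; simp only [zero_add]; linarith)
      (fun t ht y hy hpos hmax => by
        have hb0 := hbdry t ht.1.le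
        have hy' : y ∈ Ioo (0 : ℝ) 1 := by
          refine ⟨lt_of_le_of_ne hy.1 ?_, lt_of_le_of_ne hy.2 ?_⟩ <;> rintro rfl <;>
            linarith [hb0.1, hb0.2]
        obtain ⟨e1, e2⟩ := IsLocalMax.deriv_of_sub_linear (l := 0)
          ((hcd _ (add_nonneg ht.1.le hs)).sub (hcd t ht.1.le))
          (isLocalMax_of_Icc hy' fun w hw => by
            have := hmax w hw
            simp only [zero_mul] at this ⊢
            linarith)
        have hk := hdsub t ht.1.le y
        rw [hk.1] at e1; rw [hk.2] at e2
        refine ⟨_, (hder t ht.1.le y hy).sub_const L, ?_⟩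
        rw [e1, mul_zero, add_zero, zero_mul]
        have := (h.deriv_bounds hc₀ hC₀ hb.slope (add_nonneg ht.1.le hs) hy).1
        exact mul_nonpos_of_nonneg_of_nonpos (by linarith) e2) t ⟨ht, le_rfl⟩ y hy
  have lo := max_principle isCompact_Icc (T := t)
      (F := fun t y => -(X (t + s) y - X t y) - L) 0 (h1.neg.sub continuousOn_const)
      (fun y hy => by have := (abs_le.1 (hinit y hy)).1; simp only [zero_add]; linarith)
      (fun t ht y hy hpos hmax => by
        have hb0 := hbdry t ht.1.le
        have hy' : y ∈ Ioo (0 : ℝ) 1 := by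
          refine ⟨lt_of_le_of_ne hy.1 ?_, lt_of_le_of_ne hy.2 ?_⟩ <;> rintro rfl <;>
            linarith [hb0.1, hb0.2]
        obtain ⟨e1, e2⟩ := IsLocalMin.deriv_of_sub_linear (l := 0)
          ((hcd _ (add_nonneg ht.1.le hs)).sub (hcd t ht.1.le))
          (isLocalMin_of_Icc hy' fun w hw => by
            have := hmax w hw
            simp only [zero_mul] at this ⊢
            linarith)
        have hk := hdsub t ht.1.le y
        rw [hk.1] at e1; rw [hk.2] at e2
        refine ⟨_, (hder t ht.1.le y hy).neg.sub_const L, ?_⟩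
        rw [e1, mul_zero, add_zero, zero_mul]
        have := (h.deriv_bounds hc₀ hC₀ hb.slope (add_nonneg ht.1.le hs) hy).1
        have := mul_nonneg (by linarith : 0 ≤ (1 / 2) * deriv (X (t + s)) y) e2
        linarith) t ⟨ht, le_rfl⟩ y hy
  rw [abs_le]; constructor <;> linarith

end ClassicalSolution

lemma abs_deriv_le_of_lipschitz_deriv {q q' : ℝ → ℝ} {e m h θ : ℝ} (hh : 0 < h)
    (hh' : h ≤ 1 / 2) (hm : 0 ≤ m) (hq : ∀ y, HasDerivAt q (q' y) y)
    (hqe : ∀ y ∈ Icc (0 : ℝ) 1, |q y| ≤ e)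
    (hl : ∀ y ∈ Icc (0 : ℝ) 1, ∀ z ∈ Icc (0 : ℝ) 1, |q' y - q' z| ≤ m * |y - z|)
    (hθ : θ ∈ Icc (0 : ℝ) 1) : |q' θ| ≤ 2 * e / h + m * h := by
  have key : ∀ a b, 0 ≤ a → b ≤ 1 → b - a = h → θ ∈ Icc a b → |q' θ| ≤ 2 * e / h + m * h := by
    intro a b ha hb hab hθ'
    obtain ⟨ξ, hξ, he⟩ := exists_hasDerivAt_eq_slope q q' (by linarith : a < b)
      (fun y _ => (hq y).continuousAt.continuousWithinAt) (fun y _ => hq y)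
    have h1 := hl θ hθ ξ ⟨by linarith [hξ.1], by linarith [hξ.2]⟩
    have h2 : |q' ξ| ≤ 2 * e / h := by
      rw [he, hab, abs_div, abs_of_pos hh]
      gcongr
      have k1 := hqe a ⟨ha, by linarith⟩
      have k2 := hqe b ⟨by linarith, hb⟩
      exact (abs_sub _ _).trans (by linarith)
    have h3 : |θ - ξ| ≤ h := by
      rw [abs_le]; constructor <;> linarith [hξ.1, hξ.2, hθ'.1, hθ'.2]
    have h4 : m * |θ - ξ| ≤ m * h := by gcongr
    have h5 : |q' θ| ≤ |q' ξ| + |q' θ - q' ξ| := by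
      have := abs_add_le (q' ξ) (q' θ - q' ξ)
      rwa [add_sub_cancel] at this
    linarith
  rcases le_total θ (1 / 2) with h1 | h1
  · exact key θ (θ + h) hθ.1 (by linarith) (by ring) ⟨le_rfl, by linarith⟩
  · exact key (θ - h) θ (by linarith) hθ.2 (by ring) ⟨by linarith, le_rfl⟩

/-- Uniform-in-time regularity estimates with a common constant `M`. -/
structure RegularityBounds (c₀ C₀ M : ℝ) (X : ℝ → ℝ → ℝ) : Prop where
  slope : ∀ t, 0 ≤ t → ∀ y ∈ Icc (0 : ℝ) 1, c₀ ≤ deriv (X t) y ∧ deriv (X t) y ≤ C₀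
  deriv_two_zero : ∀ t, 0 ≤ t → deriv (deriv (X t)) 0 = 0 ∧ deriv (deriv (X t)) 1 = 0
  shift : ∀ t, 0 ≤ t → ∀ s, 0 ≤ s → ∀ y ∈ Icc (0 : ℝ) 1, |X (t + s) y - X t y| ≤ M * s
  deriv_shift : ∀ t, 0 ≤ t → ∀ s, 0 ≤ s → ∀ y ∈ Icc (0 : ℝ) 1,
    |deriv (X (t + s)) y - deriv (X t) y| ≤ M * s
  deriv_two_le : ∀ t, 0 ≤ t → ∀ y ∈ Icc (0 : ℝ) 1, |deriv (deriv (X t)) y| ≤ M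
  deriv_two_lipschitz : ∀ t, 0 ≤ t → ∀ y ∈ Icc (0 : ℝ) 1, ∀ z ∈ Icc (0 : ℝ) 1,
    |deriv (deriv (X t)) z - deriv (deriv (X t)) y| ≤ M * |z - y|
  deriv_two_initial : ∀ t, 0 ≤ t → ∀ y ∈ Icc (0 : ℝ) 1,
    (deriv (deriv (X t)) y - deriv (deriv (X 0)) y) ^ 2 ≤ M * min 1 t

namespace ClassicalSolution

theorem exists_regularityBounds {c₀ C₀ K : ℝ} (hc₀ : 0 < c₀) (hC₀ : 0 < C₀) (hK : 0 < K) :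
    ∃ M > 0, ∀ X, ClassicalSolution X → BoundedDatum c₀ C₀ K (X 0) →
      RegularityBounds c₀ C₀ M X := by
  obtain ⟨A, hA, HA⟩ := exists_increment_bound hc₀ hC₀ hK
  set B := 2 * A / c₀ with hB
  have hBpos : 0 < B := by positivity
  obtain ⟨Λ, hΛ, H⟩ := parabolic_lipschitz (a₀ := c₀ / 2) (b₀ := B / 2) (by positivity)
    (by positivity)
  set A₂ := Λ * A with hA₂
  have hA₂pos : 0 < A₂ := by positivity
  set M₃ := (2 * A₂ + B ^ 2) / c₀ with hM₃
  have hM₃pos : 0 < M₃ := by positivity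
  set M := A + A₂ + B + M₃ + (4 * A₂ + M₃) ^ 2 + (2 * B) ^ 2 with hM
  have m1 : 0 ≤ (4 * A₂ + M₃) ^ 2 := sq_nonneg _
  have m2 : 0 ≤ (2 * B) ^ 2 := sq_nonneg _
  refine ⟨M, by positivity, fun X h hb => ?_⟩
  have hslope : ∀ t, 0 ≤ t → ∀ y ∈ Icc (0 : ℝ) 1, c₀ ≤ deriv (X t) y ∧ deriv (X t) y ≤ C₀ :=
    fun t ht y hy => h.deriv_bounds hc₀ hC₀ hb.slope ht hy
  have h0mem : (0 : ℝ) ∈ Icc (0 : ℝ) 1 := ⟨le_rfl, zero_le_one⟩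
  have h1mem : (1 : ℝ) ∈ Icc (0 : ℝ) 1 := ⟨zero_le_one, le_rfl⟩
  have hshift : ∀ t, 0 ≤ t → ∀ s, 0 ≤ s → ∀ y ∈ Icc (0 : ℝ) 1,
      |X (t + s) y - X t y| ≤ A * s := by
    intro t ht s hs y hy
    refine h.shift_abs_le hc₀ hC₀ hb hs (by positivity) (fun y hy => ?_) ht hy
    have := HA X h hb s hs 0 h0mem y hy
    rw [h.zero s hs, h.zero 0 le_rfl, sub_zero, sub_zero, sub_zero, abs_of_nonneg hy.1] at this
    exact this.trans (mul_le_of_le_one_right (by positivity) hy.2)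
  have hd2 : ∀ t, 0 ≤ t → ∀ y ∈ Icc (0 : ℝ) 1, |deriv (deriv (X t)) y| ≤ B := by
    intro t ht y hy
    have e1 := hasDerivAt_right_bound (h.solves t ht y hy).2
      (fun s hs => hshift t ht s hs.le y hy)
    have e2 := (hslope t ht y hy).1
    rw [abs_mul, abs_mul, abs_of_pos (by linarith : 0 < deriv (X t) y),
      abs_of_pos (by norm_num : (0 : ℝ) < 1 / 2)] at e1
    rw [hB, le_div_iff₀ hc₀]
    nlinarith [abs_nonneg (deriv (deriv (X t)) y)]
  have hincr : ∀ t, 0 ≤ t → ∀ s, 0 ≤ s → ∀ y ∈ Icc (0 : ℝ) 1, ∀ z ∈ Icc (0 : ℝ) 1,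
      |(X (t + s) z - X t z) - (X (t + s) y - X t y)| ≤ A₂ * s * |z - y| := by
    intro t ht s hs y hy z hz
    have hcont := joint_continuity h.solves
    have h1 : ContinuousOn (Function.uncurry fun t y => X (t + s) y - X t y)
        (Ici 0 ×ˢ Icc 0 1) := by
      refine ContinuousOn.sub ?_ hcont
      exact hcont.comp (f := fun p : ℝ × ℝ => (p.1 + s, p.2)) (by fun_prop)
        (fun p hp => ⟨add_nonneg hp.1 hs, hp.2⟩)
    have := H (A * s) 0 (fun t y => X (t + s) y - X t y)
      (fun t y => deriv (X (t + s)) y - deriv (X t) y)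
      (fun t y => deriv (deriv (X (t + s))) y - deriv (deriv (X t)) y)
      (fun t y => (1 / 2) * deriv (X (t + s)) y) (fun t y => (1 / 2) * deriv (deriv (X t)) y)
      (fun _ _ => 0) (by positivity) le_rfl h1
      (fun t ht y => ((h.hasDerivAt (by linarith : 0 ≤ t + s)).1 y).sub
        ((h.hasDerivAt ht.le).1 y))
      (fun t ht y => ((h.hasDerivAt (by linarith : 0 ≤ t + s)).2 y).sub
        ((h.hasDerivAt ht.le).2 y))
      (fun t ht => by simp [h.zero t ht, h.zero _ (add_nonneg ht hs)])
      (fun t ht => by simp [h.one t ht, h.one _ (add_nonneg ht hs)])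
      (fun t ht y hy => by
        have e1 := (h.solves (t + s) (by linarith) y hy).2.comp_add_const t s
        refine (e1.sub (h.solves t ht.le y hy).2).congr_deriv ?_
        ring)
      (fun t ht y hy => by
        have := (hslope (t + s) (by linarith) y hy).1
        linarith)
      (fun t ht y hy => by
        have := hd2 t ht.le y hy
        rw [abs_mul]; norm_num; linarith)
      (fun t ht y hy z hz => by simp)
      (fun t ht => rfl) (fun t ht => rfl)
      (fun y hy z hz => by
        simp only [zero_add]
        exact HA X h hb s hs y hy z hz) t ht y hy z hz
    refine this.trans (le_of_eq (by rw [hA₂]; ring))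
  have hdshift : ∀ t, 0 ≤ t → ∀ s, 0 ≤ s → ∀ y ∈ Icc (0 : ℝ) 1,
      |deriv (X (t + s)) y - deriv (X t) y| ≤ A₂ * s := by
    intro t ht s hs y hy
    exact HasDerivAt.abs_le_of_sub_le (f := fun y => X (t + s) y - X t y) hy
      (((h.hasDerivAt (add_nonneg ht hs)).1 y).sub ((h.hasDerivAt ht).1 y))
      (fun y hy z hz => hincr t ht s hs y hy z hz)
  have hmvt : ∀ t, 0 ≤ t → ∀ y ∈ Icc (0 : ℝ) 1, ∀ z ∈ Icc (0 : ℝ) 1,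
      |deriv (X t) z - deriv (X t) y| ≤ B * |z - y| := by
    intro t ht y hy z hz
    simpa using (convex_Icc (0 : ℝ) 1).norm_image_sub_le_of_norm_hasDerivWithin_le
      (fun w _ => ((h.hasDerivAt ht).2 w).hasDerivWithinAt) (hd2 t ht) hy hz
  have hlip : ∀ t, 0 ≤ t → ∀ y ∈ Icc (0 : ℝ) 1, ∀ z ∈ Icc (0 : ℝ) 1,
      |deriv (deriv (X t)) z - deriv (deriv (X t)) y| ≤ M₃ * |z - y| := by
    intro t ht y hy z hz
    have e1 := hasDerivAt_right_bound (L := A₂ * |z - y|)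
      ((h.solves t ht z hz).2.sub (h.solves t ht y hy).2)
      (fun s hs => by
        have := hincr t ht s hs.le y hy z hz
        simp only [Pi.sub_apply]
        rw [show X (t + s) z - X (t + s) y - (X t z - X t y) =
          (X (t + s) z - X t z) - (X (t + s) y - X t y) by ring]
        linarith)
    have e2 := hmvt t ht y hy z hz
    have e3 := hd2 t ht y hy
    have e4 := (hslope t ht z hz).1
    set p := deriv (X t) z
    set p' := deriv (X t) y
    set r := deriv (deriv (X t)) z
    set r' := deriv (deriv (X t)) y
    have e5 : p * |r - r'| ≤ (2 * A₂ + B ^ 2) * |z - y| := by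
      rw [← abs_of_pos (by linarith : 0 < p), ← abs_mul,
        show p * (r - r') = 2 * (1 / 2 * p * r - 1 / 2 * p' * r') - r' * (p - p') by ring]
      refine (abs_sub _ _).trans ?_
      rw [abs_mul, abs_mul, abs_of_pos (by norm_num : (0 : ℝ) < 2)]
      have : |r'| * |p - p'| ≤ B * (B * |z - y|) := by gcongr
      linarith
    rw [hM₃, div_mul_eq_mul_div, le_div_iff₀ hc₀]
    nlinarith [abs_nonneg (r - r')]
  have hmono : ∀ {a b r : ℝ}, 0 ≤ r → a ≤ b → a * r ≤ b * r := fun hr hab =>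
    mul_le_mul_of_nonneg_right hab hr
  refine ⟨hslope, fun t ht => ?_, fun t ht s hs y hy => ?_, fun t ht s hs y hy => ?_,
    fun t ht y hy => ?_, fun t ht y hy z hz => ?_, fun t ht y hy => ?_⟩
  · have e1 := (hslope t ht 0 h0mem).1
    have e2 := (hslope t ht 1 h1mem).1
    have e3 := h.flux_boundary ht
    exact ⟨(mul_eq_zero.1 e3.1).resolve_left (by linarith [mul_pos (by norm_num : (0:ℝ) < 1 / 2) (hc₀.trans_le e1)] |> ne_of_gt),
      (mul_eq_zero.1 e3.2).resolve_left (by linarith [mul_pos (by norm_num : (0:ℝ) < 1 / 2) (hc₀.trans_le e2)] |> ne_of_gt)⟩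
  · exact (hshift t ht s hs y hy).trans (hmono hs (by linarith))
  · exact (hdshift t ht s hs y hy).trans (hmono hs (by linarith))
  · exact (hd2 t ht y hy).trans (by linarith)
  · exact (hlip t ht y hy z hz).trans (hmono (abs_nonneg _) (by linarith))
  · rcases le_total 1 t with ht1 | ht1
    · rw [min_eq_left ht1, mul_one]
      have e1 := hd2 t ht y hy
      have e2 := hd2 0 le_rfl y hy
      have e3 : |deriv (deriv (X t)) y - deriv (deriv (X 0)) y| ≤ 2 * B :=
        (abs_sub _ _).trans (by linarith)
      rw [← sq_abs]
      refine (pow_le_pow_left₀ (abs_nonneg _) e3 2).trans (by linarith)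
    · rw [min_eq_right ht1]
      rcases ht.eq_or_lt with rfl | htpos
      · simp
      have hsq : 0 < √t := Real.sqrt_pos.2 htpos
      have hsq1 : √t ≤ 1 := Real.sqrt_le_one.2 ht1
      have hsqt : √t ^ 2 = t := Real.sq_sqrt ht
      have key := abs_deriv_le_of_lipschitz_deriv (q := fun y => deriv (X t) y - deriv (X 0) y)
        (q' := fun y => deriv (deriv (X t)) y - deriv (deriv (X 0)) y) (e := A₂ * t)
        (m := 2 * M₃) (h := √t / 2) (by positivity) (by linarith) (by positivity)
        (fun y => ((h.hasDerivAt ht).2 y).sub ((h.hasDerivAt le_rfl).2 y))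
        (fun y hy => by
          have := hdshift 0 le_rfl t ht y hy
          rwa [zero_add] at this)
        (fun y hy z hz => by
          have e1 := hlip t ht z hz y hy
          have e2 := hlip 0 le_rfl z hz y hy
          rw [show deriv (deriv (X t)) y - deriv (deriv (X 0)) y -
            (deriv (deriv (X t)) z - deriv (deriv (X 0)) z) =
            (deriv (deriv (X t)) y - deriv (deriv (X t)) z) -
            (deriv (deriv (X 0)) y - deriv (deriv (X 0)) z) by ring]
          exact (abs_sub _ _).trans (by linarith)) hy
      have e1 : 2 * (A₂ * t) / (√t / 2) + 2 * M₃ * (√t / 2) = (4 * A₂ + M₃) * √t := by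
        rw [← hsqt, Real.sqrt_sq hsq.le]
        field_simp
        ring
      rw [e1] at key
      rw [← sq_abs]
      refine (pow_le_pow_left₀ (abs_nonneg _) key 2).trans ?_
      rw [mul_pow, hsqt]
      exact hmono ht (by linarith)

end ClassicalSolution

lemma abs_sub_sub_le_of_deriv_two {f f₁ f₂ : ℝ → ℝ} {B m y : ℝ}
    (h1 : ∀ w, HasDerivAt f (f₁ w) w) (h2 : ∀ w, HasDerivAt f₁ (f₂ w) w)
    (hB : ∀ w ∈ uIcc m y, |f₂ w| ≤ B) : |f y - f m - f₁ m * (y - m)| ≤ B * (y - m) ^ 2 := by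
  have hB0 : 0 ≤ B := (abs_nonneg _).trans (hB m left_mem_uIcc)
  have e1 : ∀ w ∈ uIcc m y, ‖f₁ w - f₁ m * 1‖ ≤ B * |y - m| := by
    intro w hw
    have := (convex_uIcc m y).norm_image_sub_le_of_norm_hasDerivWithin_le
      (fun w _ => (h2 w).hasDerivWithinAt) hB left_mem_uIcc hw
    rw [mul_one]
    refine this.trans ?_
    rw [Real.norm_eq_abs]
    exact mul_le_mul_of_nonneg_left (abs_sub_left_of_mem_uIcc hw) hB0
  have := (convex_uIcc m y).norm_image_sub_le_of_norm_hasDerivWithin_le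
      (f := fun w => f w - f₁ m * w)
      (fun w _ => ((h1 w).sub ((hasDerivAt_id w).const_mul (f₁ m))).hasDerivWithinAt) e1
      left_mem_uIcc right_mem_uIcc
  rw [Real.norm_eq_abs, Real.norm_eq_abs, mul_assoc, ← pow_two, sq_abs] at this
  rwa [show f y - f₁ m * y - (f m - f₁ m * m) = f y - f m - f₁ m * (y - m) by ring] at this

lemma abs_average_sub_le {f f₁ f₂ : ℝ → ℝ} {B m h : ℝ} (hh : 0 < h)
    (h1 : ∀ w, HasDerivAt f (f₁ w) w) (h2 : ∀ w, HasDerivAt f₁ (f₂ w) w)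
    (hB : ∀ w ∈ Icc (m - h) (m + h), |f₂ w| ≤ B) :
    |(1 / (2 * h)) * (∫ w in (m - h)..(m + h), f w) - f m| ≤ B * h ^ 2 := by
  have hB0 : 0 ≤ B := (abs_nonneg _).trans (hB m ⟨by linarith, by linarith⟩)
  have hc : Continuous f := continuous_iff_continuousAt.2 fun w => (h1 w).continuousAt
  have hintegral : (∫ w in (m - h)..(m + h), (f w - f m - f₁ m * (w - m))) =
      (∫ w in (m - h)..(m + h), f w) - 2 * h * f m := by
    rw [intervalIntegral.integral_sub, intervalIntegral.integral_sub,
      intervalIntegral.integral_const, intervalIntegral.integral_const_mul,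
      intervalIntegral.integral_sub, integral_id, intervalIntegral.integral_const, smul_eq_mul,
      smul_eq_mul]
    · ring
    all_goals apply Continuous.intervalIntegrable; fun_prop
  have hle : ‖∫ w in (m - h)..(m + h), (f w - f m - f₁ m * (w - m))‖ ≤
      (B * h ^ 2) * |m + h - (m - h)| := by
    refine intervalIntegral.norm_integral_le_of_norm_le_const fun w hw => ?_
    rw [uIoc_of_le (by linarith)] at hw
    have hsub : uIcc m w ⊆ Icc (m - h) (m + h) :=
      uIcc_subset_Icc ⟨by linarith, by linarith⟩ ⟨hw.1.le, hw.2⟩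
    refine (abs_sub_sub_le_of_deriv_two h1 h2 fun w hw => hB w (hsub hw)).trans ?_
    refine mul_le_mul_of_nonneg_left ?_ hB0
    exact sq_le_sq' (by linarith [hw.1]) (by linarith [hw.2])
  rw [hintegral, Real.norm_eq_abs, show m + h - (m - h) = 2 * h by ring,
    abs_of_pos (by positivity : 0 < 2 * h)] at hle
  have : (1 / (2 * h)) * (∫ w in (m - h)..(m + h), f w) - f m =
      ((∫ w in (m - h)..(m + h), f w) - 2 * h * f m) / (2 * h) := by field_simp
  rw [this, abs_div, abs_of_pos (by positivity : 0 < 2 * h), div_le_iff₀ (by positivity)]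
  exact hle

lemma abs_centered_difference_sub_le {f f₁ f₂ : ℝ → ℝ} {M m h : ℝ} (hh : 0 < h) (hM : 0 ≤ M)
    (h1 : ∀ w, HasDerivAt f (f₁ w) w) (h2 : ∀ w, HasDerivAt f₁ (f₂ w) w)
    (hl : ∀ y ∈ Icc (m - h) (m + h), ∀ z ∈ Icc (m - h) (m + h),
      |f₂ z - f₂ y| ≤ M * |z - y|) :
    |(f (m + h) - f (m - h)) / (2 * h) - f₁ m| ≤ M * h ^ 2 := by
  have := abs_sub_sub_le_of_deriv_two (f := fun s => f (m + s) - f (m - s))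
    (f₁ := fun s => f₁ (m + s) - -f₁ (m - s)) (f₂ := fun s => f₂ (m + s) + -f₂ (m - s))
    (B := 2 * M * h) (m := 0) (y := h)
    (fun s => ((h1 (m + s)).comp_const_add m s).sub ((h1 (m - s)).comp_const_sub m s))
    (fun s => by
      simp only [sub_neg_eq_add]
      exact ((h2 (m + s)).comp_const_add m s).add ((h2 (m - s)).comp_const_sub m s))
    (fun s hs => by
      rw [uIcc_of_le hh.le] at hs
      have := hl (m - s) ⟨by linarith [hs.2], by linarith [hs.1]⟩ (m + s)
        ⟨by linarith [hs.1], by linarith [hs.2]⟩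
      rw [← sub_eq_add_neg]
      refine this.trans ?_
      rw [show m + s - (m - s) = 2 * s by ring, abs_of_nonneg (by linarith [hs.1])]
      nlinarith [hs.2])
  simp only [add_zero, sub_zero, sub_neg_eq_add, sub_self] at this
  rw [show (f (m + h) - f (m - h)) / (2 * h) - f₁ m =
    (f (m + h) - f (m - h) - (f₁ m + f₁ m) * h) / (2 * h) by field_simp; ring,
    abs_div, abs_of_pos (by positivity : 0 < 2 * h), div_le_iff₀ (by positivity)]
  linarith

lemma sum_Icc_one_eq (f : ℕ → ℝ) (N : ℕ) :
    ∑ i ∈ Finset.Icc 1 N, f i = ∑ i ∈ Finset.range N, f (i + 1) := by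
  induction N with
  | zero => simp
  | succ n ih => rw [Finset.sum_Icc_succ_top (by omega), ih, Finset.sum_range_succ]

/-- Summation by parts with odd reflection at both ends. -/
lemma sum_mul_sub_eq {N : ℕ} {e G : ℕ → ℝ} (h0 : e 0 = -e 1)
    (h1 : e (N + 1) = -e N) :
    ∑ i ∈ Finset.range N, e (i + 1) * (G (i + 1) - G i) =
      -(1 / 2) * ∑ i ∈ Finset.range N,
        (G i * (e (i + 1) - e i) + G (i + 1) * (e (i + 2) - e (i + 1))) := by
  have key : ∀ n, ∑ i ∈ Finset.range n, (e (i + 1) * (G (i + 1) - G i) +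
      (1 / 2) * (G i * (e (i + 1) - e i) + G (i + 1) * (e (i + 2) - e (i + 1)))) =
      (1 / 2) * (G n * (e n + e (n + 1)) - G 0 * (e 0 + e 1)) := by
    intro n
    induction n with
    | zero => simp
    | succ n ih => rw [Finset.sum_range_succ, ih]; ring
  have := key N
  rw [Finset.sum_add_distrib, ← Finset.mul_sum, h0, h1] at this
  linarith

/-- Discrete Poincaré inequality with odd reflection at the left end. -/
lemma sum_sq_le {N : ℕ} {e : ℕ → ℝ} (h0 : e 0 = -e 1) :
    ∑ i ∈ Finset.range N, e (i + 1) ^ 2 ≤ (N : ℝ) ^ 2 * ((1 / 2) * ∑ i ∈ Finset.range N,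
        ((e (i + 1) - e i) ^ 2 + (e (i + 2) - e (i + 1)) ^ 2)) := by
  set a : ℕ → ℝ := fun i => (1 / 2) * (|e (i + 1) - e i| + |e (i + 2) - e (i + 1)|) with ha
  have hpre : ∀ k, |e (k + 1)| ≤ ∑ i ∈ Finset.range k, a i + (1 / 2) * |e (k + 1) - e k| := by
    intro k
    induction k with
    | zero =>
      rw [zero_add, h0, sub_neg_eq_add, ← two_mul, abs_mul,
        abs_of_pos (by norm_num : (0 : ℝ) < 2)]
      simp
    | succ k ih =>
      rw [Finset.sum_range_succ, ha]
      have := abs_add_le (e (k + 1)) (e (k + 2) - e (k + 1))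
      rw [add_sub_cancel] at this
      rw [show k + 1 + 1 = k + 2 from rfl]
      simp only at ih ⊢
      linarith
  have hanon : ∀ i, 0 ≤ a i := fun i => by positivity
  have hbound : ∀ k ∈ Finset.range N, e (k + 1) ^ 2 ≤ N * ∑ i ∈ Finset.range N, a i ^ 2 := by
    intro k hk
    have e1 : |e (k + 1)| ≤ ∑ i ∈ Finset.range N, a i := by
      refine (hpre k).trans ?_
      have e2 : ∑ i ∈ Finset.range (k + 1), a i ≤ ∑ i ∈ Finset.range N, a i :=
        Finset.sum_le_sum_of_subset_of_nonneg
          (Finset.range_subset_range.2 (Finset.mem_range.1 hk)) fun i _ _ => hanon i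
      rw [Finset.sum_range_succ] at e2
      refine le_trans ?_ e2
      have : 0 ≤ |e (k + 2) - e (k + 1)| := abs_nonneg _
      simp only [ha]
      linarith
    rw [← sq_abs]
    refine (pow_le_pow_left₀ (abs_nonneg _) e1 2).trans ?_
    simpa using sq_sum_le_card_mul_sum_sq (s := Finset.range N) (f := a)
  have ha2 : ∀ i, a i ^ 2 ≤ (1 / 2) * ((e (i + 1) - e i) ^ 2 + (e (i + 2) - e (i + 1)) ^ 2) := by
    intro i
    rw [← sq_abs (e (i + 1) - e i), ← sq_abs (e (i + 2) - e (i + 1))]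
    simp only [ha]
    nlinarith [sq_nonneg (|e (i + 1) - e i| - |e (i + 2) - e (i + 1)|)]
  calc _ ≤ ∑ _k ∈ Finset.range N, (N * ∑ i ∈ Finset.range N, a i ^ 2) := Finset.sum_le_sum hbound
    _ = N ^ 2 * ∑ i ∈ Finset.range N, a i ^ 2 := by simp; ring
    _ ≤ _ := by
      rw [Finset.mul_sum _ _ (1 / 2 : ℝ)]
      gcongr with i hi
      exact ha2 i

/-- Dissipation estimate for a discrete divergence-form operator with consistency error. -/
lemma sum_mul_sub_le {N : ℕ} (hN : 1 ≤ N) {e G S ρ : ℕ → ℝ} {s₀ s₁ r : ℝ} (hs₀ : 0 ≤ s₀)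
    (h0 : e 0 = -e 1) (h1 : e (N + 1) = -e N)
    (hG : ∀ j ≤ N, G j = (1 / 4) * S j * (N * (e (j + 1) - e j) + ρ j))
    (hS : ∀ j ≤ N, s₀ ≤ S j ∧ S j ≤ s₁) (hρ : ∀ j ≤ N, |ρ j| ≤ r) :
    ∑ i ∈ Finset.range N, e (i + 1) * (G (i + 1) - G i) ≤
      -(s₀ / (8 * N)) * ∑ i ∈ Finset.range N, e (i + 1) ^ 2 + s₁ * r ^ 2 / 8 := by
  have hNpos : (0 : ℝ) < N := by exact_mod_cast hN
  have hj : ∀ j ≤ N, s₀ * N / 8 * (e (j + 1) - e j) ^ 2 - s₁ * r ^ 2 / (8 * N) ≤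
      G j * (e (j + 1) - e j) := by
    intro j hj
    rw [hG j hj]
    obtain ⟨k1, k2⟩ := hS j hj
    have k3 := hρ j hj
    set D := e (j + 1) - e j
    have k4 : ρ j ^ 2 ≤ r ^ 2 := by
      rw [← sq_abs]; exact pow_le_pow_left₀ (abs_nonneg _) k3 2
    have k5 : S j * ρ j ^ 2 ≤ s₁ * r ^ 2 :=
      mul_le_mul k2 k4 (sq_nonneg _) ((hs₀.trans k1).trans k2)
    have k6 : N * D ^ 2 / 2 - ρ j ^ 2 / (2 * N) ≤ N * D ^ 2 + ρ j * D := by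
      have : N * D ^ 2 + ρ j * D - (N * D ^ 2 / 2 - ρ j ^ 2 / (2 * N)) =
          (N * D + ρ j) ^ 2 / (2 * N) := by field_simp; ring
      have : 0 ≤ (N * D + ρ j) ^ 2 / (2 * N) := by positivity
      linarith
    have k7 := mul_le_mul_of_nonneg_left k6 (by linarith [hs₀.trans k1] : 0 ≤ (1 / 4) * S j)
    have k8 : s₀ * N / 8 * D ^ 2 ≤ S j * N / 8 * D ^ 2 := by gcongr
    have k9 : S j * ρ j ^ 2 / (8 * N) ≤ s₁ * r ^ 2 / (8 * N) := by gcongr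
    have : (1 / 4) * S j * (N * D ^ 2 / 2 - ρ j ^ 2 / (2 * N)) =
      S j * N / 8 * D ^ 2 - S j * ρ j ^ 2 / (8 * N) := by field_simp; ring
    linarith
  rw [sum_mul_sub_eq h0 h1]
  have e1 : ∑ i ∈ Finset.range N, ((s₀ * N / 8) *
      ((e (i + 1) - e i) ^ 2 + (e (i + 2) - e (i + 1)) ^ 2) - 2 * (s₁ * r ^ 2 / (8 * N))) ≤
      ∑ i ∈ Finset.range N,
        (G i * (e (i + 1) - e i) + G (i + 1) * (e (i + 2) - e (i + 1))) := by
    refine Finset.sum_le_sum fun i hi => ?_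
    have hi := Finset.mem_range.1 hi
    have := hj i hi.le
    have := hj (i + 1) hi
    linarith
  rw [Finset.sum_sub_distrib, ← Finset.mul_sum, Finset.sum_const, Finset.card_range,
    nsmul_eq_mul] at e1
  have e2 := sum_sq_le (N := N) h0
  have e3 : s₀ / (8 * N) * ∑ i ∈ Finset.range N, e (i + 1) ^ 2 ≤ s₀ / (8 * N) * _ :=
    mul_le_mul_of_nonneg_left e2 (by positivity)
  have e4 : s₀ / (8 * N) * ((N : ℝ) ^ 2 * ((1 / 2) * ∑ i ∈ Finset.range N,
        ((e (i + 1) - e i) ^ 2 + (e (i + 2) - e (i + 1)) ^ 2))) =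
      (1 / 2) * (s₀ * N / 8 * ∑ i ∈ Finset.range N,
        ((e (i + 1) - e i) ^ 2 + (e (i + 2) - e (i + 1)) ^ 2)) := by field_simp
  have e5 : N * (2 * (s₁ * r ^ 2 / (8 * N))) = 2 * (s₁ * r ^ 2 / 8) := by field_simp
  linarith

lemma le_of_hasDerivAt_gronwall {E E' : ℝ → ℝ} {κ C : ℝ}
    (hc : ContinuousOn E (Ici 0)) (hd : ∀ t, 0 < t → HasDerivAt E (E' t) t)
    (hle : ∀ t, 0 < t → E' t ≤ -κ * E t + κ * C) {t : ℝ} (ht : 0 ≤ t) :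
    E t ≤ Real.exp (-κ * t) * (E 0 - C) + C := by
  have hd' : ∀ t, 0 < t → HasDerivAt (fun t => Real.exp (κ * t) * (E t - C))
      (Real.exp (κ * t) * (κ * 1) * (E t - C) + Real.exp (κ * t) * E' t) t := fun t ht =>
    (((hasDerivAt_id t).const_mul κ).exp).mul ((hd t ht).sub_const C)
  have hanti : AntitoneOn (fun t => Real.exp (κ * t) * (E t - C)) (Ici 0) := by
    apply antitoneOn_of_deriv_nonpos (convex_Ici 0)
    · exact (by fun_prop : Continuous fun t => Real.exp (κ * t)).continuousOn.mul
        (hc.sub continuousOn_const)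
    · intro t ht
      rw [interior_Ici] at ht
      exact (hd' t ht).differentiableAt.differentiableWithinAt
    · intro t ht
      rw [interior_Ici] at ht
      rw [(hd' t ht).deriv]
      have := hle t ht
      have h2 := Real.exp_pos (κ * t)
      have : Real.exp (κ * t) * (E' t - (-κ * E t + κ * C)) ≤ 0 :=
        mul_nonpos_of_nonneg_of_nonpos h2.le (by linarith)
      linarith
  have := hanti self_mem_Ici ht ht
  simp only [mul_zero, Real.exp_zero, one_mul] at this
  have h2 := mul_le_mul_of_nonneg_left this (Real.exp_pos (-κ * t)).le
  rw [← mul_assoc, ← Real.exp_add, neg_mul, neg_add_cancel, Real.exp_zero, one_mul] at h2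
  rw [neg_mul]
  linarith

/-- Energy estimate for error evolutions in divergence form. -/
lemma mean_sq_le {N : ℕ} (hN : 1 ≤ N) {e G S ρ : ℝ → ℕ → ℝ} {s₀ s₁ r : ℝ} (hs₀ : 0 < s₀)
    (hc : ∀ i ∈ Finset.Icc 1 N, ContinuousOn (fun t => e t i) (Ici 0))
    (hd : ∀ t, 0 < t → ∀ i < N,
      HasDerivAt (fun t => e t (i + 1)) (N * (G t (i + 1) - G t i)) t)
    (h0 : ∀ t, 0 < t → e t 0 = -e t 1) (h1 : ∀ t, 0 < t → e t (N + 1) = -e t N)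
    (hG : ∀ t, 0 < t → ∀ j ≤ N,
      G t j = (1 / 4) * S t j * (N * (e t (j + 1) - e t j) + ρ t j))
    (hS : ∀ t, 0 < t → ∀ j ≤ N, s₀ ≤ S t j ∧ S t j ≤ s₁)
    (hρ : ∀ t, 0 < t → ∀ j ≤ N, |ρ t j| ≤ r) {t : ℝ} (ht : 0 ≤ t) :
    (1 / (N : ℝ)) * ∑ i ∈ Finset.Icc 1 N, e t i ^ 2 ≤
      Real.exp (-(s₀ / 4) * t) * ((1 / (N : ℝ)) * ∑ i ∈ Finset.Icc 1 N, e 0 i ^ 2) +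
        s₁ * r ^ 2 / s₀ := by
  have hNpos : (0 : ℝ) < N := by exact_mod_cast hN
  have hs₁ : 0 ≤ s₁ := by
    obtain ⟨k1, k2⟩ := hS 1 one_pos 0 (Nat.zero_le _)
    linarith
  set E : ℝ → ℝ := fun t => (1 / (N : ℝ)) * ∑ i ∈ Finset.Icc 1 N, e t i ^ 2 with hE
  have hEd : ∀ t, 0 < t → HasDerivAt E ((1 / (N : ℝ)) * ∑ i ∈ Finset.range N,
      2 * e t (i + 1) * (N * (G t (i + 1) - G t i))) t := by
    intro t ht
    simp only [hE, sum_Icc_one_eq]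
    refine HasDerivAt.const_mul _ ?_
    refine HasDerivAt.fun_sum fun i hi => ?_
    have := (hd t ht i (Finset.mem_range.1 hi)).fun_pow 2
    simpa using this
  have hEc : ContinuousOn E (Ici 0) :=
    continuousOn_const.mul (continuousOn_finsetSum _ fun i hi => (hc i hi).pow 2)
  have := le_of_hasDerivAt_gronwall (κ := s₀ / 4) (C := s₁ * r ^ 2 / s₀) hEc hEd
    (fun t ht => ?_) ht
  · refine this.trans ?_
    have : 0 ≤ Real.exp (-(s₀ / 4) * t) * (s₁ * r ^ 2 / s₀) := by positivity
    linarith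
  · have := sum_mul_sub_le hN hs₀.le (h0 t ht) (h1 t ht) (hG t ht) (hS t ht) (hρ t ht)
    have e1 : (1 / (N : ℝ)) * ∑ i ∈ Finset.range N,
      2 * e t (i + 1) * (N * (G t (i + 1) - G t i)) =
      2 * ∑ i ∈ Finset.range N, e t (i + 1) * (G t (i + 1) - G t i) := by
      rw [Finset.mul_sum, Finset.mul_sum]
      refine Finset.sum_congr rfl fun i _ => ?_
      field_simp
    rw [e1]
    simp only [hE, sum_Icc_one_eq]
    have e2 : s₀ / 4 * (s₁ * r ^ 2 / s₀) = 2 * (s₁ * r ^ 2 / 8) := by field_simp; ring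
    have e3 : -(s₀ / 4) * ((1 / (N : ℝ)) * ∑ i ∈ Finset.range N, e t (i + 1) ^ 2) =
      2 * (-(s₀ / (8 * N)) * ∑ i ∈ Finset.range N, e t (i + 1) ^ 2) := by field_simp; ring
    linarith

/-- The gaps between consecutive padded points. -/
noncomputable def gap (N : ℕ) (v : ℕ → ℝ) (j : ℕ) : ℝ := pad N v (j + 1) - pad N v j

lemma pad_zero (N : ℕ) (v : ℕ → ℝ) : pad N v 0 = -v 1 := by simp [pad]

lemma pad_last (N : ℕ) (v : ℕ → ℝ) : pad N v (N + 1) = 2 - v N := by simp [pad]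

lemma pad_of_mem {N i : ℕ} (hi : i ∈ Finset.Icc 1 N) (v : ℕ → ℝ) : pad N v i = v i := by
  rw [Finset.mem_Icc] at hi
  simp [pad, show i ≠ 0 by omega, show i ≠ N + 1 by omega]

/-- The discrete gradient flow for the uniform density. -/
def DiscreteFlow (N : ℕ) (x : ℝ → ℕ → ℝ) : Prop :=
  ∀ t, 0 ≤ t → ∀ i ∈ Finset.Icc 1 N,
    HasDerivAt (fun s => x s i) ((1 / 4) * (gap N (x t) i ^ 2 - gap N (x t) (i - 1) ^ 2)) t

namespace DiscreteFlow

variable {N : ℕ} {x : ℝ → ℕ → ℝ}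

lemma exists_hasDerivAt_gap (h : DiscreteFlow N x) (hN : 1 ≤ N) {t : ℝ} (ht : 0 ≤ t) {j : ℕ}
    (hj : j ≤ N) : ∃ d, HasDerivAt (fun s => gap N (x s) j) d t ∧
      (∀ m, (∀ k ≤ N, m ≤ gap N (x t) k ^ 2) → (1 / 2) * (m - gap N (x t) j ^ 2) ≤ d) ∧
      (∀ m, (∀ k ≤ N, gap N (x t) k ^ 2 ≤ m) → d ≤ (1 / 2) * (m - gap N (x t) j ^ 2)) := by
  rcases Nat.eq_zero_or_pos j with rfl | hj0
  · have hd := (h t ht 1 (Finset.mem_Icc.2 ⟨le_rfl, hN⟩)).const_mul 2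
    have hfun : (fun s => gap N (x s) 0) = fun s => 2 * x s 1 := by
      funext s
      rw [gap, pad_zero, zero_add, pad_of_mem (Finset.mem_Icc.2 ⟨le_rfl, hN⟩)]
      ring
    rw [← hfun, Nat.sub_self] at hd
    refine ⟨_, hd, fun m hm => ?_, fun m hm => ?_⟩ <;> linarith [hm 1 hN]
  · rcases hj.eq_or_lt with rfl | hjN
    · have hd := ((h t ht j (Finset.mem_Icc.2 ⟨hN, le_rfl⟩)).const_mul 2).const_sub 2
      have hfun : (fun s => gap j (x s) j) = fun s => 2 - 2 * x s j := by
        funext s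
        rw [gap, pad_last, pad_of_mem (Finset.mem_Icc.2 ⟨hN, le_rfl⟩)]
        ring
      rw [← hfun] at hd
      refine ⟨_, hd, fun m hm => ?_, fun m hm => ?_⟩ <;> linarith [hm (j - 1) (by omega)]
    · have hm1 : j ∈ Finset.Icc 1 N := Finset.mem_Icc.2 ⟨hj0, hj⟩
      have hm2 : j + 1 ∈ Finset.Icc 1 N := Finset.mem_Icc.2 ⟨by omega, hjN⟩
      have hd := (h t ht (j + 1) hm2).sub (h t ht j hm1)
      have hfun : (fun s => gap N (x s) j) = (fun s => x s (j + 1)) - fun s => x s j := by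
        funext s
        rw [gap, pad_of_mem hm1, pad_of_mem hm2, Pi.sub_apply]
      rw [← hfun, Nat.add_sub_cancel] at hd
      refine ⟨_, hd, fun m hm => ?_, fun m hm => ?_⟩ <;>
        linarith [hm (j - 1) (by omega), hm (j + 1) hjN]

lemma gap_bounds (h : DiscreteFlow N x) (hN : 1 ≤ N) {a b : ℝ} (ha : 0 < a)
    (hinit : ∀ j ≤ N, a ≤ gap N (x 0) j ∧ gap N (x 0) j ≤ b) {t : ℝ} (ht : 0 ≤ t) {j : ℕ}
    (hj : j ≤ N) : a ≤ gap N (x t) j ∧ gap N (x t) j ≤ b := by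
  have hS : IsCompact (Iic N) := (finite_Iic N).isCompact
  have hcont : ∀ T, ContinuousOn (Function.uncurry fun t j => gap N (x t) j)
      (Icc 0 T ×ˢ Iic N) := by
    intro T
    refine continuousOn_prod_of_discrete_right.2 fun j t ⟨ht, hj⟩ => ?_
    obtain ⟨d, hd, -⟩ := h.exists_hasDerivAt_gap hN ht.1 hj
    exact hd.continuousAt.continuousWithinAt
  have lower : ∀ t, 0 ≤ t → ∀ j ≤ N, a ≤ gap N (x t) j := by
    intro t ht j hj
    obtain ⟨D, hD⟩ := (isCompact_Icc.prod hS).exists_bound_of_continuousOn (hcont t)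
    have := max_principle hS (T := t) (F := fun t j => a - gap N (x t) j) (D / 2)
      (continuousOn_const.sub (hcont t)) (fun j hj => by linarith [(hinit j hj).1])
      (fun s hs j hj hpos hmax => by
        obtain ⟨d, hd, hd1, -⟩ := h.exists_hasDerivAt_gap hN hs.1.le hj
        refine ⟨_, hd.const_sub a, ?_⟩
        have hDj : |gap N (x s) j| ≤ D := hD (s, j) ⟨⟨hs.1.le, hs.2⟩, hj⟩
        have hD0 : 0 ≤ D := (abs_nonneg _).trans hDj
        have hF : 0 ≤ D / 2 * (a - gap N (x s) j) := by positivity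
        rcases le_total 0 (gap N (x s) j) with hg | hg
        · have := hd1 (gap N (x s) j ^ 2) fun k hk => by
            have := hmax k hk
            exact pow_le_pow_left₀ hg (by linarith) 2
          linarith
        · have h1 := hd1 0 fun k hk => sq_nonneg _
          rw [abs_of_nonpos hg] at hDj
          have h2 : -gap N (x s) j * -gap N (x s) j ≤ D * (a - gap N (x s) j) :=
            mul_le_mul hDj (by linarith) (by linarith) hD0
          linarith) t ⟨ht, le_rfl⟩ j hj
    linarith
  refine ⟨lower t ht j hj, ?_⟩
  have := max_principle hS (T := t) (F := fun t j => gap N (x t) j - b) 0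
    ((hcont t).sub continuousOn_const) (fun j hj => by linarith [(hinit j hj).2])
    (fun s hs j hj hpos hmax => by
      obtain ⟨d, hd, -, hd2⟩ := h.exists_hasDerivAt_gap hN hs.1.le hj
      refine ⟨_, hd.sub_const b, ?_⟩
      have := hd2 (gap N (x s) j ^ 2) fun k hk => by
        have := hmax k hk
        have h0 := lower s hs.1.le k hk
        exact pow_le_pow_left₀ (by linarith) (by linarith) 2
      linarith) t ⟨ht, le_rfl⟩ j hj
  linarith

end DiscreteFlow

lemma pad_sub_zero (N : ℕ) (v w : ℕ → ℝ) :
    pad N v 0 - pad N w 0 = -(v 1 - w 1) := by rw [pad_zero, pad_zero]; ring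

lemma pad_sub_last (N : ℕ) (v w : ℕ → ℝ) :
    pad N v (N + 1) - pad N w (N + 1) = -(v N - w N) := by rw [pad_last, pad_last]; ring

lemma gap_grid {N : ℕ} (hN : 1 ≤ N) {j : ℕ} (hj : j ≤ N) : gap N (grid N) j = 1 / N := by
  have hpos : (0 : ℝ) < N := by exact_mod_cast hN
  have : ∀ k ≤ N + 1, pad N (grid N) k = ((k : ℝ) - 1 / 2) / N := by
    intro k hk
    rcases Nat.eq_zero_or_pos k with rfl | hk0
    · rw [pad_zero, grid]; push_cast; ring
    · rcases hk.eq_or_lt with rfl | hk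
      · rw [pad_last, grid]; push_cast; field_simp; ring
      · rw [pad_of_mem (Finset.mem_Icc.2 ⟨hk0, by omega⟩), grid]
  rw [gap, this _ (by omega), this _ (by omega)]
  push_cast
  field_simp
  ring

namespace DiscreteFlow

variable {N : ℕ} {x : ℝ → ℕ → ℝ}

lemma hasDerivAt_rescaled (h : DiscreteFlow N x) {t : ℝ} (ht : 0 ≤ t) {i : ℕ} (hi : i < N) :
    HasDerivAt (fun t => x ((N : ℝ) ^ 3 * t) (i + 1))
      (N * ((1 / 4) * (N * gap N (x ((N : ℝ) ^ 3 * t)) (i + 1)) ^ 2 -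
        (1 / 4) * (N * gap N (x ((N : ℝ) ^ 3 * t)) i) ^ 2)) t := by
  have h1 := h ((N : ℝ) ^ 3 * t) (by positivity) (i + 1) (Finset.mem_Icc.2 ⟨by omega, hi⟩)
  have h2 := HasDerivAt.comp t h1 ((hasDerivAt_id t).const_mul ((N : ℝ) ^ 3))
  refine h2.congr_deriv ?_
  rw [Nat.add_sub_cancel]
  ring

lemma mean_sq_sub_grid_le (h : DiscreteFlow N x) (hN : 1 ≤ N) {c₀ C₀ : ℝ} (hc₀ : 0 < c₀)
    (hinit : ∀ j ≤ N, c₀ / N ≤ gap N (x 0) j ∧ gap N (x 0) j ≤ C₀ / N) {t : ℝ} (ht : 0 ≤ t) :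
    (1 / (N : ℝ)) * ∑ i ∈ Finset.Icc 1 N, (x ((N : ℝ) ^ 3 * t) i - grid N i) ^ 2 ≤
      Real.exp (-(c₀ / 4) * t) *
        ((1 / (N : ℝ)) * ∑ i ∈ Finset.Icc 1 N, (x 0 i - grid N i) ^ 2) := by
  have hpos : (0 : ℝ) < N := by exact_mod_cast hN
  have hmem1 : 1 ∈ Finset.Icc 1 N := Finset.mem_Icc.2 ⟨le_rfl, hN⟩
  have hmemN : N ∈ Finset.Icc 1 N := Finset.mem_Icc.2 ⟨hN, le_rfl⟩
  set e : ℝ → ℕ → ℝ := fun t i => pad N (x ((N : ℝ) ^ 3 * t)) i - pad N (grid N) i with he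
  have hei : ∀ t, ∀ i ∈ Finset.Icc 1 N, e t i = x ((N : ℝ) ^ 3 * t) i - grid N i :=
    fun t i hi => by simp only [he]; rw [pad_of_mem hi, pad_of_mem hi]
  have hder : ∀ t, 0 ≤ t → ∀ i < N, HasDerivAt (fun t => e t (i + 1))
      (N * ((1 / 4) * ((N * gap N (x ((N : ℝ) ^ 3 * t)) (i + 1)) ^ 2 - 1) -
        (1 / 4) * ((N * gap N (x ((N : ℝ) ^ 3 * t)) i) ^ 2 - 1))) t := by
    intro t ht i hi
    have hmem : i + 1 ∈ Finset.Icc 1 N := Finset.mem_Icc.2 ⟨by omega, hi⟩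
    simp only [hei _ _ hmem]
    refine ((h.hasDerivAt_rescaled ht hi).sub_const _).congr_deriv ?_
    ring
  have := mean_sq_le hN (e := e)
    (G := fun t j => (1 / 4) * ((N * gap N (x ((N : ℝ) ^ 3 * t)) j) ^ 2 - 1))
    (S := fun t j => N * gap N (x ((N : ℝ) ^ 3 * t)) j + 1) (ρ := fun _ _ => 0) (s₀ := c₀)
    (s₁ := C₀ + 1) (r := 0) hc₀
    (fun i hi t ht => by
      rw [Finset.mem_Icc] at hi
      have := (hder t ht (i - 1) (by omega)).continuousAt.continuousWithinAt (s := Ici 0)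
      rwa [Nat.sub_add_cancel hi.1] at this)
    (fun t ht i hi => hder t ht.le i hi)
    (fun t ht => by rw [hei t 1 hmem1]; exact pad_sub_zero N _ _)
    (fun t ht => by rw [hei t N hmemN]; exact pad_sub_last N _ _)
    (fun t ht j hj => by
      have e1 : e t (j + 1) - e t j = gap N (x ((N : ℝ) ^ 3 * t)) j - 1 / N := by
        rw [← gap_grid hN hj]; simp only [he, gap]; ring
      have e2 : N * (gap N (x ((N : ℝ) ^ 3 * t)) j - 1 / N) =
          N * gap N (x ((N : ℝ) ^ 3 * t)) j - 1 := by field_simp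
      rw [e1, e2]; ring)
    (fun t ht j hj => by
      obtain ⟨k1, k2⟩ := h.gap_bounds hN (by positivity : 0 < c₀ / N) hinit
        (by positivity : 0 ≤ (N : ℝ) ^ 3 * t) hj
      rw [div_le_iff₀' hpos] at k1
      rw [le_div_iff₀' hpos] at k2
      constructor <;> linarith)
    (fun t ht j hj => by simp) ht
  have hsum : ∀ t, ∑ i ∈ Finset.Icc 1 N, e t i ^ 2 =
      ∑ i ∈ Finset.Icc 1 N, (x ((N : ℝ) ^ 3 * t) i - grid N i) ^ 2 := fun t =>
    Finset.sum_congr rfl fun i hi => by rw [hei t i hi]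
  rw [hsum, hsum, mul_zero] at this
  refine this.trans (le_of_eq (by simp))

end DiscreteFlow

lemma abs_sub_grid_le {N : ℕ} (hN : 1 ≤ N) {v : ℕ → ℝ} {C₀ : ℝ}
    (hgap : ∀ j ≤ N, 0 ≤ gap N v j ∧ gap N v j ≤ C₀ / N) {i : ℕ} (hi : i ∈ Finset.Icc 1 N) :
    |v i - grid N i| ≤ C₀ + 1 := by
  have hpos : (0 : ℝ) < N := by exact_mod_cast hN
  have hg0 := hgap 0 (Nat.zero_le _)
  rw [gap, pad_zero, zero_add, pad_of_mem (Finset.mem_Icc.2 ⟨le_rfl, hN⟩)] at hg0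
  have hC : 0 ≤ C₀ / N := by linarith
  have key : ∀ k, k + 1 ≤ N → 0 ≤ v (k + 1) ∧ v (k + 1) ≤ (k + 1) * (C₀ / N) := by
    intro k
    induction k with
    | zero =>
      intro _
      norm_num
      constructor <;> linarith
    | succ k ih =>
      intro hk
      have h1 := ih (by omega)
      have h2 := hgap (k + 1) (by omega)
      rw [gap, pad_of_mem (Finset.mem_Icc.2 ⟨by omega, by omega⟩),
        pad_of_mem (Finset.mem_Icc.2 ⟨by omega, by omega⟩)] at h2
      push_cast
      constructor <;> linarith
  have hi' := Finset.mem_Icc.1 hi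
  have h1 := key (i - 1) (by omega)
  rw [Nat.sub_add_cancel hi'.1] at h1
  have h2 : ((i - 1 : ℕ) : ℝ) + 1 ≤ N := by exact_mod_cast (by omega : i - 1 + 1 ≤ N)
  have h3 : (((i - 1 : ℕ) : ℝ) + 1) * (C₀ / N) ≤ N * (C₀ / N) := by gcongr
  have h4 : (N : ℝ) * (C₀ / N) = C₀ := by field_simp
  have h5 : 0 ≤ grid N i ∧ grid N i ≤ 1 := by
    have e1 : (1 : ℝ) ≤ i := by exact_mod_cast hi'.1
    have e2 : (i : ℝ) ≤ N := by exact_mod_cast hi'.2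
    rw [grid]
    exact ⟨div_nonneg (by linarith) hpos.le, (div_le_one hpos).2 (by linarith)⟩
  rw [abs_le]; constructor <;> linarith

lemma mul_sub_integral_le {φ : ℝ → ℝ} (hφ : LipschitzWith 1 φ) {m h : ℝ} (hh : 0 ≤ h) :
    2 * h * φ m - ∫ θ in (m - h)..(m + h), φ θ ≤ h ^ 2 := by
  have hc := hφ.continuous
  have hl : ∀ a b, φ a - φ b ≤ |a - b| := by
    intro a b
    have := hφ.dist_le_mul a b
    rw [NNReal.coe_one, one_mul, Real.dist_eq, Real.dist_eq] at this
    exact (le_abs_self _).trans this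
  rw [← intervalIntegral.integral_add_adjacent_intervals (b := m)
    (hc.intervalIntegrable _ _) (hc.intervalIntegrable _ _)]
  have e1 : (∫ θ in (m - h)..m, (φ m - (m - θ))) ≤ ∫ θ in (m - h)..m, φ θ := by
    refine intervalIntegral.integral_mono_on (by linarith)
      ((by fun_prop : Continuous fun θ => φ m - (m - θ)).intervalIntegrable _ _)
      (hc.intervalIntegrable _ _) fun θ hθ => ?_
    have := hl m θ
    rw [abs_of_nonneg (by linarith [hθ.2])] at this
    linarith
  have e2 : (∫ θ in m..(m + h), (φ m - (θ - m))) ≤ ∫ θ in m..(m + h), φ θ := by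
    refine intervalIntegral.integral_mono_on (by linarith)
      ((by fun_prop : Continuous fun θ => φ m - (θ - m)).intervalIntegrable _ _)
      (hc.intervalIntegrable _ _) fun θ hθ => ?_
    have := hl m θ
    rw [abs_of_nonpos (by linarith [hθ.1])] at this
    linarith
  have e3 : (∫ θ in (m - h)..m, (φ m - (m - θ))) = h * φ m - h ^ 2 / 2 := by
    rw [intervalIntegral.integral_sub, intervalIntegral.integral_sub,
      intervalIntegral.integral_const, intervalIntegral.integral_const, integral_id,
      smul_eq_mul, smul_eq_mul]
    · ring
    all_goals apply Continuous.intervalIntegrable; fun_prop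
  have e4 : (∫ θ in m..(m + h), (φ m - (θ - m))) = h * φ m - h ^ 2 / 2 := by
    rw [intervalIntegral.integral_sub, intervalIntegral.integral_sub,
      intervalIntegral.integral_const, intervalIntegral.integral_const, integral_id,
      smul_eq_mul, smul_eq_mul]
    · ring
    all_goals apply Continuous.intervalIntegrable; fun_prop
  linarith

lemma mean_grid_sub_integral_le {N : ℕ} (hN : 1 ≤ N) {φ : ℝ → ℝ} (hφ : LipschitzWith 1 φ) :
    (1 / (N : ℝ)) * ∑ i ∈ Finset.Icc 1 N, φ (grid N i) - ∫ θ in (0 : ℝ)..1, φ θ ≤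
      1 / (4 * (N : ℝ)) := by
  have hpos : (0 : ℝ) < N := by exact_mod_cast hN
  have hsum := intervalIntegral.sum_integral_adjacent_intervals (f := φ)
    (μ := MeasureTheory.volume) (n := N) (a := fun k : ℕ => (k : ℝ) / N)
    (fun k _ => hφ.continuous.intervalIntegrable _ _)
  rw [Nat.cast_zero, zero_div, div_self hpos.ne'] at hsum
  rw [sum_Icc_one_eq, ← hsum, Finset.mul_sum, ← Finset.sum_sub_distrib]
  have : ∀ i ∈ Finset.range N, 1 / (N : ℝ) * φ (grid N (i + 1)) -
      (∫ θ in ((i : ℝ) / N)..(((i + 1 : ℕ) : ℝ) / N), φ θ) ≤ (1 / (2 * N)) ^ 2 := by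
    intro i _
    have := mul_sub_integral_le hφ (m := grid N (i + 1)) (h := 1 / (2 * (N : ℝ)))
      (by positivity)
    rw [show grid N (i + 1) - 1 / (2 * (N : ℝ)) = i / N by
        rw [grid]; push_cast; field_simp; ring,
      show grid N (i + 1) + 1 / (2 * (N : ℝ)) = (i + 1 : ℕ) / N by
        rw [grid]; push_cast; field_simp; ring,
      show 2 * (1 / (2 * (N : ℝ))) = 1 / N by field_simp] at this
    exact this
  refine (Finset.sum_le_sum this).trans (le_of_eq ?_)
  rw [Finset.sum_const, Finset.card_range, nsmul_eq_mul]
  field_simp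
  norm_num

lemma mean_sub_integral_le {N : ℕ} (hN : 1 ≤ N) {v : ℕ → ℝ} {φ : ℝ → ℝ}
    (hφ : LipschitzWith 1 φ) {A : ℝ} (hA : 0 ≤ A)
    (hv : (1 / (N : ℝ)) * ∑ i ∈ Finset.Icc 1 N, (v i - grid N i) ^ 2 ≤ A ^ 2) :
    (1 / (N : ℝ)) * ∑ i ∈ Finset.Icc 1 N, φ (v i) - ∫ θ in (0 : ℝ)..1, φ θ ≤
      1 / (4 * (N : ℝ)) + A := by
  have hpos : (0 : ℝ) < N := by exact_mod_cast hN
  have h1 : (1 / (N : ℝ)) * ∑ i ∈ Finset.Icc 1 N, φ (v i) -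
      (1 / (N : ℝ)) * ∑ i ∈ Finset.Icc 1 N, φ (grid N i) ≤
      (1 / (N : ℝ)) * ∑ i ∈ Finset.Icc 1 N, |v i - grid N i| := by
    rw [← mul_sub, ← Finset.sum_sub_distrib]
    gcongr with i hi
    have := hφ.dist_le_mul (v i) (grid N i)
    rw [NNReal.coe_one, one_mul, Real.dist_eq, Real.dist_eq] at this
    exact (le_abs_self _).trans this
  have h2 : (1 / (N : ℝ)) * ∑ i ∈ Finset.Icc 1 N, |v i - grid N i| ≤ A := by
    refine abs_le_of_sq_le_sq' ?_ hA |>.2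
    refine le_trans ?_ hv
    have := sq_sum_le_card_mul_sum_sq (s := Finset.Icc 1 N) (f := fun i => |v i - grid N i|)
    simp only [sq_abs, Nat.card_Icc, Nat.add_sub_cancel] at this
    calc _ = (1 / (N : ℝ)) ^ 2 * (∑ i ∈ Finset.Icc 1 N, |v i - grid N i|) ^ 2 := by ring
      _ ≤ (1 / (N : ℝ)) ^ 2 * (N * ∑ i ∈ Finset.Icc 1 N, (v i - grid N i) ^ 2) := by gcongr
      _ = _ := by field_simp
  have h3 := mean_grid_sub_integral_le hN hφ
  linarith

/-- Exponential convergence to the uniform measure up to the quantization error. -/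
lemma DiscreteFlow.mean_sub_integral_le {N : ℕ} {x : ℝ → ℕ → ℝ} (h : DiscreteFlow N x)
    (hN : 1 ≤ N) {c₀ C₀ : ℝ} (hc₀ : 0 < c₀) (hC₀ : 0 < C₀)
    (hinit : ∀ j ≤ N, c₀ / N ≤ gap N (x 0) j ∧ gap N (x 0) j ≤ C₀ / N) {t : ℝ} (ht : 0 ≤ t)
    {φ : ℝ → ℝ} (hφ : LipschitzWith 1 φ) :
    (1 / (N : ℝ)) * ∑ i ∈ Finset.Icc 1 N, φ (x t i) - ∫ θ in (0 : ℝ)..1, φ θ ≤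
      1 / (4 * (N : ℝ)) + (C₀ + 1) * Real.exp (-(c₀ / 8) * t / (N : ℝ) ^ 3) := by
  have hpos : (0 : ℝ) < N := by exact_mod_cast hN
  refine _root_.mean_sub_integral_le hN hφ (by positivity) ?_
  have h1 := h.mean_sq_sub_grid_le hN hc₀ hinit (t := t / (N : ℝ) ^ 3) (by positivity)
  rw [mul_div_cancel₀ t (by positivity : (N : ℝ) ^ 3 ≠ 0)] at h1
  refine h1.trans ?_
  have h2 : (1 / (N : ℝ)) * ∑ i ∈ Finset.Icc 1 N, (x 0 i - grid N i) ^ 2 ≤ (C₀ + 1) ^ 2 := by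
    have : ∀ i ∈ Finset.Icc 1 N, (x 0 i - grid N i) ^ 2 ≤ (C₀ + 1) ^ 2 := fun i hi => by
      rw [← sq_abs]
      refine pow_le_pow_left₀ (abs_nonneg _) (abs_sub_grid_le hN (fun j hj => ?_) hi) 2
      exact ⟨(by positivity : 0 ≤ c₀ / N).trans (hinit j hj).1, (hinit j hj).2⟩
    have := Finset.sum_le_sum this
    rw [Finset.sum_const, Nat.card_Icc, Nat.add_sub_cancel, nsmul_eq_mul] at this
    calc _ ≤ (1 / (N : ℝ)) * (N * (C₀ + 1) ^ 2) := by gcongr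
      _ = _ := by field_simp
  have h3 : Real.exp (-(c₀ / 4) * (t / (N : ℝ) ^ 3)) =
      Real.exp (-(c₀ / 8) * t / (N : ℝ) ^ 3) ^ 2 := by
    rw [← Real.exp_nat_mul]; congr 1; push_cast; ring
  rw [h3, mul_pow, mul_comm]
  gcongr

/-- The average of `f` over the cell of width `1/N` centred at `m`. -/
noncomputable def cellAverage (N : ℕ) (f : ℝ → ℝ) (m : ℝ) : ℝ :=
  N * ∫ w in (m - 1 / (2 * (N : ℝ)))..(m + 1 / (2 * (N : ℝ))), f w

/-- The difference between the cell average and the midpoint value. -/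
noncomputable def cellDefect (N : ℕ) (f : ℝ → ℝ) (m : ℝ) : ℝ := cellAverage N f m - f m

lemma cellDefect_sub {N : ℕ} {f g : ℝ → ℝ} (hf : Continuous f) (hg : Continuous g) (m : ℝ) :
    cellDefect N (fun w => f w - g w) m = cellDefect N f m - cellDefect N g m := by
  rw [cellDefect, cellDefect, cellDefect, cellAverage, cellAverage, cellAverage,
    intervalIntegral.integral_sub (hf.intervalIntegrable _ _) (hg.intervalIntegrable _ _)]
  ring

lemma cellDefect_shift (N : ℕ) (f : ℝ → ℝ) (m d : ℝ) :
    cellDefect N (fun w => f (w + d)) m = cellDefect N f (m + d) := by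
  rw [cellDefect, cellDefect, cellAverage, cellAverage,
    intervalIntegral.integral_comp_add_right (fun w => f w)]
  ring_nf

lemma abs_cellDefect_le {N : ℕ} (hN : 1 ≤ N) {f f₁ f₂ : ℝ → ℝ} {B m : ℝ}
    (h1 : ∀ w, HasDerivAt f (f₁ w) w) (h2 : ∀ w, HasDerivAt f₁ (f₂ w) w)
    (hB : ∀ w ∈ Icc (m - 1 / (2 * (N : ℝ))) (m + 1 / (2 * (N : ℝ))), |f₂ w| ≤ B) :
    |cellDefect N f m| ≤ B / (4 * (N : ℝ) ^ 2) := by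
  have hpos : (0 : ℝ) < N := by exact_mod_cast hN
  have := abs_average_sub_le (by positivity : 0 < 1 / (2 * (N : ℝ))) h1 h2 hB
  rw [show 1 / (2 * (1 / (2 * (N : ℝ)))) = N by field_simp] at this
  rw [cellDefect, cellAverage]
  refine this.trans (le_of_eq ?_)
  field_simp
  norm_num

lemma grid_sub {N : ℕ} (hN : 1 ≤ N) (i : ℕ) : grid N (i + 1) - 1 / (2 * (N : ℝ)) = i / N := by
  have hpos : (0 : ℝ) < N := by exact_mod_cast hN
  rw [grid]; push_cast; field_simp; ring

lemma grid_add {N : ℕ} (hN : 1 ≤ N) (i : ℕ) : grid N i + 1 / (2 * (N : ℝ)) = i / N := by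
  have hpos : (0 : ℝ) < N := by exact_mod_cast hN
  rw [grid]; field_simp; ring

lemma cell_subset {N : ℕ} (hN : 1 ≤ N) {i : ℕ} (hi : i ∈ Finset.Icc 1 N) :
    Icc (grid N i - 1 / (2 * (N : ℝ))) (grid N i + 1 / (2 * (N : ℝ))) ⊆ Icc 0 1 := by
  have hpos : (0 : ℝ) < N := by exact_mod_cast hN
  rw [Finset.mem_Icc] at hi
  obtain ⟨k, rfl⟩ : ∃ k, i = k + 1 := ⟨i - 1, by omega⟩
  rw [grid_sub hN, grid_add hN]
  refine Icc_subset_Icc (by positivity) ((div_le_one hpos).2 ?_)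
  exact_mod_cast hi.2

lemma abs_cellDefect_bounds {N : ℕ} (hN : 1 ≤ N) {q q₁ q₂ : ℝ → ℝ} {M : ℝ}
    (h1 : ∀ w, HasDerivAt q (q₁ w) w) (h2 : ∀ w, HasDerivAt q₁ (q₂ w) w)
    (hl : ∀ y ∈ Icc (0 : ℝ) 1, ∀ z ∈ Icc (0 : ℝ) 1, |q₂ z - q₂ y| ≤ 2 * M * |z - y|)
    (hq0 : q₂ 0 = 0) (hq1 : q₂ 1 = 0) (hM : 0 ≤ M) :
    |cellDefect N q (grid N 1)| ≤ M / (2 * (N : ℝ) ^ 3) ∧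
    |cellDefect N q (grid N N)| ≤ M / (2 * (N : ℝ) ^ 3) ∧
    ∀ i, 1 ≤ i → i < N → |cellDefect N q (grid N (i + 1)) - cellDefect N q (grid N i)| ≤
      M / (2 * (N : ℝ) ^ 3) := by
  have hpos : (0 : ℝ) < N := by exact_mod_cast hN
  have hform : 2 * M / N / (4 * (N : ℝ) ^ 2) = M / (2 * (N : ℝ) ^ 3) := by field_simp; ring
  have hN1 : (1 : ℝ) ≤ N := by exact_mod_cast hN
  have hinv : 1 / (N : ℝ) ≤ 1 := (div_le_one hpos).2 hN1
  refine ⟨?_, ?_, fun i hi hiN => ?_⟩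
  · rw [← hform]
    refine abs_cellDefect_le hN h1 h2 fun w hw => ?_
    have hw' := cell_subset hN (Finset.mem_Icc.2 ⟨le_rfl, hN⟩) hw
    rw [grid_add hN] at hw
    have := hl 0 ⟨le_rfl, zero_le_one⟩ w hw'
    rw [hq0, sub_zero, sub_zero, abs_of_nonneg hw'.1] at this
    refine this.trans ?_
    have : w ≤ 1 / N := by simpa using hw.2
    calc 2 * M * w ≤ 2 * M * (1 / N) := by gcongr
      _ = _ := by ring
  · rw [← hform]
    refine abs_cellDefect_le hN h1 h2 fun w hw => ?_
    have hw' := cell_subset hN (Finset.mem_Icc.2 ⟨hN, le_rfl⟩) hw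
    have := hl 1 ⟨zero_le_one, le_rfl⟩ w hw'
    rw [hq1, sub_zero, abs_sub_comm w 1, abs_of_nonneg (by linarith [hw'.2] : 0 ≤ 1 - w)] at this
    refine this.trans ?_
    have hlow : 1 - w ≤ 1 / N := by
      have e1 := hw.1
      have e2 := grid_add hN N
      rw [div_self hpos.ne'] at e2
      have e3 : 1 / (N : ℝ) = 1 / (2 * N) + 1 / (2 * N) := by field_simp; norm_num
      linarith
    calc 2 * M * (1 - w) ≤ 2 * M * (1 / N) := by gcongr
      _ = _ := by ring
  · have hgrid : grid N (i + 1) = grid N i + 1 / N := by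
      rw [grid, grid]; push_cast; field_simp; ring
    have hc : Continuous q := continuous_iff_continuousAt.2 fun w => (h1 w).continuousAt
    rw [hgrid, ← cellDefect_shift, ← cellDefect_sub (by fun_prop) hc, ← hform]
    refine abs_cellDefect_le hN (f₁ := fun w => q₁ (w + 1 / N) - q₁ w)
      (f₂ := fun w => q₂ (w + 1 / N) - q₂ w)
      (fun w => ((h1 _).comp_add_const w _).sub (h1 w))
      (fun w => ((h2 _).comp_add_const w _).sub (h2 w)) fun w hw => ?_
    have hw1 := cell_subset hN (Finset.mem_Icc.2 ⟨hi, hiN.le⟩) hw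
    have hw2 : w + 1 / N ∈ Icc (0 : ℝ) 1 := by
      refine cell_subset hN (Finset.mem_Icc.2 ⟨by omega, hiN⟩) ⟨?_, ?_⟩ <;>
        rw [hgrid] <;> linarith [hw.1, hw.2]
    refine (hl w hw1 _ hw2).trans (le_of_eq ?_)
    rw [add_sub_cancel_left, abs_of_pos (by positivity)]
    ring

lemma abs_gap_sub_deriv_le {N : ℕ} (hN : 1 ≤ N) {f f₁ f₂ : ℝ → ℝ} {η : ℕ → ℝ} {M : ℝ}
    (hM : 0 ≤ M) (h1 : ∀ w, HasDerivAt f (f₁ w) w) (h2 : ∀ w, HasDerivAt f₁ (f₂ w) w)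
    (hl : ∀ y ∈ Icc (0 : ℝ) 1, ∀ z ∈ Icc (0 : ℝ) 1, |f₂ z - f₂ y| ≤ M * |z - y|)
    (hf0 : f 0 = 0) (hf1 : f 1 = 1) (hf20 : f₂ 0 = 0) (hf21 : f₂ 1 = 0)
    (hη1 : |η 1| ≤ M / (2 * (N : ℝ) ^ 3)) (hηN : |η N| ≤ M / (2 * (N : ℝ) ^ 3))
    (hη : ∀ i, 1 ≤ i → i < N → |η (i + 1) - η i| ≤ M / (2 * (N : ℝ) ^ 3)) {j : ℕ} (hj : j ≤ N) :
    |N * gap N (fun i => f (grid N i) + η i) j - f₁ (j / N)| ≤ 2 * M / (N : ℝ) ^ 2 := by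
  have hpos : (0 : ℝ) < N := by exact_mod_cast hN
  have hN1 : (1 : ℝ) ≤ N := by exact_mod_cast hN
  set h : ℝ := 1 / (2 * (N : ℝ)) with hh
  have hhpos : 0 < h := by positivity
  have hh1 : h ≤ 1 := by rw [hh, div_le_one (by positivity)]; linarith
  have hMN : 0 ≤ M / (N : ℝ) ^ 2 := by positivity
  have hNh : N * (2 * h) = 1 := by rw [hh]; field_simp
  have hMN2 : M * h ^ 2 = (1 / 4) * (M / (N : ℝ) ^ 2) := by rw [hh]; field_simp; norm_num
  have hMN3 : N * (M / (2 * (N : ℝ) ^ 3)) = (1 / 2) * (M / (N : ℝ) ^ 2) := by field_simp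
  have hmul : ∀ a : ℝ, |a| ≤ M / (2 * (N : ℝ) ^ 3) → |N * a| ≤ (1 / 2) * (M / (N : ℝ) ^ 2) := by
    intro a ha
    rw [abs_mul, abs_of_pos hpos, ← hMN3]
    gcongr
  have hmulh : ∀ a : ℝ, |a| ≤ M * h * h ^ 2 → |2 * N * a| ≤ (1 / 4) * (M / (N : ℝ) ^ 2) := by
    intro a ha
    rw [abs_mul, abs_of_pos (by positivity : 0 < 2 * (N : ℝ)), ← hMN2]
    calc 2 * N * |a| ≤ 2 * N * (M * h * h ^ 2) := by gcongr
      _ = (N * (2 * h)) * (M * h ^ 2) := by ring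
      _ = M * h ^ 2 := by rw [hNh, one_mul]
  rw [mul_div_assoc]
  rcases Nat.eq_zero_or_pos j with rfl | hj0
  · have hg : grid N 1 = h := by
      have := grid_sub hN 0
      rw [Nat.cast_zero, zero_div, zero_add] at this
      linarith
    have e1 := abs_sub_sub_le_of_deriv_two (B := M * h) (m := 0) (y := h) h1 h2 (fun w hw => by
      rw [uIcc_of_le hhpos.le] at hw
      have := hl 0 ⟨le_rfl, zero_le_one⟩ w ⟨hw.1, hw.2.trans hh1⟩
      rw [hf20, sub_zero, sub_zero, abs_of_nonneg hw.1] at this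
      exact this.trans (by gcongr; exact hw.2))
    rw [sub_zero, hf0, sub_zero] at e1
    have e1 := abs_le.1 (hmulh _ e1)
    have e2 := abs_le.1 (hmul _ hη1)
    have e3 : N * gap N (fun i => f (grid N i) + η i) 0 - f₁ ((0 : ℕ) / N) =
        2 * N * (f h - f₁ 0 * h) + 2 * (N * η 1) + (N * (2 * h) - 1) * f₁ 0 := by
      rw [gap, pad_zero, zero_add, pad_of_mem (Finset.mem_Icc.2 ⟨le_rfl, hN⟩), hg,
        Nat.cast_zero, zero_div]
      ring
    rw [e3, hNh, abs_le]
    constructor <;> linarith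
  · rcases hj.eq_or_lt with rfl | hjN
    · have hg : grid j j = 1 - h := by
        have := grid_add hN j
        rw [div_self hpos.ne'] at this
        linarith
      have e1 := abs_sub_sub_le_of_deriv_two (B := M * h) (m := 1) (y := 1 - h) h1 h2
        (fun w hw => by
          rw [uIcc_of_ge (by linarith)] at hw
          have := hl 1 ⟨zero_le_one, le_rfl⟩ w ⟨by linarith [hw.1], hw.2⟩
          rw [hf21, sub_zero, abs_sub_comm w 1, abs_of_nonneg (by linarith [hw.2] : 0 ≤ 1 - w)] at this
          exact this.trans (by gcongr; linarith [hw.1]))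
      rw [hf1, show (1 - h - 1) ^ 2 = h ^ 2 by ring] at e1
      have e1 := abs_le.1 (hmulh _ e1)
      have e2 := abs_le.1 (hmul _ hηN)
      have e3 : j * gap j (fun i => f (grid j i) + η i) j - f₁ (j / j) =
          -(2 * j * (f (1 - h) - 1 - f₁ 1 * (1 - h - 1))) - 2 * (j * η j) +
            (j * (2 * h) - 1) * f₁ 1 := by
        rw [gap, pad_last, pad_of_mem (Finset.mem_Icc.2 ⟨hN, le_rfl⟩), hg, div_self hpos.ne']
        ring
      rw [e3, hNh, abs_le]
      constructor <;> linarith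
    · have hm1 : j ∈ Finset.Icc 1 N := Finset.mem_Icc.2 ⟨hj0, hj⟩
      have hm2 : j + 1 ∈ Finset.Icc 1 N := Finset.mem_Icc.2 ⟨by omega, hjN⟩
      have g1 : grid N j = j / N - h := by linarith [grid_add hN j]
      have g2 : grid N (j + 1) = j / N + h := by linarith [grid_sub hN j]
      have hsub : Icc ((j : ℝ) / N - h) (j / N + h) ⊆ Icc 0 1 := by
        have s1 := cell_subset hN hm1
        have s2 := cell_subset hN hm2
        have k1 := (s1 ⟨le_rfl, by linarith⟩).1
        have k2 := (s2 ⟨by linarith, le_rfl⟩).2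
        exact Icc_subset_Icc (by linarith) (by linarith)
      have e1 := abs_centered_difference_sub_le hhpos hM h1 h2
        (m := (j : ℝ) / N) fun y hy z hz => hl y (hsub hy) z (hsub hz)
      have e2 := abs_le.1 (hmul _ (hη j hj0 hjN))
      have e3 : (f (j / N + h) - f (j / N - h)) / (2 * h) = N * (f (j / N + h) - f (j / N - h)) := by
        rw [div_eq_iff (by positivity), mul_right_comm, hNh, one_mul]
      rw [e3, hMN2] at e1
      have e1 := abs_le.1 e1
      rw [gap, pad_of_mem hm1, pad_of_mem hm2, g1, g2, abs_le]
      constructor <;> linarith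

namespace RegularityBounds

variable {c₀ C₀ M : ℝ} {X : ℝ → ℝ → ℝ}

lemma continuousOn_integral (h : RegularityBounds c₀ C₀ M X) (hX : ClassicalSolution X)
    {a b : ℝ} (ha : a ∈ Icc (0 : ℝ) 1) (hb : b ∈ Icc (0 : ℝ) 1) :
    ContinuousOn (fun t => ∫ w in a..b, X t w) (Ici 0) := by
  have hc : ∀ t, 0 ≤ t → Continuous (X t) := fun t ht =>
    (hX.solves t ht 0 ⟨le_rfl, zero_le_one⟩).1.continuous
  have hlip : ∀ s, 0 ≤ s → ∀ t, 0 ≤ t → ∀ w ∈ Icc (0 : ℝ) 1, |X s w - X t w| ≤ M * |s - t| := by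
    have key : ∀ s, 0 ≤ s → ∀ t, s ≤ t → ∀ w ∈ Icc (0 : ℝ) 1,
        |X s w - X t w| ≤ M * |s - t| := by
      intro s hs t hst w hw
      have := h.shift s hs (t - s) (by linarith) w hw
      rw [add_sub_cancel] at this
      rwa [abs_sub_comm, abs_sub_comm s, abs_of_nonneg (by linarith : 0 ≤ t - s)]
    intro s hs t ht w hw
    rcases le_total s t with hst | hst
    · exact key s hs t hst w hw
    · rw [abs_sub_comm, abs_sub_comm s]; exact key t ht s hst w hw
  refine (LipschitzOnWith.of_dist_le' (K := M * |b - a|) fun s hs t ht => ?_).continuousOn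
  rw [Real.dist_eq, Real.dist_eq, ← intervalIntegral.integral_sub
    ((hc s hs).intervalIntegrable _ _) ((hc t ht).intervalIntegrable _ _)]
  refine (intervalIntegral.norm_integral_le_of_norm_le_const (f := fun w => X s w - X t w)
    (C := M * |s - t|)
    fun w hw => hlip s hs t ht w (uIcc_subset_Icc ha hb (uIoc_subset_uIcc hw))).trans ?_
  exact le_of_eq (by ring)

lemma hasDerivAt_integral (h : RegularityBounds c₀ C₀ M X) (hX : ClassicalSolution X)
    {a b : ℝ} (ha : a ∈ Icc (0 : ℝ) 1) (hb : b ∈ Icc (0 : ℝ) 1) {t : ℝ} (ht : 0 < t) :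
    HasDerivAt (fun t => ∫ w in a..b, X t w)
      ((1 / 4) * deriv (X t) b ^ 2 - (1 / 4) * deriv (X t) a ^ 2) t := by
  have hcd : ∀ t, 0 ≤ t → ContDiff ℝ 2 (X t) := fun t ht =>
    (hX.solves t ht 0 ⟨le_rfl, zero_le_one⟩).1
  have hsub : ∀ w ∈ uIoc a b, w ∈ Icc (0 : ℝ) 1 := fun w hw =>
    uIcc_subset_Icc ha hb (uIoc_subset_uIcc hw)
  have hd := hX.hasDerivAt ht.le
  have hc1 : Continuous (deriv (X t)) := continuous_iff_continuousAt.2 fun w =>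
    (hd.2 w).continuousAt
  have hc2 : Continuous (deriv (deriv (X t))) := by
    have := (hcd t ht.le).continuous_iteratedDeriv 2 le_rfl
    simpa [iteratedDeriv_succ] using this
  have hflux : Continuous fun w => (1 / 2) * deriv (X t) w * deriv (deriv (X t)) w := by fun_prop
  have key := (intervalIntegral.hasDerivAt_integral_of_dominated_loc_of_deriv_le
    (μ := MeasureTheory.volume) (F := X) (x₀ := t) (a := a) (b := b)
    (F' := fun t w => (1 / 2) * deriv (X t) w * deriv (deriv (X t)) w) (bound := fun _ => M)
    (Ioi_mem_nhds ht)
    (by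
      filter_upwards [Ioi_mem_nhds ht] with s hs
      exact (hcd s (le_of_lt hs)).continuous.aestronglyMeasurable)
    ((hcd t ht.le).continuous.intervalIntegrable _ _) hflux.aestronglyMeasurable
    (Eventually.of_forall fun w hw s hs =>
      hasDerivAt_right_bound (hX.solves s (le_of_lt hs) w (hsub w hw)).2 fun r hr =>
        h.shift s (le_of_lt hs) r hr.le w (hsub w hw))
    intervalIntegrable_const
    (Eventually.of_forall fun w hw s hs => (hX.solves s (le_of_lt hs) w (hsub w hw)).2)).2
  refine key.congr_deriv ?_
  exact intervalIntegral.integral_eq_sub_of_hasDerivAt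
    (f := fun w => (1 / 4) * deriv (X t) w ^ 2)
    (fun w _ => (((hd.2 w).fun_pow 2).const_mul (1 / 4)).congr_deriv (by push_cast; ring))
    (hflux.intervalIntegrable _ _)

end RegularityBounds

lemma sq_add_le_weighted {ε : ℝ} (hε : 0 < ε) (a b : ℝ) :
    (a + b) ^ 2 ≤ (1 + ε) * a ^ 2 + (1 + 1 / ε) * b ^ 2 := by
  have h : (1 + ε) * a ^ 2 + (1 + 1 / ε) * b ^ 2 - (a + b) ^ 2 = (ε * a - b) ^ 2 / ε := by
    field_simp; ring
  have : 0 ≤ (ε * a - b) ^ 2 / ε := by positivity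
  linarith

namespace RegularityBounds

variable {c₀ C₀ M : ℝ} {X : ℝ → ℝ → ℝ} {N : ℕ} {x : ℝ → ℕ → ℝ}

lemma cellDefect_bounds (h : RegularityBounds c₀ C₀ M X) (hX : ClassicalSolution X) (hM : 0 ≤ M)
    (hN : 1 ≤ N) {t : ℝ} (ht : 0 ≤ t) :
    |cellDefect N (fun w => X t w - X 0 w) (grid N 1)| ≤ M / (2 * (N : ℝ) ^ 3) ∧
    |cellDefect N (fun w => X t w - X 0 w) (grid N N)| ≤ M / (2 * (N : ℝ) ^ 3) ∧
    ∀ i, 1 ≤ i → i < N → |cellDefect N (fun w => X t w - X 0 w) (grid N (i + 1)) -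
      cellDefect N (fun w => X t w - X 0 w) (grid N i)| ≤ M / (2 * (N : ℝ) ^ 3) := by
  have d1 := hX.hasDerivAt ht
  have d0 := hX.hasDerivAt le_rfl
  have z1 := h.deriv_two_zero t ht
  have z0 := h.deriv_two_zero 0 le_rfl
  refine abs_cellDefect_bounds hN (q₁ := fun w => deriv (X t) w - deriv (X 0) w)
    (q₂ := fun w => deriv (deriv (X t)) w - deriv (deriv (X 0)) w)
    (fun w => (d1.1 w).sub (d0.1 w)) (fun w => (d1.2 w).sub (d0.2 w))
    (fun y hy z hz => ?_) (by simp only [z1.1, z0.1, sub_zero])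
    (by simp only [z1.2, z0.2, sub_zero]) hM
  have e1 := abs_le.1 (h.deriv_two_lipschitz t ht y hy z hz)
  have e0 := abs_le.1 (h.deriv_two_lipschitz 0 le_rfl y hy z hz)
  rw [abs_le]
  constructor <;> linarith

lemma cellDefect_sq_le (h : RegularityBounds c₀ C₀ M X) (hX : ClassicalSolution X) (hM : 0 ≤ M)
    (hN : 1 ≤ N) {t : ℝ} (ht : 0 ≤ t) {i : ℕ} (hi : i ∈ Finset.Icc 1 N) :
    cellDefect N (fun w => X t w - X 0 w) (grid N i) ^ 2 ≤
      M * min 1 t / (16 * (N : ℝ) ^ 4) := by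
  have d1 := hX.hasDerivAt ht
  have d0 := hX.hasDerivAt le_rfl
  have hm : 0 ≤ M * min 1 t := mul_nonneg hM (le_min zero_le_one ht)
  have := abs_cellDefect_le hN (m := grid N i) (B := √(M * min 1 t))
    (f := fun w => X t w - X 0 w) (f₁ := fun w => deriv (X t) w - deriv (X 0) w)
    (f₂ := fun w => deriv (deriv (X t)) w - deriv (deriv (X 0)) w)
    (fun w => (d1.1 w).sub (d0.1 w)) (fun w => (d1.2 w).sub (d0.2 w))
    (fun w hw => Real.abs_le_sqrt (h.deriv_two_initial t ht w (cell_subset hN hi hw)))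
  rw [← sq_abs]
  refine (pow_le_pow_left₀ (abs_nonneg _) this 2).trans (le_of_eq ?_)
  rw [div_pow, Real.sq_sqrt hm]
  ring

lemma mean_sq_sub_corrected_le (h : RegularityBounds c₀ C₀ M X) (hX : ClassicalSolution X)
    (hM : 0 ≤ M) (hx : DiscreteFlow N x) (hN : 1 ≤ N) (hc₀ : 0 < c₀)
    (hinit : ∀ j ≤ N, c₀ / N ≤ gap N (x 0) j ∧ gap N (x 0) j ≤ C₀ / N) {t : ℝ} (ht : 0 ≤ t) :
    (1 / (N : ℝ)) * ∑ i ∈ Finset.Icc 1 N, (x ((N : ℝ) ^ 3 * t) i -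
        (X t (grid N i) + cellDefect N (fun w => X t w - X 0 w) (grid N i))) ^ 2 ≤
      Real.exp (-(c₀ / 2) * t) *
        ((1 / (N : ℝ)) * ∑ i ∈ Finset.Icc 1 N, (x 0 i - X 0 (grid N i)) ^ 2) +
      4 * C₀ * M ^ 2 / c₀ / (N : ℝ) ^ 4 := by
  have hpos : (0 : ℝ) < N := by exact_mod_cast hN
  have hmem1 : 1 ∈ Finset.Icc 1 N := Finset.mem_Icc.2 ⟨le_rfl, hN⟩
  have hmemN : N ∈ Finset.Icc 1 N := Finset.mem_Icc.2 ⟨hN, le_rfl⟩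
  have hc : ∀ t, 0 ≤ t → Continuous (X t) := fun t ht =>
    (hX.solves t ht 0 ⟨le_rfl, zero_le_one⟩).1.continuous
  set Y : ℝ → ℕ → ℝ := fun t i =>
    X t (grid N i) + cellDefect N (fun w => X t w - X 0 w) (grid N i) with hY
  have hYavg : ∀ t, 0 ≤ t → ∀ i, Y t i =
      cellAverage N (X t) (grid N i) - cellDefect N (X 0) (grid N i) := by
    intro t ht i
    simp only [hY]
    rw [cellDefect_sub (hc t ht) (hc 0 le_rfl), cellDefect]
    ring
  have hnode : ∀ j ≤ N, ((j : ℝ) / N) ∈ Icc (0 : ℝ) 1 := fun j hj =>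
    ⟨by positivity, (div_le_one hpos).2 (by exact_mod_cast hj)⟩
  have hYcell : ∀ t, 0 ≤ t → ∀ i, Y t (i + 1) =
      N * (∫ w in ((i : ℝ) / N)..(((i + 1 : ℕ) : ℝ) / N), X t w) -
        cellDefect N (X 0) (grid N (i + 1)) := by
    intro t ht i
    rw [hYavg t ht, cellAverage, grid_sub hN, grid_add hN]
  have hYcont : ∀ i < N, ContinuousOn (fun t => Y t (i + 1)) (Ici 0) := by
    intro i hi
    refine ContinuousOn.congr ?_ fun t ht => hYcell t ht i
    exact ((h.continuousOn_integral hX (hnode i hi.le) (hnode (i + 1) hi)).const_mul _).sub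
      continuousOn_const
  have hYder : ∀ t, 0 < t → ∀ i < N, HasDerivAt (fun t => Y t (i + 1))
      (N * ((1 / 4) * deriv (X t) ((i + 1 : ℕ) / N) ^ 2 - (1 / 4) * deriv (X t) (i / N) ^ 2)) t := by
    intro t ht i hi
    refine HasDerivAt.congr_of_eventuallyEq ?_ (f₁ := fun t => Y t (i + 1))
      (f := fun t => N * (∫ w in ((i : ℝ) / N)..(((i + 1 : ℕ) : ℝ) / N), X t w) -
        cellDefect N (X 0) (grid N (i + 1))) ?_
    · exact ((h.hasDerivAt_integral hX (hnode i hi.le) (hnode (i + 1) hi) ht).const_mul _).sub_const _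
    · filter_upwards [Ioi_mem_nhds ht] with s hs
      exact hYcell s (le_of_lt hs) i
  set e : ℝ → ℕ → ℝ := fun t i => pad N (x ((N : ℝ) ^ 3 * t)) i - pad N (Y t) i with he
  have hei : ∀ t, ∀ i ∈ Finset.Icc 1 N, e t i = x ((N : ℝ) ^ 3 * t) i - Y t i :=
    fun t i hi => by simp only [he]; rw [pad_of_mem hi, pad_of_mem hi]
  have key := mean_sq_le hN (e := e)
    (G := fun t j => (1 / 4) * (N * gap N (x ((N : ℝ) ^ 3 * t)) j) ^ 2 -
      (1 / 4) * deriv (X t) (j / N) ^ 2)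
    (S := fun t j => N * gap N (x ((N : ℝ) ^ 3 * t)) j + deriv (X t) (j / N))
    (ρ := fun t j => N * gap N (Y t) j - deriv (X t) (j / N)) (s₀ := 2 * c₀)
    (s₁ := 2 * C₀) (r := 2 * M / (N : ℝ) ^ 2) (by positivity)
    (fun i hi => by
      have hi' := Finset.mem_Icc.1 hi
      obtain ⟨k, rfl⟩ : ∃ k, i = k + 1 := ⟨i - 1, by omega⟩
      simp only [hei _ _ hi]
      exact ContinuousOn.sub (fun t ht => (hx.hasDerivAt_rescaled ht
        (by omega)).continuousAt.continuousWithinAt) (hYcont k (by omega)))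
    (fun t ht i hi => by
      simp only [hei _ _ (Finset.mem_Icc.2 ⟨by omega, hi⟩ : i + 1 ∈ Finset.Icc 1 N)]
      refine ((hx.hasDerivAt_rescaled ht.le hi).sub (hYder t ht i hi)).congr_deriv ?_
      ring)
    (fun t ht => by rw [hei t 1 hmem1]; exact pad_sub_zero N _ _)
    (fun t ht => by rw [hei t N hmemN]; exact pad_sub_last N _ _)
    (fun t ht j hj => by
      simp only [he, gap]
      ring)
    (fun t ht j hj => by
      obtain ⟨k1, k2⟩ := hx.gap_bounds hN (by positivity : 0 < c₀ / N) hinit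
        (by positivity : 0 ≤ (N : ℝ) ^ 3 * t) hj
      rw [div_le_iff₀' hpos] at k1
      rw [le_div_iff₀' hpos] at k2
      have := h.slope t ht.le _ (hnode j hj)
      constructor <;> linarith)
    (fun t ht j hj => by
      have d := hX.hasDerivAt ht.le
      have z := h.deriv_two_zero t ht.le
      obtain ⟨b1, b2, b3⟩ := h.cellDefect_bounds hX hM hN ht.le
      exact abs_gap_sub_deriv_le hN hM d.1 d.2 (h.deriv_two_lipschitz t ht.le)
        (hX.zero t ht.le) (hX.one t ht.le) z.1 z.2
        (η := fun i => cellDefect N (fun w => X t w - X 0 w) (grid N i)) b1 b2 b3 hj) ht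
  have hY0 : ∀ i, Y 0 i = X 0 (grid N i) := fun i => by
    simp [hY, cellDefect, cellAverage]
  have hsum : ∀ t, ∑ i ∈ Finset.Icc 1 N, e t i ^ 2 =
      ∑ i ∈ Finset.Icc 1 N, (x ((N : ℝ) ^ 3 * t) i - Y t i) ^ 2 := fun t =>
    Finset.sum_congr rfl fun i hi => by rw [hei t i hi]
  rw [hsum, hsum] at key
  simp only [hY0, mul_zero] at key
  refine key.trans (le_of_eq ?_)
  congr 1
  · congr 3; ring
  · field_simp; ring

/-- Uniform-in-time quantitative comparison of the discrete and continuous flows. -/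
lemma mean_sq_sub_le (h : RegularityBounds c₀ C₀ M X) (hX : ClassicalSolution X)
    (hM : 0 ≤ M) (hx : DiscreteFlow N x) (hN : 1 ≤ N) (hc₀ : 0 < c₀) (hC₀ : 0 < C₀)
    (hinit : ∀ j ≤ N, c₀ / N ≤ gap N (x 0) j ∧ gap N (x 0) j ≤ C₀ / N) {t : ℝ} (ht : 0 ≤ t) :
    (1 / (N : ℝ)) * ∑ i ∈ Finset.Icc 1 N, (x ((N : ℝ) ^ 3 * t) i - X t (grid N i)) ^ 2 ≤
      Real.exp (-(c₀ / 4) * t) *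
        ((1 / (N : ℝ)) * ∑ i ∈ Finset.Icc 1 N, (x 0 i - X 0 (grid N i)) ^ 2) +
      ((1 + c₀ / 4) * (4 * C₀ * M ^ 2 / c₀) + M + M / (c₀ / 4)) / (N : ℝ) ^ 4 := by
  have hpos : (0 : ℝ) < N := by exact_mod_cast hN
  have hκ : 0 < c₀ / 4 := by positivity
  rcases ht.eq_or_lt with rfl | ht0
  · rw [mul_zero, mul_zero, Real.exp_zero, one_mul]
    exact le_add_of_nonneg_right (by positivity)
  set m := min 1 t with hm
  have hm0 : 0 < m := lt_min one_pos ht0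
  have hm1 : m ≤ 1 := min_le_left _ _
  have hmt : m ≤ t := min_le_right _ _
  set κ := c₀ / 4 with hκd
  set A := 4 * C₀ * M ^ 2 / c₀ with hA
  have hA0 : 0 ≤ A := by positivity
  set η : ℕ → ℝ := fun i => cellDefect N (fun w => X t w - X 0 w) (grid N i) with hη
  set E := (1 / (N : ℝ)) * ∑ i ∈ Finset.Icc 1 N, (x 0 i - X 0 (grid N i)) ^ 2 with hE
  have hE0 : 0 ≤ E := by positivity
  have h1 := h.mean_sq_sub_corrected_le hX hM hx hN hc₀ hinit ht
  set F := (1 / (N : ℝ)) * ∑ i ∈ Finset.Icc 1 N, (x ((N : ℝ) ^ 3 * t) i -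
        (X t (grid N i) + η i)) ^ 2 with hF
  have h2 : ∀ i ∈ Finset.Icc 1 N, η i ^ 2 ≤ M * m / (N : ℝ) ^ 4 := fun i hi =>
    (h.cellDefect_sq_le hX hM hN ht hi).trans (by gcongr; linarith [pow_pos hpos 4])
  have hstep : (1 / (N : ℝ)) * ∑ i ∈ Finset.Icc 1 N, (x ((N : ℝ) ^ 3 * t) i - X t (grid N i)) ^ 2 ≤
      (1 + κ * m) * F + (1 + 1 / (κ * m)) * (M * m / (N : ℝ) ^ 4) := by
    have : ∀ i ∈ Finset.Icc 1 N, (x ((N : ℝ) ^ 3 * t) i - X t (grid N i)) ^ 2 ≤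
        (1 + κ * m) * (x ((N : ℝ) ^ 3 * t) i - (X t (grid N i) + η i)) ^ 2 +
          (1 + 1 / (κ * m)) * (M * m / (N : ℝ) ^ 4) := by
      intro i hi
      have := sq_add_le_weighted (by positivity : 0 < κ * m)
        (x ((N : ℝ) ^ 3 * t) i - (X t (grid N i) + η i)) (η i)
      rw [show x ((N : ℝ) ^ 3 * t) i - (X t (grid N i) + η i) + η i =
        x ((N : ℝ) ^ 3 * t) i - X t (grid N i) by ring] at this
      refine this.trans ?_
      gcongr
      exact h2 i hi
    have := mul_le_mul_of_nonneg_left (Finset.sum_le_sum this)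
      (by positivity : (0 : ℝ) ≤ 1 / N)
    refine this.trans (le_of_eq ?_)
    rw [Finset.sum_add_distrib, ← Finset.mul_sum, Finset.sum_const, Nat.card_Icc,
      Nat.add_sub_cancel, nsmul_eq_mul, hF]
    field_simp
  have hexp : (1 + κ * m) * Real.exp (-(c₀ / 2) * t) ≤ Real.exp (-κ * t) := by
    have e1 : 1 + κ * m ≤ Real.exp (κ * t) := by
      have := Real.add_one_le_exp (κ * t)
      have : κ * m ≤ κ * t := by gcongr
      linarith
    calc _ ≤ Real.exp (κ * t) * Real.exp (-(c₀ / 2) * t) := by gcongr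
      _ = _ := by rw [← Real.exp_add, hκd]; congr 1; ring
  have hrest : (1 + 1 / (κ * m)) * (M * m / (N : ℝ) ^ 4) ≤ (M + M / κ) / (N : ℝ) ^ 4 := by
    rw [show (1 + 1 / (κ * m)) * (M * m / (N : ℝ) ^ 4) = (M * m + M / κ) / (N : ℝ) ^ 4 by
      field_simp]
    gcongr
    exact mul_le_of_le_one_right hM hm1
  calc _ ≤ (1 + κ * m) * F + (1 + 1 / (κ * m)) * (M * m / (N : ℝ) ^ 4) := hstep
    _ ≤ (1 + κ * m) * (Real.exp (-(c₀ / 2) * t) * E + A / (N : ℝ) ^ 4) +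
        (M + M / κ) / (N : ℝ) ^ 4 := by gcongr
    _ = (1 + κ * m) * Real.exp (-(c₀ / 2) * t) * E + ((1 + κ * m) * A + M + M / κ) / (N : ℝ) ^ 4 := by
        ring
    _ ≤ Real.exp (-κ * t) * E + ((1 + κ) * A + M + M / κ) / (N : ℝ) ^ 4 := by
        gcongr
        exact mul_le_of_le_one_right hκ.le hm1

end RegularityBounds

end

theorem quantization_convergence_rho_one
    (c0 C0 K α : ℝ) (hc0 : 0 < c0) (hC0 : 0 < C0) (hK : 0 < K) (hα : 0 < α) :
    ∃ c' C' : ℝ, 0 < c' ∧ 0 < C' ∧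
      ∀ (N : ℕ), 1 ≤ N →
      ∀ (x : ℝ → ℕ → ℝ) (X : ℝ → ℝ → ℝ),
        -- the discrete gradient flow of `F_{N,2}` (with `ρ ≡ 1`)
        (∀ t, 0 ≤ t → ∀ i ∈ Finset.Icc 1 N,
          HasDerivAt (fun s => x s i)
            ((1 / 4) * ((pad N (x t) (i + 1) - pad N (x t) i) ^ 2
              - (pad N (x t) i - pad N (x t) (i - 1)) ^ 2)) t) →
        -- spatial regularity of the continuous solution
        (∀ t, 0 ≤ t → ContDiff ℝ 2 (X t)) →
        -- the continuous gradient flow PDE `∂ₜX = (1/2) ∂_θX ∂²_θθX`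
        (∀ t, 0 ≤ t → ∀ θ ∈ Set.Icc (0 : ℝ) 1,
          HasDerivAt (fun s => X s θ)
            ((1 / 2) * deriv (X t) θ * deriv (deriv (X t)) θ) t) →
        -- Dirichlet boundary conditions
        (∀ t, 0 ≤ t → X t 0 = 0 ∧ X t 1 = 1) →
        -- `X₀ ∈ C^{4,α}([0,1])` with norm bounded by `K`
        C4HolderBound α K (X 0) →
        -- initial spacing of the discrete points
        (∀ i ∈ Finset.Icc 1 (N + 1),
          c0 / N ≤ pad N (x 0) i - pad N (x 0) (i - 1) ∧
            pad N (x 0) i - pad N (x 0) (i - 1) ≤ C0 / N) →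
        -- monotonicity of the initial datum
        (∀ θ ∈ Set.Icc (0 : ℝ) 1, c0 ≤ deriv (X 0) θ ∧ deriv (X 0) θ ≤ C0) →
        -- conclusion 1: uniform-in-time L² bound for `x̄ⁱ(t) := xⁱ(N³t)` vs `Xⁱ(t)`
        (∀ t, 0 ≤ t →
          (1 / (N : ℝ)) * ∑ i ∈ Finset.Icc 1 N,
              (x ((N : ℝ) ^ 3 * t) i - X t (grid N i)) ^ 2 ≤
            Real.exp (-c' * t) *
              ((1 / (N : ℝ)) * ∑ i ∈ Finset.Icc 1 N, (x 0 i - X 0 (grid N i)) ^ 2)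
              + C' / (N : ℝ) ^ 4)
        -- conclusion 2: `MK₁(μ_t^N, dθ) ≤ 1/(4N) + C' e^{-c't/N³} + C'/N²`
        ∧ (∀ t, 0 ≤ t → ∀ φ : ℝ → ℝ, LipschitzWith 1 φ →
            (1 / (N : ℝ)) * ∑ i ∈ Finset.Icc 1 N, φ (x t i) - ∫ θ in (0 : ℝ)..1, φ θ ≤
              1 / (4 * (N : ℝ)) + C' * Real.exp (-c' * t / (N : ℝ) ^ 3) + C' / (N : ℝ) ^ 2)
        -- conclusion 3: for `t ≥ 2N³ log N / c'`
        ∧ (∀ t, 2 * (N : ℝ) ^ 3 * Real.log N / c' ≤ t → ∀ φ : ℝ → ℝ, LipschitzWith 1 φ →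
            (1 / (N : ℝ)) * ∑ i ∈ Finset.Icc 1 N, φ (x t i) - ∫ θ in (0 : ℝ)..1, φ θ ≤
              1 / (4 * (N : ℝ)) + 2 * C' / (N : ℝ) ^ 2) := by
  obtain ⟨M, hM, H⟩ := ClassicalSolution.exists_regularityBounds hc0 hC0 hK
  set A := (1 + c0 / 4) * (4 * C0 * M ^ 2 / c0) + M + M / (c0 / 4) with hA
  have hApos : 0 < A := by positivity
  refine ⟨c0 / 8, A + (C0 + 1), by positivity, by positivity, ?_⟩
  intro N hN x X hflow hreg hpde hbc hhol hspace hslope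
  have hpos : (0 : ℝ) < N := by exact_mod_cast hN
  have hX : ClassicalSolution X :=
    ⟨fun t ht θ hθ => ⟨hreg t ht, hpde t ht θ hθ⟩, fun t ht => (hbc t ht).1,
      fun t ht => (hbc t ht).2⟩
  have hb := H X hX ⟨hhol.1.of_le (by norm_num),
    fun k hk => hhol.2.1 k (by omega), hslope⟩
  have hx : DiscreteFlow N x := by
    intro t ht i hi
    refine (hflow t ht i hi).congr_deriv ?_
    rw [gap, gap, Nat.sub_add_cancel (Finset.mem_Icc.1 hi).1]
  have hinit : ∀ j ≤ N, c0 / N ≤ gap N (x 0) j ∧ gap N (x 0) j ≤ C0 / N := by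
    intro j hj
    have := hspace (j + 1) (Finset.mem_Icc.2 ⟨by omega, by omega⟩)
    rwa [Nat.add_sub_cancel] at this
  have hconv : ∀ t, 0 ≤ t → ∀ φ : ℝ → ℝ, LipschitzWith 1 φ →
      (1 / (N : ℝ)) * ∑ i ∈ Finset.Icc 1 N, φ (x t i) - ∫ θ in (0 : ℝ)..1, φ θ ≤
        1 / (4 * (N : ℝ)) + (A + (C0 + 1)) * Real.exp (-(c0 / 8) * t / (N : ℝ) ^ 3) := by
    intro t ht φ hφ
    refine (hx.mean_sub_integral_le hN hc0 hC0 hinit ht hφ).trans (add_le_add_right ?_ _)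
    exact mul_le_mul_of_nonneg_right (by linarith) (Real.exp_pos _).le
  refine ⟨fun t ht => ?_, fun t ht φ hφ => ?_, fun t ht φ hφ => ?_⟩
  · refine (hb.mean_sq_sub_le hX hM.le hx hN hc0 hC0 hinit ht).trans ?_
    rw [← hA]
    gcongr
    · linarith
    · linarith
  · exact (hconv t ht φ hφ).trans (le_add_of_nonneg_right (by positivity))
  · have hlog : 0 ≤ Real.log N := Real.log_nonneg (by exact_mod_cast hN)
    have ht0 : 0 ≤ t := le_trans (by positivity) ht
    have hexp : Real.exp (-(c0 / 8) * t / (N : ℝ) ^ 3) ≤ 1 / (N : ℝ) ^ 2 := by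
      have h1 : 2 * Real.log N ≤ c0 / 8 * t / (N : ℝ) ^ 3 := by
        rw [div_le_iff₀ (by positivity)] at ht
        rw [le_div_iff₀ (by positivity)]
        linarith
      calc Real.exp (-(c0 / 8) * t / (N : ℝ) ^ 3) ≤ Real.exp (-(2 * Real.log N)) := by
            rw [Real.exp_le_exp, neg_mul, neg_div]
            linarith
        _ = 1 / (N : ℝ) ^ 2 := by
            rw [Real.exp_neg, ← Nat.cast_ofNat (n := 2), Real.exp_nat_mul, Real.exp_log hpos,
              one_div]
    refine (hconv t ht0 φ hφ).trans ?_
    have h2 : (A + (C0 + 1)) * Real.exp (-(c0 / 8) * t / (N : ℝ) ^ 3) ≤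
        (A + (C0 + 1)) * (1 / (N : ℝ) ^ 2) := by gcongr
    have h3 : 0 ≤ (A + (C0 + 1)) * (1 / (N : ℝ) ^ 2) := by positivity
    have h4 : 2 * (A + (C0 + 1)) / (N : ℝ) ^ 2 =
        (A + (C0 + 1)) * (1 / (N : ℝ) ^ 2) + (A + (C0 + 1)) * (1 / (N : ℝ) ^ 2) := by ring
    linarith
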